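/- For a ∈ (0,a*) let u_a be a minimizer of e(a) and set ε_a = (∫_{ℝ²}|∇|u_a||² dx)^{−1/2}. Then ε_a has the precise asymptotic behavior ε_a = (2/a*)((a*−a)/a*)^{1/2} + o((a*−a)^{1/2}) as a ↗ a*. -/

import Mathlib

open MeasureTheory Filter Topology Set Metric

noncomputable section

/-- The plane `ℝ²` with the Euclidean norm. -/
abbrev Plane : Type := EuclideanSpace ℝ (Fin 2)

def e0 : Plane := EuclideanSpace.single (0 : Fin 2) (1 : ℝ)
def e1 : Plane := EuclideanSpace.single (1 : Fin 2) (1 : ℝ)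

/-- Partial derivatives of a complex-valued function. -/
def d0 (u : Plane → ℂ) (x : Plane) : ℂ := fderiv ℝ u x e0
def d1 (u : Plane → ℂ) (x : Plane) : ℂ := fderiv ℝ u x e1

/-- `|∇u|²` for complex-valued `u`. -/
def gradSq (u : Plane → ℂ) (x : Plane) : ℝ := ‖d0 u x‖ ^ 2 + ‖d1 u x‖ ^ 2

/-- `|∇|u||²`. -/
def gradAbsSq (u : Plane → ℂ) (x : Plane) : ℝ := ‖fderiv ℝ (fun y => ‖u y‖) x‖ ^ 2

/-- Membership in `H¹(ℝ², ℂ)` (smooth-representative formulation). -/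
def InH1 (u : Plane → ℂ) : Prop :=
  Differentiable ℝ u ∧ Integrable (fun x => ‖u x‖ ^ 2) ∧ Integrable (gradSq u)

/-- Membership in the space `𝓗 = {u ∈ H¹ : ∫ V |u|² < ∞}`. -/
def InH (V : Plane → ℝ) (u : Plane → ℂ) : Prop :=
  InH1 u ∧ Integrable (fun x => V x * ‖u x‖ ^ 2)

/-- The constraint set `S_a`. -/
def Sset (V : Plane → ℝ) (a : ℝ) : Set (Plane → ℂ) :=
  {u | InH V u ∧ (∫ x : Plane, ‖u x‖ ^ 2) = a}

/-- The momentum density `x^⊥ · (iu, ∇u)`, with `x^⊥ = (-x₂, x₁)` and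
`(iu,∇u)_j = Im(ū ∂_j u)`. -/
def momentum (u : Plane → ℂ) (x : Plane) : ℝ :=
  (-(x 1)) * ((starRingEnd ℂ) (u x) * d0 u x).im + (x 0) * ((starRingEnd ℂ) (u x) * d1 u x).im

/-- The logarithmic convolution term `∫∫ ln|x-y| |u(x)|²|u(y)|²`. -/
def logConv (u : Plane → ℂ) : ℝ :=
  ∫ x : Plane, ∫ y : Plane, Real.log ‖x - y‖ * ‖u x‖ ^ 2 * ‖u y‖ ^ 2

/-- The energy functional `E_a`. -/
def Ea (V : Plane → ℝ) (Ω : ℝ) (u : Plane → ℂ) : ℝ :=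
  (∫ x : Plane, (gradSq u x + V x * ‖u x‖ ^ 2)) + (1 / 2) * logConv u
    - (1 / 2) * (∫ x : Plane, ‖u x‖ ^ 4) - Ω * (∫ x : Plane, momentum u x)

/-- `u` is a minimizer of `e(a) = inf_{S_a} E_a`. -/
def IsMinimizer (V : Plane → ℝ) (Ω a : ℝ) (u : Plane → ℂ) : Prop :=
  u ∈ Sset V a ∧ ∀ v ∈ Sset V a, Ea V Ω u ≤ Ea V Ω v

/-- `e(a) = inf_{u ∈ S_a} E_a(u)`. -/
def eInf (V : Plane → ℝ) (Ω a : ℝ) : ℝ := sInf (Ea V Ω '' Sset V a)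

/-- `f(x) → ∞` as `|x| → ∞`. -/
def TendsInfty (f : Plane → ℝ) : Prop := ∀ M : ℝ, ∃ R : ℝ, ∀ x : Plane, R ≤ ‖x‖ → M ≤ f x

/-- Hypotheses (1.10): `0 ≤ V ∈ L^∞_loc` and `liminf_{|x|→∞} V(x)/|x|² > 0`. -/
def V110 (V : Plane → ℝ) : Prop :=
  Measurable V ∧ (∀ x, 0 ≤ V x) ∧
  (∀ R : ℝ, ∃ C : ℝ, ∀ x : Plane, ‖x‖ ≤ R → V x ≤ C) ∧
  (∃ c : ℝ, 0 < c ∧ ∃ R : ℝ, ∀ x : Plane, R ≤ ‖x‖ → c * ‖x‖ ^ 2 ≤ V x)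

/-- The set of rotational velocities `W > 0` with `V(x) - (W²/4)|x|² → ∞`;
`Ω* = sup RotSet V`. -/
def RotSet (V : Plane → ℝ) : Set ℝ :=
  {W : ℝ | 0 < W ∧ TendsInfty (fun x => V x - W ^ 2 / 4 * ‖x‖ ^ 2)}

/-- `Ω < Ω*` where `Ω* = sup RotSet V` (possibly `+∞`). -/
def SubCritical (V : Plane → ℝ) (Ω : ℝ) : Prop := ∃ W ∈ RotSet V, Ω < W

def d0R (q : Plane → ℝ) (x : Plane) : ℝ := fderiv ℝ q x e0
def d1R (q : Plane → ℝ) (x : Plane) : ℝ := fderiv ℝ q x e1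

/-- `|∇q|²` for real-valued `q`. -/
def gradSqR (q : Plane → ℝ) (x : Plane) : ℝ := (d0R q x) ^ 2 + (d1R q x) ^ 2

/-- The Laplacian of a real-valued function. -/
def lapR (q : Plane → ℝ) (x : Plane) : ℝ := fderiv ℝ (d0R q) x e0 + fderiv ℝ (d1R q) x e1

/-- `Q` is the positive radially symmetric `H¹` solution of `-ΔQ + Q - Q³ = 0` on `ℝ²`. -/
def IsGroundState (Q : Plane → ℝ) : Prop :=
  ContDiff ℝ 2 Q ∧ (∀ x, 0 < Q x) ∧ (∀ x y : Plane, ‖x‖ = ‖y‖ → Q x = Q y) ∧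
  Integrable (fun x => (Q x) ^ 2) ∧ Integrable (fun x => ‖fderiv ℝ Q x‖ ^ 2) ∧
  (∀ x, - lapR Q x + Q x - (Q x) ^ 3 = 0)

/-- The Laplacian of a complex-valued function. -/
def lapC (u : Plane → ℂ) (x : Plane) : ℂ := fderiv ℝ (d0 u) x e0 + fderiv ℝ (d1 u) x e1

/-- The Euler–Lagrange equation (1.18):
`-Δu + V u + (∫ ln|x-y||u(y)|² dy) u + iΩ (x^⊥·∇u) = μ u + |u|² u`. -/
def EulerLagrange (V : Plane → ℝ) (Ω : ℝ) (u : Plane → ℂ) (μ : ℝ) : Prop :=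
  ∀ x : Plane,
    - lapC u x + (V x : ℂ) * u x
      + (((∫ y : Plane, Real.log ‖x - y‖ * ‖u y‖ ^ 2) : ℝ) : ℂ) * u x
      + Complex.I * (Ω : ℂ) * (((-(x 1) : ℝ) : ℂ) * d0 u x + ((x 0 : ℝ) : ℂ) * d1 u x)
    = (μ : ℂ) * u x + ((‖u x‖ ^ 2 : ℝ) : ℂ) * u x

/-- Condition (V): `0 ≤ V_Ω ∈ C^α_loc`, `V_Ω` vanishes only at the origin, and `V` has at
most exponential growth. Here `V_Ω(x) = V(x) - (Ω²/4)|x|²`. -/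
def CondV (V : Plane → ℝ) (Ω α : ℝ) : Prop :=
  α ∈ Ioo (0 : ℝ) 1 ∧
  (∀ x : Plane, 0 ≤ V x - Ω ^ 2 / 4 * ‖x‖ ^ 2) ∧
  (∀ x : Plane, V x - Ω ^ 2 / 4 * ‖x‖ ^ 2 = 0 ↔ x = 0) ∧
  (∀ R : ℝ, 0 < R → ∃ C : ℝ, ∀ x ∈ closedBall (0 : Plane) R, ∀ y ∈ closedBall (0 : Plane) R,
    |(V x - Ω ^ 2 / 4 * ‖x‖ ^ 2) - (V y - Ω ^ 2 / 4 * ‖y‖ ^ 2)| ≤ C * ‖x - y‖ ^ α) ∧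
  (∃ C γ : ℝ, 0 < γ ∧ ∀ x : Plane, V x ≤ C * Real.exp (γ * ‖x‖))

/-- `ε_a = (∫ |∇|u_a||²)^{-1/2}` for a family of minimizers. -/
def epsOf (u : ℝ → Plane → ℂ) (a : ℝ) : ℝ :=
  (∫ x : Plane, gradAbsSq (u a) x) ^ (-(1 : ℝ) / 2)

/-- The rescaled family
`w_a(y) = ε_a u_a(ε_a y + x_a) e^{-i((ε_a Ω/2) y·x_a^⊥ - θ)}`. -/
def wfam (Ω : ℝ) (u : ℝ → Plane → ℂ) (xa : ℝ → Plane) (a θv : ℝ) (y : Plane) : ℂ :=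
  ((epsOf u a : ℝ) : ℂ) * u a ((epsOf u a) • y + xa a) *
    Complex.exp (-Complex.I *
      ((((epsOf u a * Ω / 2) * (-(y 0) * (xa a 1) + (y 1) * (xa a 0)) - θv) : ℝ) : ℂ))

/-- The limit profile `(1/√a*) Q(x/√a*)` where `a* = ‖Q‖₂²`. -/
def Qstar (Q : Plane → ℝ) (x : Plane) : ℝ :=
  (Real.sqrt (∫ y : Plane, (Q y) ^ 2))⁻¹ * Q ((Real.sqrt (∫ y : Plane, (Q y) ^ 2))⁻¹ • x)

/-- A differentiable compactly supported function of one variable is bounded by the total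
variation of its derivative. -/
lemma enorm_le_lintegral_deriv_of_hasCompactSupport {h h' : ℝ → ℝ}
    (hd : ∀ s, HasDerivAt h (h' s) s) (hc : HasCompactSupport h) (s : ℝ) :
    ‖h s‖ₑ ≤ ∫⁻ t, ‖h' t‖ₑ := by
  by_cases hi : ∫⁻ t, ‖h' t‖ₑ = ⊤
  · rw [hi]; exact le_top
  have hm : Measurable h' := by
    have : h' = deriv h := funext fun x => ((hd x).deriv).symm
    rw [this]; exact measurable_deriv h
  have h_integrable : Integrable h' := ⟨hm.aestronglyMeasurable, lt_top_iff_ne_top.2 hi⟩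
  have hlim : Tendsto h atBot (𝓝 0) := by
    have := hc.is_zero_at_infty
    exact this.mono_left atBot_le_cocompact
  have := integral_Iic_of_hasDerivAt_of_tendsto' (f := h) (f' := h') (a := s)
    (fun x _ => hd x) h_integrable.integrableOn hlim
  rw [sub_zero] at this
  rw [← this]
  exact (enorm_integral_le_lintegral_enorm _).trans (setLIntegral_le_lintegral _ _)

/-- The identification of the plane with `ℝ × ℝ`. -/
def planeEquiv : Plane ≃ᵐ ℝ × ℝ :=
  (MeasurableEquiv.toLp 2 (Fin 2 → ℝ)).symm.trans MeasurableEquiv.finTwoArrow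

lemma planeEquiv_preserving : MeasurePreserving planeEquiv :=
  (volume_preserving_finTwoArrow ℝ).comp
    (EuclideanSpace.volume_preserving_symm_measurableEquiv_toLp (Fin 2))

lemma planeEquiv_symm_apply (p : ℝ × ℝ) : planeEquiv.symm p = p.1 • e0 + p.2 • e1 := by
  ext i
  fin_cases i <;> simp [planeEquiv, e0, e1, MeasurableEquiv.finTwoArrow, MeasurableEquiv.piFinTwo]

lemma norm_e0 : ‖e0‖ = 1 := by simp [e0]
lemma norm_e1 : ‖e1‖ = 1 := by simp [e1]

lemma lintegral_plane (F : Plane → ENNReal) (hF : Measurable F) :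
    ∫⁻ x, F x = ∫⁻ t : ℝ, ∫⁻ s : ℝ, F (s • e0 + t • e1) := by
  rw [← planeEquiv_preserving.symm.lintegral_comp hF, Measure.volume_eq_prod,
    lintegral_prod_symm']
  · simp [planeEquiv_symm_apply]
  · exact hF.comp planeEquiv.symm.measurable

lemma lintegral_plane' (F : Plane → ENNReal) (hF : Measurable F) :
    ∫⁻ x, F x = ∫⁻ s : ℝ, ∫⁻ t : ℝ, F (s • e0 + t • e1) := by
  rw [← planeEquiv_preserving.symm.lintegral_comp hF, Measure.volume_eq_prod,
    lintegral_prod]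
  · simp [planeEquiv_symm_apply]
  · exact (hF.comp planeEquiv.symm.measurable).aemeasurable

lemma enorm_le_lintegral_line {g : Plane → ℝ} (hg : Differentiable ℝ g)
    (hc : HasCompactSupport g) (p v : Plane) (hv : ‖v‖ = 1) (s : ℝ) :
    ‖g (s • v + p)‖ₑ ≤ ∫⁻ t : ℝ, ‖fderiv ℝ g (t • v + p)‖ₑ := by
  have hd : ∀ s : ℝ, HasDerivAt (fun s : ℝ => g (s • v + p)) (fderiv ℝ g (s • v + p) v) s := by
    intro s
    have h1 : HasDerivAt (fun s : ℝ => s • v + p) v s := by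
      simpa using ((hasDerivAt_id s).smul_const v).add_const p
    exact (hg (s • v + p)).hasFDerivAt.comp_hasDerivAt s h1
  have hcl : Topology.IsClosedEmbedding (fun s : ℝ => s • v + p) := by
    have : Isometry (fun s : ℝ => s • v + p) := by
      refine Isometry.of_dist_eq fun a b => ?_
      rw [dist_add_right, dist_eq_norm, ← sub_smul, norm_smul, hv, mul_one, dist_eq_norm]
    exact this.isClosedEmbedding
  have hc' : HasCompactSupport (fun s : ℝ => g (s • v + p)) := hc.comp_isClosedEmbedding hcl
  refine (enorm_le_lintegral_deriv_of_hasCompactSupport hd hc' s).trans ?_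
  refine lintegral_mono fun t => ?_
  rw [← ofReal_norm, ← ofReal_norm]
  apply ENNReal.ofReal_le_ofReal
  simpa [hv] using (fderiv ℝ g (t • v + p)).le_opNorm v

/-- The Sobolev inequality `‖g‖₂ ≤ ‖∇g‖₁` in the plane, for differentiable functions of
compact support. -/
lemma sobolev_lintegral {g : Plane → ℝ} (hg : Differentiable ℝ g) (hc : HasCompactSupport g) :
    ∫⁻ x, ‖g x‖ₑ ^ 2 ≤ (∫⁻ x, ‖fderiv ℝ g x‖ₑ) ^ 2 := by
  have hm : Measurable fun x => ‖fderiv ℝ g x‖ₑ := (measurable_fderiv ℝ g).enorm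
  have hgm : Measurable fun x => ‖g x‖ₑ ^ 2 := hg.continuous.measurable.enorm.pow_const 2
  have hL : Measurable fun p : ℝ × ℝ => (p.1 • e0 + p.2 • e1 : Plane) := by fun_prop
  have hmA : Measurable fun t : ℝ => ∫⁻ s : ℝ, ‖fderiv ℝ g (s • e0 + t • e1)‖ₑ :=
    (hm.comp hL).lintegral_prod_left'
  have hmB : Measurable fun s : ℝ => ∫⁻ t : ℝ, ‖fderiv ℝ g (s • e0 + t • e1)‖ₑ :=
    (hm.comp hL).lintegral_prod_right'
  rw [lintegral_plane _ hgm]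
  calc ∫⁻ t : ℝ, ∫⁻ s : ℝ, ‖g (s • e0 + t • e1)‖ₑ ^ 2
      ≤ ∫⁻ t : ℝ, ∫⁻ s : ℝ, (∫⁻ s : ℝ, ‖fderiv ℝ g (s • e0 + t • e1)‖ₑ) *
          ∫⁻ t : ℝ, ‖fderiv ℝ g (s • e0 + t • e1)‖ₑ := by
        refine lintegral_mono fun t => lintegral_mono fun s => ?_
        dsimp only
        rw [sq]
        refine mul_le_mul' ?_ ?_
        · exact enorm_le_lintegral_line hg hc (t • e1) e0 norm_e0 s
        · have := enorm_le_lintegral_line hg hc (s • e0) e1 norm_e1 t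
          simpa only [add_comm] using this
    _ = (∫⁻ x, ‖fderiv ℝ g x‖ₑ) ^ 2 := by
        rw [sq]
        nth_rewrite 1 [lintegral_plane _ hm]
        rw [lintegral_plane' _ hm, ← lintegral_mul_const _ hmA]
        refine lintegral_congr fun t => ?_
        rw [lintegral_const_mul _ hmB]

lemma integral_sq_le_of_lintegral {g : Plane → ℝ} (hg : Measurable g) {c : ℝ} (hc : 0 ≤ c)
    (h : ∫⁻ x, ‖g x‖ₑ ^ 2 ≤ ENNReal.ofReal c) : Integrable (fun x => g x ^ 2) ∧ ∫ x, g x ^ 2 ≤ c := by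
  have e : ∀ x, ‖g x‖ₑ ^ 2 = ENNReal.ofReal (g x ^ 2) := by
    intro x
    rw [← ofReal_norm, ← ENNReal.ofReal_pow (norm_nonneg _), Real.norm_eq_abs, sq_abs]
  simp_rw [e] at h
  constructor
  · refine ⟨(hg.pow_const 2).aestronglyMeasurable, ?_⟩
    rw [hasFiniteIntegral_iff_ofReal (Eventually.of_forall fun x => sq_nonneg _)]
    exact h.trans_lt ENNReal.ofReal_lt_top
  · rw [integral_eq_lintegral_of_nonneg_ae (Eventually.of_forall fun x => sq_nonneg _)
      (hg.pow_const 2).aestronglyMeasurable]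
    exact ENNReal.toReal_le_of_le_ofReal hc h

lemma sobolev_integral {g : Plane → ℝ} (hg : Differentiable ℝ g) (hc : HasCompactSupport g)
    (hi : Integrable fun x => ‖fderiv ℝ g x‖) :
    ∫ x, g x ^ 2 ≤ (∫ x, ‖fderiv ℝ g x‖) ^ 2 := by
  have h0 : 0 ≤ ∫ x, ‖fderiv ℝ g x‖ := integral_nonneg fun x => norm_nonneg _
  refine (integral_sq_le_of_lintegral hg.continuous.measurable (sq_nonneg _) ?_).2
  refine (sobolev_lintegral hg hc).trans (le_of_eq ?_)
  rw [ENNReal.ofReal_pow h0, ofReal_integral_eq_lintegral_ofReal hi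
    (Eventually.of_forall fun x => norm_nonneg _)]
  simp_rw [ofReal_norm]

/-- Cauchy–Schwarz for integrals of real functions. -/
lemma sq_integral_mul_le {α : Type*} [MeasurableSpace α] {μ : Measure α} {f g : α → ℝ}
    (hf : Integrable (fun x => f x ^ 2) μ) (hg : Integrable (fun x => g x ^ 2) μ)
    (hfg : Integrable (fun x => f x * g x) μ) :
    (∫ x, f x * g x ∂μ) ^ 2 ≤ (∫ x, f x ^ 2 ∂μ) * ∫ x, g x ^ 2 ∂μ := by
  have key : ∀ t : ℝ, 0 ≤ (∫ x, f x ^ 2 ∂μ) * (t * t) + (2 * ∫ x, f x * g x ∂μ) * t +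
      ∫ x, g x ^ 2 ∂μ := by
    intro t
    have h1 : ∫ x, (t * f x + g x) ^ 2 ∂μ = (∫ x, f x ^ 2 ∂μ) * (t * t) +
        (2 * ∫ x, f x * g x ∂μ) * t + ∫ x, g x ^ 2 ∂μ := by
      have : (fun x => (t * f x + g x) ^ 2) =
          fun x => (t * t) * f x ^ 2 + (2 * t) * (f x * g x) + g x ^ 2 := by
        funext x; ring
      rw [this, integral_add ((hf.const_mul _).fun_add (hfg.const_mul _)) hg,
        integral_add (hf.const_mul _) (hfg.const_mul _), integral_const_mul, integral_const_mul]
      ring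
    rw [← h1]
    exact integral_nonneg fun x => sq_nonneg _
  have := discrim_le_zero key
  rw [discrim] at this
  nlinarith

lemma integrable_mul_of_sq {α : Type*} [MeasurableSpace α] {μ : Measure α} {f g : α → ℝ}
    (hfm : AEStronglyMeasurable f μ) (hgm : AEStronglyMeasurable g μ)
    (hf : Integrable (fun x => f x ^ 2) μ) (hg : Integrable (fun x => g x ^ 2) μ) :
    Integrable (fun x => f x * g x) μ := by
  refine (hf.add hg).mono' (hfm.mul hgm) (Eventually.of_forall fun x => ?_)
  simp only [Pi.add_apply, Real.norm_eq_abs, abs_mul]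
  nlinarith [sq_nonneg (|f x| - |g x|), sq_abs (f x), sq_abs (g x), sq_nonneg (f x),
    sq_nonneg (g x)]

/-- The mass `∫ f²`. -/
def mass (f : Plane → ℝ) : ℝ := ∫ x, f x ^ 2

/-- The kinetic energy `∫ |∇f|²`. -/
def kin (f : Plane → ℝ) : ℝ := ∫ x, ‖fderiv ℝ f x‖ ^ 2

/-- The quartic integral `∫ f⁴`. -/
def quart (f : Plane → ℝ) : ℝ := ∫ x, f x ^ 4

/-- The logarithmic energy of the density `f²`. -/
def logE (f : Plane → ℝ) : ℝ := ∫ x, ∫ y, Real.log ‖x - y‖ * f x ^ 2 * f y ^ 2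

/-- Differentiable real functions of compact support with finite kinetic energy. -/
structure IsCore (f : Plane → ℝ) : Prop where
  diff : Differentiable ℝ f
  supp : HasCompactSupport f
  kin : Integrable fun x => ‖fderiv ℝ f x‖ ^ 2

lemma mass_nonneg (f : Plane → ℝ) : 0 ≤ mass f := integral_nonneg fun _ => sq_nonneg _
lemma kin_nonneg (f : Plane → ℝ) : 0 ≤ kin f := integral_nonneg fun _ => sq_nonneg _
lemma quart_nonneg (f : Plane → ℝ) : 0 ≤ quart f :=
  integral_nonneg fun _ => by positivity

lemma IsCore.integrable_pow {f : Plane → ℝ} (hf : IsCore f) {n : ℕ} (hn : n ≠ 0) :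
    Integrable fun x => f x ^ n := by
  refine (hf.diff.continuous.pow n).integrable_of_hasCompactSupport ?_
  exact hf.supp.comp_left (g := fun t : ℝ => t ^ n) (zero_pow hn)

lemma norm_sq_clm (L : Plane →L[ℝ] ℝ) : ‖L‖ ^ 2 = L e0 ^ 2 + L e1 ^ 2 := by
  have h : ∀ i, ((InnerProductSpace.toDual ℝ Plane).symm L) i =
      L (EuclideanSpace.single i 1) := by
    intro i
    rw [← InnerProductSpace.toDual_symm_apply (𝕜 := ℝ), EuclideanSpace.inner_single_right]
    simp
  rw [← LinearIsometryEquiv.norm_map (InnerProductSpace.toDual ℝ Plane).symm L,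
    EuclideanSpace.norm_sq_eq, Fin.sum_univ_two, h, h]
  simp [e0, e1]

lemma measurable_fderiv_norm_sq (f : Plane → ℝ) : Measurable fun x => ‖fderiv ℝ f x‖ ^ 2 :=
  ((measurable_fderiv ℝ f).norm).pow_const 2

/-- Weighted form of the Gagliardo–Nirenberg inequality. -/
lemma integral_weight_quart_le {w ξ : Plane → ℝ} (hw : Differentiable ℝ w)
    (hξ : Differentiable ℝ ξ) (hξ0 : ∀ x, 0 ≤ ξ x)
    (hc : HasCompactSupport fun x => ξ x * w x ^ 2) {G M : ℝ}
    (hG : ∀ x, ‖fderiv ℝ ξ x‖ ≤ G)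
    (hm : Integrable fun x => w x ^ 2) (hk : Integrable fun x => ‖fderiv ℝ (fun y => ξ y * w y) x‖ ^ 2)
    (hM : ∫ x in {x | ξ x ≠ 0}, w x ^ 2 ≤ M) :
    ∫ x, ξ x ^ 2 * w x ^ 4 ≤ 8 * M * kin (fun y => ξ y * w y) + 2 * G ^ 2 * M ^ 2 := by
  set S : Set Plane := {x | ξ x ≠ 0} with hS
  have hSm : MeasurableSet S := (hξ.continuous.measurable (measurableSet_singleton 0)).compl
  have hG0 : 0 ≤ G := (norm_nonneg _).trans (hG 0)
  have hgd : Differentiable ℝ fun x => ξ x * w x ^ 2 := hξ.mul (hw.pow 2)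
  set p : Plane → ℝ := S.indicator fun x => |w x| with hp
  set q : Plane → ℝ := fun x => ‖fderiv ℝ (fun y => ξ y * w y) x‖ with hq
  have hpm : Measurable p := hw.continuous.abs.measurable.indicator hSm
  have hqm : Measurable q := (measurable_fderiv ℝ _).norm
  have hp2 : (fun x => p x ^ 2) = S.indicator fun x => w x ^ 2 := by
    funext x
    by_cases hx : x ∈ S <;> simp [hp, hx]
  have hp2i : Integrable fun x => p x ^ 2 := by rw [hp2]; exact hm.indicator hSm
  have hp2v : ∫ x, p x ^ 2 ≤ M := by rw [hp2, integral_indicator hSm]; exact hM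
  have hp2n : 0 ≤ ∫ x, p x ^ 2 := integral_nonneg fun _ => sq_nonneg _
  have hpq : Integrable fun x => p x * q x :=
    integrable_mul_of_sq hpm.aestronglyMeasurable hqm.aestronglyMeasurable hp2i hk
  have hbound : ∀ x, ‖fderiv ℝ (fun x => ξ x * w x ^ 2) x‖ ≤ 2 * (p x * q x) + G * p x ^ 2 := by
    intro x
    by_cases hx : x ∈ S
    · have e : fderiv ℝ (fun x => ξ x * w x ^ 2) x =
          (2 * w x) • fderiv ℝ (fun y => ξ y * w y) x - (w x ^ 2) • fderiv ℝ ξ x := by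
        rw [fderiv_fun_mul (hξ x) ((hw x).fun_pow 2), fderiv_fun_mul (hξ x) (hw x),
          fderiv_fun_pow 2 (hw x)]
        ext v
        simp
        ring
      rw [e]
      refine (norm_sub_le _ _).trans ?_
      rw [norm_smul, norm_smul]
      have h1 : p x = |w x| := by simp [hp, hx]
      have h2 : ‖2 * w x‖ = 2 * |w x| := by simp
      have h3 : ‖w x ^ 2‖ = |w x| ^ 2 := by simp
      rw [h1, h2, h3]
      have := mul_le_mul_of_nonneg_left (hG x) (sq_nonneg |w x|)
      simp only [hq]
      linarith
    · have hx0 : ξ x = 0 := by simpa [hS] using hx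
      have hmin : IsLocalMin (fun x => ξ x * w x ^ 2) x := by
        refine Eventually.of_forall fun y => ?_
        simp only [hx0, zero_mul]
        exact mul_nonneg (hξ0 y) (sq_nonneg _)
      rw [hmin.fderiv_eq_zero]
      simp [hp, hx]
  have hRi : Integrable fun x => 2 * (p x * q x) + G * p x ^ 2 :=
    (hpq.const_mul 2).add (hp2i.const_mul G)
  have hgi : Integrable fun x => ‖fderiv ℝ (fun x => ξ x * w x ^ 2) x‖ :=
    hRi.mono' ((measurable_fderiv ℝ _).norm.aestronglyMeasurable)
      (Eventually.of_forall fun x => by rw [norm_norm]; exact hbound x)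
  have h1 := sobolev_integral hgd hc hgi
  have h2 : ∫ x, ‖fderiv ℝ (fun x => ξ x * w x ^ 2) x‖ ≤
      2 * (∫ x, p x * q x) + G * ∫ x, p x ^ 2 := by
    refine (integral_mono hgi hRi hbound).trans (le_of_eq ?_)
    rw [integral_add (hpq.const_mul 2) (hp2i.const_mul G), integral_const_mul, integral_const_mul]
  have h3 : (∫ x, p x * q x) ^ 2 ≤ (∫ x, p x ^ 2) * kin (fun y => ξ y * w y) :=
    sq_integral_mul_le hp2i hk hpq
  have h4 : 0 ≤ ∫ x, ‖fderiv ℝ (fun x => ξ x * w x ^ 2) x‖ := integral_nonneg fun _ => norm_nonneg _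
  have e2 : (fun x => ξ x ^ 2 * w x ^ 4) = fun x => (ξ x * w x ^ 2) ^ 2 := by funext x; ring
  rw [e2]
  have hk0 := kin_nonneg (fun y => ξ y * w y)
  have h5 := pow_le_pow_left₀ h4 h2 2
  have h6 : (∫ x, p x ^ 2) * kin (fun y => ξ y * w y) ≤ M * kin (fun y => ξ y * w y) :=
    mul_le_mul_of_nonneg_right hp2v hk0
  have h7 : G ^ 2 * (∫ x, p x ^ 2) ^ 2 ≤ G ^ 2 * M ^ 2 :=
    mul_le_mul_of_nonneg_left (pow_le_pow_left₀ hp2n hp2v 2) (sq_nonneg _)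
  nlinarith [sq_nonneg (2 * (∫ x, p x * q x) - G * ∫ x, p x ^ 2)]

/-- Smooth cutoff functions at every scale with uniformly controlled gradients. -/
lemma exists_cutoffs : ∃ G : ℝ, 0 < G ∧ ∃ η : ℝ → Plane → ℝ, ∀ R : ℝ, 0 < R →
    ContDiff ℝ 1 (η R) ∧ HasCompactSupport (η R) ∧ (∀ x, 0 ≤ η R x ∧ η R x ≤ 1) ∧
    (∀ x, ‖x‖ ≤ R → η R x = 1) ∧ (∀ x, 2 * R ≤ ‖x‖ → η R x = 0) ∧
    ∀ x, ‖fderiv ℝ (η R) x‖ ≤ G / R := by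
  let b : ContDiffBump (0 : Plane) := ⟨1, 2, one_pos, one_lt_two⟩
  have hb : ContDiff ℝ 1 b := b.contDiff
  have hbc : HasCompactSupport b := b.hasCompactSupport
  obtain ⟨G, hG⟩ : ∃ G, ∀ x, ‖fderiv ℝ b x‖ ≤ G :=
    (hb.continuous_fderiv one_ne_zero).bounded_above_of_compact_support (hbc.fderiv ℝ)
  have hG0 : 0 ≤ G := (norm_nonneg _).trans (hG 0)
  refine ⟨G + 1, by linarith, fun R x => b (R⁻¹ • x), fun R hR => ?_⟩
  have hR' : R⁻¹ ≠ 0 := inv_ne_zero hR.ne'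
  refine ⟨hb.comp (contDiff_const_smul _), hbc.comp_smul hR', fun x => ⟨b.nonneg, b.le_one⟩,
    fun x hx => ?_, fun x hx => ?_, fun x => ?_⟩
  · apply b.one_of_mem_closedBall
    rw [mem_closedBall_zero_iff, norm_smul, norm_inv, Real.norm_eq_abs, abs_of_pos hR]
    rw [inv_mul_le_iff₀ hR]
    exact hx.trans (mul_one R).ge
  · apply b.zero_of_le_dist
    rw [dist_zero_right, norm_smul, norm_inv, Real.norm_eq_abs, abs_of_pos hR]
    rw [le_inv_mul_iff₀ hR]; linarith
  · have : fderiv ℝ (fun x => b (R⁻¹ • x)) x = R⁻¹ • fderiv ℝ b (R⁻¹ • x) := fderiv_comp_smul _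
    rw [this, norm_smul, norm_inv, Real.norm_eq_abs, abs_of_pos hR, div_eq_inv_mul]
    exact mul_le_mul_of_nonneg_left ((hG _).trans (by linarith)) (inv_nonneg.2 hR.le)

/-- The localization identity for `χ = cos θ`, `ξ = sin θ`. -/
lemma localization_identity {w θ : Plane → ℝ} {x : Plane} (hw : DifferentiableAt ℝ w x)
    (hθ : DifferentiableAt ℝ θ x) :
    ‖fderiv ℝ (fun y => Real.cos (θ y) * w y) x‖ ^ 2 +
      ‖fderiv ℝ (fun y => Real.sin (θ y) * w y) x‖ ^ 2 =
    ‖fderiv ℝ w x‖ ^ 2 + ‖fderiv ℝ θ x‖ ^ 2 * w x ^ 2 := by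
  rw [fderiv_fun_mul hθ.cos hw, fderiv_fun_mul hθ.sin hw, fderiv_cos hθ, fderiv_sin hθ]
  simp only [norm_sq_clm]
  simp
  linear_combination (((fderiv ℝ w x) e0) ^ 2 + ((fderiv ℝ w x) e1) ^ 2 +
    w x ^ 2 * ((fderiv ℝ θ x) e0) ^ 2 + w x ^ 2 * ((fderiv ℝ θ x) e1) ^ 2) *
    Real.sin_sq_add_cos_sq (θ x)

/-- The negative part of the logarithmic kernel. -/
def negLog (z : Plane) : ℝ := Real.posLog ‖z‖⁻¹

/-- The positive part of the logarithmic kernel. -/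
def plusLog (z : Plane) : ℝ := Real.posLog ‖z‖

lemma plusLog_sub_negLog (z : Plane) : plusLog z - negLog z = Real.log ‖z‖ :=
  Real.posLog_sub_posLog_inv

lemma negLog_nonneg (z : Plane) : 0 ≤ negLog z := Real.posLog_nonneg
lemma plusLog_nonneg (z : Plane) : 0 ≤ plusLog z := Real.posLog_nonneg

lemma measurable_negLog : Measurable negLog :=
  Real.continuous_posLog.measurable.comp measurable_norm.inv

lemma continuous_plusLog : Continuous plusLog :=
  Real.continuous_posLog.comp continuous_norm

lemma plusLog_le (z : Plane) : plusLog z ≤ ‖z‖ := by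
  unfold plusLog
  rw [Real.posLog_apply]
  exact max_le (norm_nonneg _) ((Real.log_le_self (norm_nonneg z)))

lemma integrable_negLog_sq : Integrable fun z => negLog z ^ 2 := by
  have h := (integrable_fun_norm_addHaar (volume : Measure Plane)
    (f := fun r : ℝ => (Real.posLog r⁻¹) ^ 2)).2
  refine h ?_
  rw [show Module.finrank ℝ Plane - 1 = 1 by simp]
  have hdom : IntegrableOn (fun r : ℝ => (Ioc (0 : ℝ) 1).indicator (fun _ => (4 : ℝ)) r)
      (Ioi 0) := by
    refine Integrable.integrableOn ?_
    rw [integrable_indicator_iff measurableSet_Ioc]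
    exact integrableOn_const (by simp)
  refine hdom.mono' ?_ ?_
  · have : Measurable fun r : ℝ => r ^ 1 • (Real.posLog r⁻¹) ^ 2 :=
      (measurable_id.pow_const 1).smul
        ((Real.continuous_posLog.measurable.comp measurable_inv).pow_const 2)
    exact this.aestronglyMeasurable
  · refine (ae_restrict_iff' measurableSet_Ioi).2 (Eventually.of_forall fun r hr => ?_)
    have hr0 : (0 : ℝ) < r := hr
    rw [smul_eq_mul, pow_one, Real.norm_eq_abs, abs_of_nonneg (by positivity)]
    by_cases h1 : r ≤ 1
    · rw [indicator_of_mem (show r ∈ Ioc (0 : ℝ) 1 from ⟨hr0, h1⟩)]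
      have hl := Real.abs_log_mul_self_rpow_lt r (1 / 2) hr0 h1 (by norm_num)
      have hp : Real.posLog r⁻¹ = - Real.log r := by
        rw [Real.posLog_eq_log, Real.log_inv]
        rw [abs_of_pos (inv_pos.2 hr0)]
        exact (one_le_inv₀ hr0).2 h1
      rw [hp]
      have hs : r ^ (1 / 2 : ℝ) * r ^ (1 / 2 : ℝ) = r := by
        rw [← Real.rpow_add hr0]; norm_num
      have := sq_lt_sq' (neg_lt_of_abs_lt hl) (lt_of_abs_lt hl)
      calc r * (-Real.log r) ^ 2 = (Real.log r * r ^ (1 / 2 : ℝ)) ^ 2 := by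
            rw [mul_pow, sq (r ^ (1 / 2 : ℝ)), hs]; ring
        _ ≤ 4 := by norm_num at this; exact this.le
    · push Not at h1
      have hp : Real.posLog r⁻¹ = 0 := by
        rw [Real.posLog_eq_zero_iff, abs_of_pos (inv_pos.2 hr0)]
        exact inv_le_one_of_one_le₀ h1.le
      rw [hp]
      simp [indicator_apply]
      split_ifs <;> norm_num

/-- Continuous functions for which all terms of the energy are finite. -/
structure HasFiniteEnergy (f : Plane → ℝ) : Prop where
  cont : Continuous f
  sq : Integrable fun x => f x ^ 2
  quart : Integrable fun x => f x ^ 4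
  moment : Integrable fun x => ‖x‖ ^ 2 * f x ^ 2

lemma IsCore.hasFiniteEnergy {f : Plane → ℝ} (hf : IsCore f) : HasFiniteEnergy f where
  cont := hf.diff.continuous
  sq := hf.integrable_pow two_ne_zero
  quart := hf.integrable_pow four_ne_zero
  moment := by
    have hc := hf.diff.continuous
    have h : HasCompactSupport fun x => f x ^ 2 :=
      hf.supp.comp_left (g := fun t : ℝ => t ^ 2) (by simp)
    exact Continuous.integrable_of_hasCompactSupport (by fun_prop)
      (HasCompactSupport.mul_left (f := fun x : Plane => ‖x‖ ^ 2) h)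

/-- The square of the `L²` norm of the negative part of the logarithmic kernel. -/
def kernelNorm : ℝ := ∫ z, negLog z ^ 2

lemma kernelNorm_nonneg : 0 ≤ kernelNorm := integral_nonneg fun _ => sq_nonneg _

lemma integrable_negLog_sub_sq (x : Plane) : Integrable fun y => negLog (x - y) ^ 2 :=
  integrable_negLog_sq.comp_sub_left x

lemma negLog_mul_le (z : Plane) (t : ℝ) {s : ℝ} (hs : 0 < s) :
    negLog z * t ^ 2 ≤ s / 2 * negLog z ^ 2 + (1 / (2 * s)) * t ^ 4 := by
  have h : s / 2 * negLog z ^ 2 + (1 / (2 * s)) * t ^ 4 - negLog z * t ^ 2 =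
      (1 / (2 * s)) * (s * negLog z - t ^ 2) ^ 2 := by
    field_simp; ring
  have : 0 ≤ (1 / (2 * s)) * (s * negLog z - t ^ 2) ^ 2 := by positivity
  linarith

namespace HasFiniteEnergy

variable {f : Plane → ℝ}

lemma integrable_negLog_mul (hf : HasFiniteEnergy f) (x : Plane) :
    Integrable fun y => negLog (x - y) * f y ^ 2 := by
  refine (((integrable_negLog_sub_sq x).const_mul (1 / 2)).add (hf.quart.const_mul (1 / (2 * 1)))).mono'
    ((measurable_negLog.comp (measurable_const.sub measurable_id)).mul
      (hf.cont.measurable.pow_const 2)).aestronglyMeasurable (Eventually.of_forall fun y => ?_)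
  rw [Real.norm_eq_abs, abs_of_nonneg (mul_nonneg (negLog_nonneg _) (sq_nonneg _))]
  exact negLog_mul_le _ _ one_pos

lemma integral_negLog_mul_le (hf : HasFiniteEnergy f) (x : Plane) {s : ℝ} (hs : 0 < s) :
    ∫ y, negLog (x - y) * f y ^ 2 ≤ s / 2 * kernelNorm + 1 / (2 * s) * _root_.quart f := by
  refine (integral_mono (hf.integrable_negLog_mul x)
    (((integrable_negLog_sub_sq x).const_mul (s / 2)).add (hf.quart.const_mul (1 / (2 * s))))
    fun y => negLog_mul_le _ _ hs).trans (le_of_eq ?_)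
  simp only [Pi.add_apply]
  rw [integral_add ((integrable_negLog_sub_sq x).const_mul _) (hf.quart.const_mul _),
    integral_const_mul, integral_const_mul, integral_sub_left_eq_self (fun z => negLog z ^ 2)]
  rfl

lemma integrable_plusLog_mul (hf : HasFiniteEnergy f) (x : Plane) :
    Integrable fun y => plusLog (x - y) * f y ^ 2 := by
  refine ((hf.sq.const_mul (‖x‖ + 1)).add hf.moment).mono'
    ((continuous_plusLog.comp (continuous_const.sub continuous_id)).mul
      (hf.cont.pow 2)).aestronglyMeasurable (Eventually.of_forall fun y => ?_)
  rw [Real.norm_eq_abs, abs_of_nonneg (mul_nonneg (plusLog_nonneg _) (sq_nonneg _))]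
  have h1 : plusLog (x - y) ≤ ‖x‖ + 1 + ‖y‖ ^ 2 :=
    (plusLog_le _).trans ((norm_sub_le _ _).trans (by nlinarith [sq_nonneg (‖y‖ - 1 / 2)]))
  have := mul_le_mul_of_nonneg_right h1 (sq_nonneg (f y))
  simp only [Pi.add_apply]
  linarith

lemma integrable_prod_plusLog (hf : HasFiniteEnergy f) :
    Integrable fun p : Plane × Plane => plusLog (p.1 - p.2) * (f p.1 ^ 2 * f p.2 ^ 2) := by
  have h1 : Integrable fun p : Plane × Plane => f p.1 ^ 2 * f p.2 ^ 2 := hf.sq.mul_prod hf.sq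
  have h2 : Integrable fun p : Plane × Plane => (‖p.1‖ ^ 2 * f p.1 ^ 2) * f p.2 ^ 2 :=
    hf.moment.mul_prod hf.sq
  have h3 : Integrable fun p : Plane × Plane => f p.1 ^ 2 * (‖p.2‖ ^ 2 * f p.2 ^ 2) :=
    hf.sq.mul_prod hf.moment
  have hc := hf.cont
  refine (((h1.const_mul 2).add h2).add h3).mono' ?_ (Eventually.of_forall fun p => ?_)
  · have := continuous_plusLog
    exact Continuous.aestronglyMeasurable (by fun_prop)
  · rw [Real.norm_eq_abs, abs_of_nonneg (mul_nonneg (plusLog_nonneg _) (by positivity))]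
    have h1 : plusLog (p.1 - p.2) ≤ 2 + ‖p.1‖ ^ 2 + ‖p.2‖ ^ 2 :=
      (plusLog_le _).trans ((norm_sub_le _ _).trans
        (by nlinarith [sq_nonneg (‖p.1‖ - 1 / 2), sq_nonneg (‖p.2‖ - 1 / 2)]))
    have := mul_le_mul_of_nonneg_right h1 (by positivity : 0 ≤ f p.1 ^ 2 * f p.2 ^ 2)
    simp only [Pi.add_apply]
    linarith

lemma aestronglyMeasurable_prod_negLog (hf : HasFiniteEnergy f) :
    AEStronglyMeasurable (fun p : Plane × Plane => negLog (p.1 - p.2) * (f p.1 ^ 2 * f p.2 ^ 2)) := by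
  have h1 : Measurable fun p : Plane × Plane => negLog (p.1 - p.2) :=
    measurable_negLog.comp (measurable_fst.sub measurable_snd)
  have := hf.cont
  have h2 : Continuous fun p : Plane × Plane => f p.1 ^ 2 * f p.2 ^ 2 := by fun_prop
  exact (h1.mul h2.measurable).aestronglyMeasurable

lemma integral_negLog_mul_mul (x : Plane) :
    ∫ y, negLog (x - y) * (f x ^ 2 * f y ^ 2) = f x ^ 2 * ∫ y, negLog (x - y) * f y ^ 2 := by
  rw [← integral_const_mul]
  exact integral_congr_ae (Eventually.of_forall fun y => by ring)

lemma integrable_prod_negLog (hf : HasFiniteEnergy f) :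
    Integrable fun p : Plane × Plane => negLog (p.1 - p.2) * (f p.1 ^ 2 * f p.2 ^ 2) := by
  have hm := hf.aestronglyMeasurable_prod_negLog
  refine (integrable_prod_iff hm).2 ⟨Eventually.of_forall fun x => ?_, ?_⟩
  · refine ((hf.integrable_negLog_mul x).const_mul (f x ^ 2)).congr (Eventually.of_forall fun y => ?_)
    ring
  · refine (hf.sq.mul_const (1 / 2 * kernelNorm + 1 / (2 * 1) * _root_.quart f)).mono'
      hm.norm.integral_prod_right' (Eventually.of_forall fun x => ?_)
    have e : ∀ y, ‖negLog (x - y) * (f x ^ 2 * f y ^ 2)‖ = negLog (x - y) * (f x ^ 2 * f y ^ 2) :=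
      fun y => by
        rw [Real.norm_eq_abs, abs_of_nonneg (mul_nonneg (negLog_nonneg _) (by positivity))]
    simp only [e]
    rw [integral_negLog_mul_mul, Real.norm_eq_abs, abs_of_nonneg]
    · exact mul_le_mul_of_nonneg_left (hf.integral_negLog_mul_le x one_pos) (sq_nonneg _)
    · exact mul_nonneg (sq_nonneg _) (integral_nonneg fun y =>
        mul_nonneg (negLog_nonneg _) (sq_nonneg _))

end HasFiniteEnergy

/-- The repulsive part of the logarithmic energy. -/
def plusE (f : Plane → ℝ) : ℝ :=
  ∫ p : Plane × Plane, plusLog (p.1 - p.2) * (f p.1 ^ 2 * f p.2 ^ 2)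

/-- The attractive part of the logarithmic energy. -/
def negE (f : Plane → ℝ) : ℝ :=
  ∫ p : Plane × Plane, negLog (p.1 - p.2) * (f p.1 ^ 2 * f p.2 ^ 2)

lemma plusE_nonneg (f : Plane → ℝ) : 0 ≤ plusE f :=
  integral_nonneg fun _ => mul_nonneg (plusLog_nonneg _) (by positivity)

namespace HasFiniteEnergy

variable {f : Plane → ℝ}

lemma integrable_prod_log (hf : HasFiniteEnergy f) :
    Integrable fun p : Plane × Plane => Real.log ‖p.1 - p.2‖ * f p.1 ^ 2 * f p.2 ^ 2 := by
  refine (hf.integrable_prod_plusLog.sub hf.integrable_prod_negLog).congr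
    (Eventually.of_forall fun p => ?_)
  simp only [Pi.sub_apply, ← plusLog_sub_negLog]
  ring

lemma logE_eq_integral_prod (hf : HasFiniteEnergy f) :
    logE f = ∫ p : Plane × Plane, Real.log ‖p.1 - p.2‖ * f p.1 ^ 2 * f p.2 ^ 2 :=
  (integral_prod _ hf.integrable_prod_log).symm

lemma logE_eq (hf : HasFiniteEnergy f) : logE f = plusE f - negE f := by
  rw [hf.logE_eq_integral_prod, plusE, negE,
    ← integral_sub hf.integrable_prod_plusLog hf.integrable_prod_negLog]
  refine integral_congr_ae (Eventually.of_forall fun p => ?_)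
  simp only [← plusLog_sub_negLog]
  ring

lemma negE_le (hf : HasFiniteEnergy f) {s : ℝ} (hs : 0 < s) :
    negE f ≤ mass f * (s / 2 * kernelNorm + 1 / (2 * s) * _root_.quart f) := by
  have hi := hf.integrable_prod_negLog
  rw [negE, Measure.volume_eq_prod, integral_prod _ hi]
  refine (integral_mono hi.integral_prod_left (hf.sq.mul_const
    (s / 2 * kernelNorm + 1 / (2 * s) * _root_.quart f)) fun x => ?_).trans (le_of_eq ?_)
  · dsimp only
    rw [integral_negLog_mul_mul]
    exact mul_le_mul_of_nonneg_left (hf.integral_negLog_mul_le x hs) (sq_nonneg _)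
  · rw [integral_mul_const]; rfl

lemma integrable_log_mul (hf : HasFiniteEnergy f) (x : Plane) :
    Integrable fun y => Real.log ‖x - y‖ * f x ^ 2 * f y ^ 2 := by
  refine (((hf.integrable_plusLog_mul x).sub (hf.integrable_negLog_mul x)).const_mul (f x ^ 2)).congr
    (Eventually.of_forall fun y => ?_)
  simp only [Pi.sub_apply, ← plusLog_sub_negLog]
  ring

lemma integrable_integral_log (hf : HasFiniteEnergy f) :
    Integrable fun x => ∫ y, Real.log ‖x - y‖ * f x ^ 2 * f y ^ 2 :=
  hf.integrable_prod_log.integral_prod_left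

end HasFiniteEnergy

/-! ### Behaviour under multiplication, dilation and translation -/

lemma mass_const_mul (c : ℝ) (f : Plane → ℝ) : mass (fun x => c * f x) = c ^ 2 * mass f := by
  simp only [mass, mul_pow, integral_const_mul]

lemma quart_const_mul (c : ℝ) (f : Plane → ℝ) : quart (fun x => c * f x) = c ^ 4 * quart f := by
  simp only [quart, mul_pow, integral_const_mul]

lemma kin_const_mul (c : ℝ) (f : Plane → ℝ) : kin (fun x => c * f x) = c ^ 2 * kin f := by
  have : ∀ x, fderiv ℝ (fun x => c * f x) x = c • fderiv ℝ f x := fun x =>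
    congrFun (fderiv_const_smul_field (𝕜 := ℝ) (f := f) c) x
  simp only [kin, this, norm_smul, mul_pow, integral_const_mul, Real.norm_eq_abs, sq_abs]

lemma logE_const_mul (c : ℝ) (f : Plane → ℝ) : logE (fun x => c * f x) = c ^ 4 * logE f := by
  simp only [logE, ← integral_const_mul]
  refine integral_congr_ae (Eventually.of_forall fun x => ?_)
  refine integral_congr_ae (Eventually.of_forall fun y => ?_)
  ring

lemma integral_plane_comp_smul (F : Plane → ℝ) {τ : ℝ} (hτ : 0 < τ) :
    ∫ x, F (τ • x) = (τ ^ 2)⁻¹ * ∫ x, F x := by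
  rw [Measure.integral_comp_smul_of_nonneg volume F τ (hR := hτ.le)]
  simp

lemma mass_dilate (f : Plane → ℝ) {τ : ℝ} (hτ : 0 < τ) :
    mass (fun x => τ * f (τ • x)) = mass f := by
  rw [mass_const_mul, mass, integral_plane_comp_smul (fun x => f x ^ 2) hτ]
  field_simp; rfl

lemma quart_dilate (f : Plane → ℝ) {τ : ℝ} (hτ : 0 < τ) :
    quart (fun x => τ * f (τ • x)) = τ ^ 2 * quart f := by
  rw [quart_const_mul, quart, integral_plane_comp_smul (fun x => f x ^ 4) hτ]
  field_simp; rfl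

lemma kin_dilate (f : Plane → ℝ) {τ : ℝ} (hτ : 0 < τ) :
    kin (fun x => τ * f (τ • x)) = τ ^ 2 * kin f := by
  have : ∀ x, fderiv ℝ (fun x => f (τ • x)) x = τ • fderiv ℝ f (τ • x) := fun x =>
    fderiv_comp_smul _
  rw [kin_const_mul, kin]
  simp only [this, norm_smul, mul_pow, integral_const_mul, Real.norm_eq_abs, sq_abs]
  rw [integral_plane_comp_smul (fun x => ‖fderiv ℝ f x‖ ^ 2) hτ]
  field_simp; rfl

lemma HasFiniteEnergy.logE_dilate {f : Plane → ℝ} (hf : HasFiniteEnergy f) {τ : ℝ} (hτ : 0 < τ) :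
    logE (fun x => τ * f (τ • x)) = logE f - mass f ^ 2 * Real.log τ := by
  have h1 : logE (fun x => τ * f (τ • x)) = ∫ x, ∫ y,
      Real.log ‖τ⁻¹ • (x - y)‖ * f x ^ 2 * f y ^ 2 := by
    rw [logE_const_mul, logE]
    have e : ∀ x y : Plane, Real.log ‖x - y‖ * f (τ • x) ^ 2 * f (τ • y) ^ 2 =
        (fun z => Real.log ‖τ⁻¹ • (τ • x - z)‖ * f (τ • x) ^ 2 * f z ^ 2) (τ • y) := by
      intro x y
      simp only [← smul_sub, smul_smul, inv_mul_cancel₀ hτ.ne', one_smul]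
    simp_rw [e]
    have e2 : ∀ x : Plane, ∫ y : Plane, (fun z => Real.log ‖τ⁻¹ • (τ • x - z)‖ * f (τ • x) ^ 2 * f z ^ 2) (τ • y) =
      (τ ^ 2)⁻¹ * ∫ y : Plane, (Real.log ‖τ⁻¹ • (τ • x - y)‖ * f (τ • x) ^ 2 * f y ^ 2) := fun x =>
      integral_plane_comp_smul
        (fun z => Real.log ‖τ⁻¹ • (τ • x - z)‖ * f (τ • x) ^ 2 * f z ^ 2) hτ
    simp_rw [e2, integral_const_mul]
    rw [integral_plane_comp_smul (fun x' => ∫ y : Plane, (Real.log ‖τ⁻¹ • (x' - y)‖ * f x' ^ 2 * f y ^ 2)) hτ]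
    field_simp
  have h2 : ∀ x, ∫ y, Real.log ‖τ⁻¹ • (x - y)‖ * f x ^ 2 * f y ^ 2 =
      (∫ y, Real.log ‖x - y‖ * f x ^ 2 * f y ^ 2) - (Real.log τ * mass f) * f x ^ 2 := by
    intro x
    have e : (fun y => Real.log ‖τ⁻¹ • (x - y)‖ * f x ^ 2 * f y ^ 2) =ᵐ[volume]
        fun y => Real.log ‖x - y‖ * f x ^ 2 * f y ^ 2 - (Real.log τ * f x ^ 2) * f y ^ 2 := by
      have : ∀ᵐ y : Plane, y ≠ x := by
        rw [ae_iff]; simp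
      filter_upwards [this] with y hy
      have hn : ‖x - y‖ ≠ 0 := norm_ne_zero_iff.2 (sub_ne_zero.2 hy.symm)
      rw [norm_smul, Real.log_mul (by simp [hτ.ne']) hn, norm_inv, Real.log_inv,
        Real.norm_eq_abs, abs_of_pos hτ]
      ring
    rw [integral_congr_ae e, integral_sub (hf.integrable_log_mul x) (hf.sq.const_mul _),
      integral_const_mul]
    simp only [mass]; ring
  rw [h1]
  simp_rw [h2]
  rw [integral_sub hf.integrable_integral_log (hf.sq.const_mul _), integral_const_mul]
  simp only [logE, mass]; ring

lemma IsCore.const_mul {f : Plane → ℝ} (hf : IsCore f) (c : ℝ) : IsCore fun x => c * f x := by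
  refine ⟨hf.diff.const_mul c, HasCompactSupport.mul_left (f := fun _ => c) hf.supp, ?_⟩
  have : ∀ x, fderiv ℝ (fun x => c * f x) x = c • fderiv ℝ f x := fun x =>
    congrFun (fderiv_const_smul_field (𝕜 := ℝ) (f := f) c) x
  simp only [this, norm_smul, mul_pow]
  exact hf.kin.const_mul (‖c‖ ^ 2)

lemma IsCore.dilate {f : Plane → ℝ} (hf : IsCore f) {τ : ℝ} (hτ : 0 < τ) :
    IsCore fun x => τ * f (τ • x) := by
  refine IsCore.const_mul (f := fun x => f (τ • x))
    ⟨hf.diff.comp (differentiable_id.const_smul τ), hf.supp.comp_smul hτ.ne', ?_⟩ τ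
  have : ∀ x, ‖fderiv ℝ (fun x => f (τ • x)) x‖ ^ 2 = τ ^ 2 * ‖fderiv ℝ f (τ • x)‖ ^ 2 := by
    intro x
    rw [show fderiv ℝ (fun x => f (τ • x)) x = τ • fderiv ℝ f (τ • x) from fderiv_comp_smul _,
      norm_smul, mul_pow, Real.norm_eq_abs, sq_abs]
  simp_rw [this]
  exact (hf.kin.comp_smul hτ.ne').const_mul _

lemma IsCore.translate {f : Plane → ℝ} (hf : IsCore f) (z : Plane) : IsCore fun x => f (x + z) := by
  refine ⟨hf.diff.comp (differentiable_id.add_const z),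
    hf.supp.comp_homeomorph (Homeomorph.addRight z), ?_⟩
  simp_rw [fderiv_comp_add_right]
  exact hf.kin.comp_add_right z

lemma mass_translate (f : Plane → ℝ) (z : Plane) : mass (fun x => f (x + z)) = mass f :=
  integral_add_right_eq_self (fun x => f x ^ 2) z

lemma quart_translate (f : Plane → ℝ) (z : Plane) : quart (fun x => f (x + z)) = quart f :=
  integral_add_right_eq_self (fun x => f x ^ 4) z

lemma kin_translate (f : Plane → ℝ) (z : Plane) : kin (fun x => f (x + z)) = kin f := by
  simp only [kin, fderiv_comp_add_right]
  exact integral_add_right_eq_self (fun x => ‖fderiv ℝ f x‖ ^ 2) z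

lemma logE_translate (f : Plane → ℝ) (z : Plane) : logE (fun x => f (x + z)) = logE f := by
  simp only [logE]
  rw [← integral_add_right_eq_self (fun x => ∫ y, Real.log ‖x - y‖ * f x ^ 2 * f y ^ 2) z]
  refine integral_congr_ae (Eventually.of_forall fun x => ?_)
  dsimp only
  rw [← integral_add_right_eq_self (fun y => Real.log ‖x + z - y‖ * f (x + z) ^ 2 * f y ^ 2) z]
  simp

/-- Nonnegative functions with differentiable square, finite kinetic energy and finite second
moment. -/
structure Admissible (f : Plane → ℝ) : Prop where
  nonneg : ∀ x, 0 ≤ f x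
  diff : Differentiable ℝ fun x => f x ^ 2
  sq : Integrable fun x => f x ^ 2
  kin : Integrable fun x => ‖fderiv ℝ f x‖ ^ 2
  moment : Integrable fun x => ‖x‖ ^ 2 * f x ^ 2

namespace Admissible

variable {f : Plane → ℝ}

lemma continuous (hf : Admissible f) : Continuous f := by
  have h : f = fun x => Real.sqrt (f x ^ 2) := by
    funext x; rw [Real.sqrt_sq (hf.nonneg x)]
  rw [h]
  exact hf.diff.continuous.sqrt

lemma fderiv_sq (hf : Admissible f) (x : Plane) :
    fderiv ℝ (fun x => f x ^ 2) x = (2 * f x) • fderiv ℝ f x := by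
  by_cases hx : f x = 0
  · have hmin : IsLocalMin (fun x => f x ^ 2) x :=
      Eventually.of_forall fun y => by simpa [hx] using sq_nonneg (f y)
    rw [hmin.fderiv_eq_zero, hx]; simp
  · have hd : DifferentiableAt ℝ f x := by
      have h : f = fun x => Real.sqrt (f x ^ 2) := by
        funext x; rw [Real.sqrt_sq (hf.nonneg x)]
      rw [h]
      exact (hf.diff x).sqrt (pow_ne_zero 2 hx)
    rw [fderiv_fun_pow 2 hd]
    simp

lemma integrable_mul_fderiv (hf : Admissible f) : Integrable fun x => f x * ‖fderiv ℝ f x‖ :=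
  integrable_mul_of_sq hf.continuous.aestronglyMeasurable
    (measurable_fderiv ℝ f).norm.aestronglyMeasurable hf.sq hf.kin

lemma integrable_quart (hf : Admissible f) : Integrable fun x => f x ^ 4 := by
  obtain ⟨G, hG, η, hη⟩ := exists_cutoffs
  set K := ∫ x, (2 * (f x * ‖fderiv ℝ f x‖) + G * f x ^ 2)
  have hKi : Integrable fun x => 2 * (f x * ‖fderiv ℝ f x‖) + G * f x ^ 2 :=
    (hf.integrable_mul_fderiv.const_mul 2).add (hf.sq.const_mul G)
  have hpos : ∀ n : ℕ, (0 : ℝ) < n + 1 := fun n => by positivity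
  have hdiff : ∀ n : ℕ, Differentiable ℝ fun x => η (n + 1) x * f x ^ 2 := fun n =>
    ((hη _ (hpos n)).1.differentiable one_ne_zero).mul hf.diff
  have hsupp : ∀ n : ℕ, HasCompactSupport fun x => η (n + 1) x * f x ^ 2 := fun n =>
    HasCompactSupport.mul_right (f' := fun x => f x ^ 2) (hη _ (hpos n)).2.1
  have hb : ∀ (n : ℕ) x, ‖fderiv ℝ (fun x => η (n + 1) x * f x ^ 2) x‖ ≤
      2 * (f x * ‖fderiv ℝ f x‖) + G * f x ^ 2 := by
    intro n x
    obtain ⟨h1, h2, h3, h4, h5, h6⟩ := hη _ (hpos n)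
    rw [fderiv_fun_mul (h1.differentiable one_ne_zero x) (hf.diff x), hf.fderiv_sq]
    refine (norm_add_le _ _).trans ?_
    rw [norm_smul, norm_smul, norm_smul, Real.norm_eq_abs, Real.norm_eq_abs, Real.norm_eq_abs,
      abs_of_nonneg (h3 x).1, abs_of_nonneg (sq_nonneg (f x)),
      abs_of_nonneg (by have := hf.nonneg x; positivity : 0 ≤ 2 * f x)]
    have h7 : ‖fderiv ℝ (η (n + 1)) x‖ ≤ G :=
      (h6 x).trans (div_le_self hG.le (by linarith [(Nat.cast_nonneg n : (0 : ℝ) ≤ n)]))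
    have h8 := mul_le_mul_of_nonneg_left h7 (sq_nonneg (f x))
    have h9 := mul_le_of_le_one_left
      (mul_nonneg (by have := hf.nonneg x; positivity : 0 ≤ 2 * f x) (norm_nonneg (fderiv ℝ f x)))
      (h3 x).2
    linarith
  have hgi : ∀ n : ℕ, Integrable fun x => ‖fderiv ℝ (fun x => η (n + 1) x * f x ^ 2) x‖ := fun n =>
    hKi.mono' (measurable_fderiv ℝ _).norm.aestronglyMeasurable
      (Eventually.of_forall fun x => by rw [norm_norm]; exact hb n x)
  have hK0 : 0 ≤ K := integral_nonneg fun x => by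
    have := hf.nonneg x
    show 0 ≤ 2 * (f x * ‖fderiv ℝ f x‖) + G * f x ^ 2
    positivity
  have hI : ∀ n : ℕ, ∫⁻ x, ‖η (n + 1) x * f x ^ 2‖ₑ ^ 2 ≤ ENNReal.ofReal (K ^ 2) := by
    intro n
    refine (sobolev_lintegral (hdiff n) (hsupp n)).trans ?_
    rw [ENNReal.ofReal_pow hK0]
    gcongr
    have := ofReal_integral_norm_eq_lintegral_enorm (hgi n)
    simp only [norm_norm, enorm_norm] at this
    rw [← this]
    exact ENNReal.ofReal_le_ofReal (integral_mono (hgi n) hKi (hb n))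
  have hF : ∫⁻ x, ‖f x ^ 2‖ₑ ^ 2 ≤ ENNReal.ofReal (K ^ 2) := by
    have hlim : ∀ x, liminf (fun n : ℕ => ‖η (n + 1) x * f x ^ 2‖ₑ ^ 2) atTop = ‖f x ^ 2‖ₑ ^ 2 := by
      intro x
      refine Tendsto.liminf_eq (tendsto_const_nhds.congr' ?_)
      filter_upwards [eventually_ge_atTop ⌈‖x‖⌉₊] with n hn
      have : ‖x‖ ≤ (n : ℝ) + 1 := (Nat.ceil_le.1 hn).trans (by linarith)
      rw [(hη _ (hpos n)).2.2.2.1 x this, one_mul]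
    calc ∫⁻ x, ‖f x ^ 2‖ₑ ^ 2
        = ∫⁻ x, liminf (fun n : ℕ => ‖η (n + 1) x * f x ^ 2‖ₑ ^ 2) atTop := by simp_rw [hlim]
      _ ≤ liminf (fun n : ℕ => ∫⁻ x, ‖η (n + 1) x * f x ^ 2‖ₑ ^ 2) atTop :=
          lintegral_liminf_le fun n => ((hdiff n).continuous.measurable.enorm.pow_const 2)
      _ ≤ ENNReal.ofReal (K ^ 2) :=
          liminf_le_of_frequently_le' (Frequently.of_forall hI)
  have := (integral_sq_le_of_lintegral hf.diff.continuous.measurable (sq_nonneg K) hF).1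
  refine this.congr (Eventually.of_forall fun x => ?_)
  ring

lemma hasFiniteEnergy (hf : Admissible f) : HasFiniteEnergy f :=
  ⟨hf.continuous, hf.sq, hf.integrable_quart, hf.moment⟩

/-- Approximation by core functions, with control of all terms of the energy. -/
lemma exists_approx (hf : Admissible f) : ∃ v : ℕ → Plane → ℝ, (∀ n, IsCore (v n)) ∧
    Tendsto (fun n => mass (v n)) atTop (𝓝 (mass f)) ∧
    Tendsto (fun n => quart (v n)) atTop (𝓝 (quart f)) ∧
    Tendsto (fun n => logE (v n)) atTop (𝓝 (logE f)) ∧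
    ∃ k : ℕ → ℝ, (∀ n, _root_.kin (v n) ≤ k n) ∧ Tendsto k atTop (𝓝 (_root_.kin f)) := by
  obtain ⟨G, hG, η, hη⟩ := exists_cutoffs
  have hpos : ∀ n : ℕ, (0 : ℝ) < n + 1 := fun n => by positivity
  set δ : ℕ → ℝ := fun n => 1 / ((n : ℝ) + 1) with hδ
  have hδ0 : ∀ n, 0 < δ n := fun n => one_div_pos.2 (hpos n)
  have hδlim : Tendsto δ atTop (𝓝 0) := tendsto_one_div_add_atTop_nhds_zero_nat
  set s : ℕ → Plane → ℝ := fun n x => Real.sqrt (f x ^ 2 + δ n ^ 2) - δ n with hs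
  have hpos2 : ∀ n x, 0 < f x ^ 2 + δ n ^ 2 := fun n x => by have := hδ0 n; positivity
  have hs0 : ∀ n x, 0 ≤ s n x := fun n x => by
    have : δ n ≤ Real.sqrt (f x ^ 2 + δ n ^ 2) :=
      Real.le_sqrt_of_sq_le (by linarith [sq_nonneg (f x)])
    simp only [hs]; linarith
  have hsf : ∀ n x, s n x ≤ f x := fun n x => by
    have : Real.sqrt (f x ^ 2 + δ n ^ 2) ≤ f x + δ n :=
      Real.sqrt_le_iff.2 ⟨add_nonneg (hf.nonneg x) (hδ0 n).le,
        by nlinarith [mul_nonneg (hf.nonneg x) (hδ0 n).le]⟩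
    simp only [hs]; linarith
  have hsf2 : ∀ n x, f x - δ n ≤ s n x := fun n x => by
    have : f x ≤ Real.sqrt (f x ^ 2 + δ n ^ 2) :=
      Real.le_sqrt_of_sq_le (by linarith [sq_nonneg (δ n)])
    simp only [hs]; linarith
  have hsd : ∀ n, Differentiable ℝ (s n) := fun n x =>
    (((hf.diff x).add_const _).sqrt (hpos2 n x).ne').sub_const _
  have hsg : ∀ n x, ‖fderiv ℝ (s n) x‖ ≤ ‖fderiv ℝ f x‖ := fun n x => by
    have e : fderiv ℝ (s n) x = (f x / Real.sqrt (f x ^ 2 + δ n ^ 2)) • fderiv ℝ f x := by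
      simp only [hs]
      rw [fderiv_sub_const, fderiv_sqrt ((hf.diff x).add_const _) (hpos2 n x).ne',
        fderiv_add_const, hf.fderiv_sq, smul_smul]
      congr 1
      field_simp
    rw [e, norm_smul]
    refine mul_le_of_le_one_left (norm_nonneg _) ?_
    rw [Real.norm_eq_abs, abs_of_nonneg (div_nonneg (hf.nonneg x) (Real.sqrt_nonneg _))]
    refine div_le_one_of_le₀ (Real.le_sqrt_of_sq_le (by linarith [sq_nonneg (δ n)]))
      (Real.sqrt_nonneg _)
  set v : ℕ → Plane → ℝ := fun n x => η (n + 1) x * s n x with hv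
  have hv0 : ∀ n x, 0 ≤ v n x := fun n x => mul_nonneg ((hη _ (hpos n)).2.2.1 x).1 (hs0 n x)
  have hvf : ∀ n x, v n x ≤ f x := fun n x =>
    (mul_le_of_le_one_left (hs0 n x) ((hη _ (hpos n)).2.2.1 x).2).trans (hsf n x)
  have hvd : ∀ n, Differentiable ℝ (v n) := fun n =>
    ((hη _ (hpos n)).1.differentiable one_ne_zero).mul (hsd n)
  have hvc : ∀ n, Continuous (v n) := fun n => (hvd n).continuous
  have hvlim : ∀ x, Tendsto (fun n => v n x) atTop (𝓝 (f x)) := by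
    intro x
    have h1 : Tendsto (fun n => s n x) atTop (𝓝 (f x)) := by
      refine tendsto_of_tendsto_of_tendsto_of_le_of_le (g := fun n => f x - δ n) (h := fun _ => f x)
        ?_ tendsto_const_nhds (fun n => hsf2 n x) (fun n => hsf n x)
      simpa using hδlim.const_sub (f x)
    refine h1.congr' ?_
    filter_upwards [eventually_ge_atTop ⌈‖x‖⌉₊] with n hn
    have : ‖x‖ ≤ (n : ℝ) + 1 := (Nat.ceil_le.1 hn).trans (by linarith)
    simp only [hv]
    rw [(hη _ (hpos n)).2.2.2.1 x this, one_mul]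
  have hvg : ∀ n x, ‖fderiv ℝ (v n) x‖ ≤ ‖fderiv ℝ f x‖ + G * δ n * f x := by
    intro n x
    obtain ⟨h1, h2, h3, h4, h5, h6⟩ := hη _ (hpos n)
    simp only [hv]
    rw [fderiv_fun_mul (h1.differentiable one_ne_zero x) (hsd n x)]
    refine (norm_add_le _ _).trans ?_
    rw [norm_smul, norm_smul, Real.norm_eq_abs, Real.norm_eq_abs, abs_of_nonneg (h3 x).1,
      abs_of_nonneg (hs0 n x)]
    have e1 := mul_le_of_le_one_left (norm_nonneg (fderiv ℝ (s n) x)) (h3 x).2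
    have e2 : s n x * ‖fderiv ℝ (η (n + 1)) x‖ ≤ f x * (G / (n + 1)) :=
      mul_le_mul (hsf n x) (h6 x) (norm_nonneg _) (hf.nonneg x)
    have e3 : f x * (G / (n + 1)) = G * δ n * f x := by simp only [hδ]; ring
    linarith [hsg n x]
  have hRi : ∀ n, Integrable fun x =>
      ‖fderiv ℝ f x‖ ^ 2 + 2 * (G * δ n) * (f x * ‖fderiv ℝ f x‖) + (G * δ n) ^ 2 * f x ^ 2 :=
    fun n => (hf.kin.add (hf.integrable_mul_fderiv.const_mul _)).add (hf.sq.const_mul _)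
  have hkb : ∀ n x, ‖fderiv ℝ (v n) x‖ ^ 2 ≤
      ‖fderiv ℝ f x‖ ^ 2 + 2 * (G * δ n) * (f x * ‖fderiv ℝ f x‖) + (G * δ n) ^ 2 * f x ^ 2 := by
    intro n x
    have := pow_le_pow_left₀ (norm_nonneg _) (hvg n x) 2
    linarith
  have hki : ∀ n, Integrable fun x => ‖fderiv ℝ (v n) x‖ ^ 2 := fun n =>
    (hRi n).mono' (measurable_fderiv_norm_sq _).aestronglyMeasurable
      (Eventually.of_forall fun x => by
        rw [Real.norm_eq_abs, abs_of_nonneg (sq_nonneg _)]; exact hkb n x)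
  have hcore : ∀ n, IsCore (v n) := fun n => ⟨hvd n,
    HasCompactSupport.mul_right (f' := s n) (hη _ (hpos n)).2.1, hki n⟩
  refine ⟨v, hcore, ?_, ?_, ?_, fun n => _root_.kin f +
    2 * (G * δ n) * (∫ x, f x * ‖fderiv ℝ f x‖) + (G * δ n) ^ 2 * mass f, fun n => ?_, ?_⟩
  · refine tendsto_integral_of_dominated_convergence _
      (fun n => ((hvc n).pow 2).aestronglyMeasurable) hf.sq
      (fun n => Eventually.of_forall fun x => ?_)
      (Eventually.of_forall fun x => (hvlim x).pow 2)
    rw [Real.norm_eq_abs, abs_of_nonneg (sq_nonneg _)]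
    exact pow_le_pow_left₀ (hv0 n x) (hvf n x) 2
  · refine tendsto_integral_of_dominated_convergence _
      (fun n => ((hvc n).pow 4).aestronglyMeasurable) hf.integrable_quart
      (fun n => Eventually.of_forall fun x => ?_)
      (Eventually.of_forall fun x => (hvlim x).pow 4)
    rw [Real.norm_eq_abs, abs_of_nonneg (pow_nonneg (hv0 n x) 4)]
    exact pow_le_pow_left₀ (hv0 n x) (hvf n x) 4
  · rw [hf.hasFiniteEnergy.logE_eq_integral_prod]
    simp_rw [fun n => (hcore n).hasFiniteEnergy.logE_eq_integral_prod]
    refine tendsto_integral_of_dominated_convergence _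
      (fun n => (hcore n).hasFiniteEnergy.integrable_prod_log.aestronglyMeasurable)
      hf.hasFiniteEnergy.integrable_prod_log.norm
      (fun n => Eventually.of_forall fun p => ?_)
      (Eventually.of_forall fun p => (((hvlim p.1).pow 2).const_mul _).mul ((hvlim p.2).pow 2))
    rw [norm_mul, norm_mul, norm_mul, norm_mul, Real.norm_eq_abs (v n p.1 ^ 2),
      Real.norm_eq_abs (v n p.2 ^ 2), Real.norm_eq_abs (f p.1 ^ 2), Real.norm_eq_abs (f p.2 ^ 2),
      abs_of_nonneg (sq_nonneg _), abs_of_nonneg (sq_nonneg _), abs_of_nonneg (sq_nonneg _),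
      abs_of_nonneg (sq_nonneg _)]
    have a1 := pow_le_pow_left₀ (hv0 n p.1) (hvf n p.1) 2
    have a2 := pow_le_pow_left₀ (hv0 n p.2) (hvf n p.2) 2
    gcongr
  · refine (integral_mono (hki n) (hRi n) (hkb n)).trans (le_of_eq ?_)
    rw [integral_add (hf.kin.fun_add (hf.integrable_mul_fderiv.const_mul _)) (hf.sq.const_mul _),
      integral_add hf.kin (hf.integrable_mul_fderiv.const_mul _), integral_const_mul,
      integral_const_mul]
    rfl
  · have h1 : Tendsto (fun n => G * δ n) atTop (𝓝 0) := by simpa using hδlim.const_mul G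
    have h2 := ((h1.const_mul 2).mul_const (∫ x, f x * ‖fderiv ℝ f x‖)).const_add (_root_.kin f)
    simpa using h2.add ((h1.pow 2).mul_const (mass f))

end Admissible

/-! ### Real trial functions -/

lemma fderiv_ofReal_comp {f : Plane → ℝ} {x : Plane} (hf : DifferentiableAt ℝ f x) (v : Plane) :
    fderiv ℝ (fun y => (f y : ℂ)) x v = (fderiv ℝ f x v : ℂ) := by
  have := (Complex.ofRealCLM.hasFDerivAt (x := f x)).comp x hf.hasFDerivAt
  have e : fderiv ℝ (fun y => (f y : ℂ)) x = Complex.ofRealCLM.comp (fderiv ℝ f x) := this.fderiv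
  rw [e]; rfl

lemma norm_ofReal_sq (t : ℝ) : ‖(t : ℂ)‖ ^ 2 = t ^ 2 := by
  rw [Complex.norm_real, Real.norm_eq_abs, sq_abs]

lemma gradSq_ofReal {f : Plane → ℝ} (hf : Differentiable ℝ f) (x : Plane) :
    gradSq (fun y => (f y : ℂ)) x = ‖fderiv ℝ f x‖ ^ 2 := by
  simp only [gradSq, d0, d1]
  rw [fderiv_ofReal_comp (hf x), fderiv_ofReal_comp (hf x), norm_ofReal_sq, norm_ofReal_sq,
    norm_sq_clm]

lemma momentum_ofReal {f : Plane → ℝ} (hf : Differentiable ℝ f) (x : Plane) :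
    momentum (fun y => (f y : ℂ)) x = 0 := by
  simp only [momentum, d0, d1]
  rw [fderiv_ofReal_comp (hf x), fderiv_ofReal_comp (hf x)]
  simp

lemma IsCore.integrable_potential {V : Plane → ℝ} (hV : V110 V) {f : Plane → ℝ} (hf : IsCore f) :
    Integrable fun x => V x * f x ^ 2 := by
  obtain ⟨R, hR⟩ := hf.supp.isCompact.isBounded.subset_closedBall 0
  obtain ⟨C, hC⟩ := hV.2.2.1 R
  refine ((hf.integrable_pow two_ne_zero).const_mul C).mono'
    (hV.1.mul (hf.diff.continuous.measurable.pow_const 2)).aestronglyMeasurable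
    (Eventually.of_forall fun x => ?_)
  rw [Real.norm_eq_abs, abs_of_nonneg (mul_nonneg (hV.2.1 x) (sq_nonneg _))]
  by_cases hx : f x = 0
  · simp [hx]
  · exact mul_le_mul_of_nonneg_right
      (hC x (mem_closedBall_zero_iff.1 (hR (subset_tsupport f hx)))) (sq_nonneg _)

lemma IsCore.integral_potential_le {V : Plane → ℝ} (hV : V110 V) {f : Plane → ℝ} (hf : IsCore f)
    {C : ℝ} (hC : ∀ x, f x ≠ 0 → V x ≤ C) : ∫ x, V x * f x ^ 2 ≤ C * mass f := by
  rw [mass, ← integral_const_mul]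
  refine integral_mono (hf.integrable_potential hV) ((hf.integrable_pow two_ne_zero).const_mul C)
    fun x => ?_
  by_cases hx : f x = 0
  · simp [hx]
  · exact mul_le_mul_of_nonneg_right (hC x hx) (sq_nonneg _)

lemma IsCore.mem_Sset {V : Plane → ℝ} (hV : V110 V) {f : Plane → ℝ} (hf : IsCore f) :
    (fun x => (f x : ℂ)) ∈ Sset V (mass f) := by
  refine ⟨⟨⟨fun x => (Complex.ofRealCLM.hasFDerivAt.comp x (hf.diff x).hasFDerivAt).differentiableAt,
    ?_, ?_⟩, ?_⟩, ?_⟩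
  · simp_rw [norm_ofReal_sq]; exact hf.integrable_pow two_ne_zero
  · rw [show gradSq (fun x => (f x : ℂ)) = fun x => ‖fderiv ℝ f x‖ ^ 2 from
      funext (gradSq_ofReal hf.diff)]
    exact hf.kin
  · simp_rw [norm_ofReal_sq]; exact hf.integrable_potential hV
  · simp_rw [norm_ofReal_sq]; rfl

lemma IsCore.Ea_eq {V : Plane → ℝ} (hV : V110 V) (Ω : ℝ) {f : Plane → ℝ} (hf : IsCore f) :
    Ea V Ω (fun x => (f x : ℂ)) =
      _root_.kin f + (∫ x, V x * f x ^ 2) + 1 / 2 * logE f - 1 / 2 * quart f := by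
  have h4 : ∀ t : ℝ, ‖(t : ℂ)‖ ^ 4 = t ^ 4 := fun t => by
    rw [show (4 : ℕ) = 2 * 2 by norm_num, pow_mul, pow_mul, norm_ofReal_sq]
  simp only [Ea, logConv, gradSq_ofReal hf.diff, momentum_ofReal hf.diff, norm_ofReal_sq, h4,
    integral_zero, mul_zero, sub_zero]
  rw [integral_add hf.kin (hf.integrable_potential hV)]
  rfl

lemma IsMinimizer.le_core {V : Plane → ℝ} (hV : V110 V) {Ω a : ℝ} {u : Plane → ℂ}
    (hu : IsMinimizer V Ω a u) {f : Plane → ℝ} (hf : IsCore f) (hm : mass f = a) {C : ℝ}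
    (hC : ∀ x, f x ≠ 0 → V x ≤ C) :
    Ea V Ω u ≤ kin f + C * a + 1 / 2 * logE f - 1 / 2 * quart f := by
  have h1 := hu.2 _ (hm ▸ hf.mem_Sset hV)
  rw [hf.Ea_eq hV] at h1
  have h2 := hf.integral_potential_le hV hC
  rw [hm] at h2
  linarith

/-- The sharp Gagliardo–Nirenberg inequality, deduced from the existence of minimizers. -/
lemma IsCore.gagliardo_nirenberg {V : Plane → ℝ} (hV : V110 V) {Ω A : ℝ} (hA : 0 < A)
    {u : ℝ → Plane → ℂ} (hmin : ∀ a ∈ Ioo (0 : ℝ) A, IsMinimizer V Ω a (u a))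
    {f : Plane → ℝ} (hf : IsCore f) :
    A * (1 / 2 * quart f) ≤ _root_.kin f * mass f := by
  rcases (mass_nonneg f).eq_or_lt with hm | hm
  · have h0 : (fun x => f x ^ 2) =ᵐ[volume] 0 :=
      (integral_eq_zero_iff_of_nonneg (fun _ => sq_nonneg _) (hf.integrable_pow two_ne_zero)).1 hm.symm
    have : quart f = 0 := by
      rw [quart, ← integral_zero Plane ℝ (μ := volume)]
      refine integral_congr_ae ?_
      filter_upwards [h0] with x hx
      have hx' : f x ^ 2 = 0 := hx
      rw [show f x ^ 4 = (f x ^ 2) ^ 2 by ring, hx']; norm_num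
    rw [this, ← hm]; simp
  set K := _root_.kin f
  set N := 1 / 2 * quart f with hN
  set m := mass f
  suffices h : ∀ a ∈ Ioo (0 : ℝ) A, a * N ≤ K * m by
    have hc : Tendsto (fun a : ℝ => a * N) (𝓝[<] A) (𝓝 (A * N)) :=
      ((continuous_id.mul continuous_const).tendsto A).mono_left nhdsWithin_le_nhds
    refine le_of_tendsto hc ?_
    filter_upwards [Ioo_mem_nhdsLT hA] with a ha using h a ha
  intro a ha
  by_contra hcon
  push Not at hcon
  set c := Real.sqrt (a / m) with hcdef
  have hc2 : c ^ 2 = a / m := Real.sq_sqrt (div_pos ha.1 hm).le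
  have hβ : 0 < c ^ 4 * N - c ^ 2 * K := by
    have e : c ^ 4 * N - c ^ 2 * K = a / m ^ 2 * (a * N - K * m) := by
      rw [show c ^ 4 = (c ^ 2) ^ 2 by ring, hc2]
      field_simp
    rw [e]
    exact mul_pos (div_pos ha.1 (pow_pos hm 2)) (by linarith)
  set β := c ^ 4 * N - c ^ 2 * K
  obtain ⟨R, hR⟩ := hf.supp.isCompact.isBounded.subset_closedBall 0
  obtain ⟨C, hC⟩ := hV.2.2.1 R
  have key : ∀ τ : ℝ, 1 ≤ τ → Ea V Ω (u a) ≤ - (τ * β) + (C * a + 1 / 2 * (c ^ 4 * logE f)) := by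
    intro τ hτ
    have hτ0 : 0 < τ := by linarith
    have hd := hf.dilate hτ0
    have hcore := hd.const_mul c
    have hmass : mass (fun x => c * (τ * f (τ • x))) = a := by
      rw [mass_const_mul, mass_dilate f hτ0, hc2]; field_simp; rfl
    have hsup : ∀ x, c * (τ * f (τ • x)) ≠ 0 → V x ≤ C := by
      intro x hx
      have hfx : f (τ • x) ≠ 0 := fun h => hx (by rw [h]; ring)
      have h1 := mem_closedBall_zero_iff.1 (hR (subset_tsupport f hfx))
      rw [norm_smul, Real.norm_eq_abs, abs_of_pos hτ0] at h1
      refine hC x (le_trans ?_ h1)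
      nlinarith [norm_nonneg x]
    have h := (hmin a ha).le_core hV hcore hmass hsup
    rw [kin_const_mul, kin_dilate f hτ0, quart_const_mul, quart_dilate f hτ0, logE_const_mul,
      hf.hasFiniteEnergy.logE_dilate hτ0] at h
    have hl : 0 ≤ c ^ 4 * (m ^ 2 * Real.log τ) := by
      have := Real.log_nonneg hτ
      positivity
    have hq : 1 / 2 * (c ^ 4 * (τ ^ 2 * quart f)) = τ ^ 2 * (c ^ 4 * N) := by rw [hN]; ring
    have h2 : τ * β ≤ τ ^ 2 * β := mul_le_mul_of_nonneg_right (by nlinarith) hβ.le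
    have h3 : τ ^ 2 * β = τ ^ 2 * (c ^ 4 * N) - c ^ 2 * (τ ^ 2 * K) := by simp only [β]; ring
    linarith
  set D := C * a + 1 / 2 * (c ^ 4 * logE f)
  have h1 := key (max 1 ((D - Ea V Ω (u a) + 1) / β)) (le_max_left _ _)
  have h2 : D - Ea V Ω (u a) + 1 ≤ max 1 ((D - Ea V Ω (u a) + 1) / β) * β := by
    rw [← div_le_iff₀ hβ]; exact le_max_right _ _
  linarith

lemma CondV.exists_le {V : Plane → ℝ} {Ω α : ℝ} (h : CondV V Ω α) {ε : ℝ} (hε : 0 < ε) :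
    ∃ r, 0 < r ∧ ∀ x, ‖x‖ ≤ r → V x ≤ ε := by
  obtain ⟨hα, -, h0, hH, -⟩ := h
  obtain ⟨C, hC⟩ := hH 1 one_pos
  have h00 := (h0 0).2 rfl
  have hlim : Tendsto (fun r : ℝ => C * r ^ α + Ω ^ 2 / 4 * r ^ 2) (𝓝 0) (𝓝 0) := by
    have h1 : Continuous fun r : ℝ => C * r ^ α + Ω ^ 2 / 4 * r ^ 2 :=
      (continuous_const.mul (Real.continuous_rpow_const hα.1.le)).add
        (continuous_const.mul (continuous_pow 2))
    have := h1.tendsto 0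
    simpa [Real.zero_rpow hα.1.ne'] using this
  obtain ⟨δ, hδ, hball⟩ := Metric.eventually_nhds_iff.1 (hlim.eventually (gt_mem_nhds hε))
  refine ⟨min (δ / 2) 1, by positivity, fun x hx => ?_⟩
  have hx1 : ‖x‖ ≤ 1 := hx.trans (min_le_right _ _)
  have hx2 : ‖x‖ < δ := (hx.trans (min_le_left _ _)).trans_lt (by linarith)
  have h1 := hC x (mem_closedBall_zero_iff.2 hx1) 0 (mem_closedBall_zero_iff.2 (by simp))
  rw [h00, sub_zero, sub_zero] at h1
  have h2 := hball (y := ‖x‖) (by rw [Real.dist_eq, sub_zero, abs_of_nonneg (norm_nonneg x)]; exact hx2)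
  linarith [le_abs_self (V x - Ω ^ 2 / 4 * ‖x‖ ^ 2)]

/-! ### The diamagnetic inequality -/

lemma fderiv_norm_mul {u : Plane → ℂ} (hu : Differentiable ℝ u) {x : Plane} (hx : u x ≠ 0)
    (v : Plane) : ‖u x‖ * fderiv ℝ (fun y => ‖u y‖) x v =
      ((starRingEnd ℂ) (u x) * fderiv ℝ u x v).re := by
  have hd : DifferentiableAt ℝ (fun y => ‖u y‖) x := (hu x).norm ℝ hx
  have h1 : fderiv ℝ (fun y => ‖u y‖ ^ 2) x = (2 * ‖u x‖) • fderiv ℝ (fun y => ‖u y‖) x := by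
    rw [fderiv_fun_pow 2 hd]; simp
  have h2 := ((hu x).hasFDerivAt.norm_sq).fderiv
  have h3 := congrArg (fun L : Plane →L[ℝ] ℝ => L v) (h1.symm.trans h2)
  simp [Complex.inner, mul_assoc] at h3
  simp [Complex.mul_re]
  linarith

lemma normSq_conj_mul (z w : ℂ) : ‖z‖ ^ 2 * ‖w‖ ^ 2 =
    ((starRingEnd ℂ) z * w).re ^ 2 + ((starRingEnd ℂ) z * w).im ^ 2 := by
  rw [← mul_pow, ← Complex.norm_conj z, ← norm_mul, Complex.sq_norm, Complex.normSq_apply]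
  ring

lemma diamagnetic {u : Plane → ℂ} (hu : Differentiable ℝ u) (Ω : ℝ) (x : Plane) :
    gradAbsSq u x ≤ gradSq u x + Ω ^ 2 / 4 * ‖x‖ ^ 2 * ‖u x‖ ^ 2 - Ω * momentum u x := by
  by_cases hx : u x = 0
  · have hmin : IsLocalMin (fun y => ‖u y‖) x :=
      Eventually.of_forall fun y => by simp [hx]
    have : 0 ≤ gradSq u x := by unfold gradSq; positivity
    simpa [gradAbsSq, hmin.fderiv_eq_zero, hx, momentum] using this
  · have hp : 0 < ‖u x‖ ^ 2 := by positivity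
    refine le_of_mul_le_mul_left ?_ hp
    have e0' := fderiv_norm_mul hu hx e0
    have e1' := fderiv_norm_mul hu hx e1
    have n0 := normSq_conj_mul (u x) (fderiv ℝ u x e0)
    have n1 := normSq_conj_mul (u x) (fderiv ℝ u x e1)
    have hn : ‖x‖ ^ 2 = x 0 ^ 2 + x 1 ^ 2 := by
      rw [EuclideanSpace.norm_sq_eq, Fin.sum_univ_two]; simp
    have hL : ‖u x‖ ^ 2 * gradAbsSq u x = ((starRingEnd ℂ) (u x) * fderiv ℝ u x e0).re ^ 2 +
        ((starRingEnd ℂ) (u x) * fderiv ℝ u x e1).re ^ 2 := by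
      rw [gradAbsSq, norm_sq_clm, ← e0', ← e1']; ring
    rw [hL]
    have hR : ‖u x‖ ^ 2 * (gradSq u x + Ω ^ 2 / 4 * ‖x‖ ^ 2 * ‖u x‖ ^ 2 - Ω * momentum u x) =
        ((starRingEnd ℂ) (u x) * fderiv ℝ u x e0).re ^ 2 +
        ((starRingEnd ℂ) (u x) * fderiv ℝ u x e1).re ^ 2 +
        (((starRingEnd ℂ) (u x) * fderiv ℝ u x e0).im + Ω / 2 * x 1 * ‖u x‖ ^ 2) ^ 2 +
        (((starRingEnd ℂ) (u x) * fderiv ℝ u x e1).im - Ω / 2 * x 0 * ‖u x‖ ^ 2) ^ 2 := by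
      simp only [gradSq, momentum, d0, d1]
      rw [hn, mul_sub, mul_add, mul_add, n0, n1]; ring
    rw [hR]
    nlinarith [sq_nonneg (((starRingEnd ℂ) (u x) * fderiv ℝ u x e0).im + Ω / 2 * x 1 * ‖u x‖ ^ 2),
      sq_nonneg (((starRingEnd ℂ) (u x) * fderiv ℝ u x e1).im - Ω / 2 * x 0 * ‖u x‖ ^ 2)]

lemma abs_momentum_le (u : Plane → ℂ) (x : Plane) :
    |momentum u x| ≤ 1 / 2 * (‖x‖ ^ 2 * ‖u x‖ ^ 2 + gradSq u x) := by
  have hn : ‖x‖ ^ 2 = x 0 ^ 2 + x 1 ^ 2 := by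
    rw [EuclideanSpace.norm_sq_eq, Fin.sum_univ_two]; simp
  have h : ∀ w : ℂ, |((starRingEnd ℂ) (u x) * w).im| ≤ ‖u x‖ * ‖w‖ := fun w => by
    refine (Complex.abs_im_le_norm _).trans ?_
    rw [norm_mul, Complex.norm_conj]
  simp only [momentum, gradSq]
  refine (abs_add_le _ _).trans ?_
  rw [abs_mul, abs_mul, abs_neg, hn, ← sq_abs (x 0), ← sq_abs (x 1)]
  have h0 := mul_le_mul_of_nonneg_left (h (d0 u x)) (abs_nonneg (x 1))
  have h1 := mul_le_mul_of_nonneg_left (h (d1 u x)) (abs_nonneg (x 0))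
  nlinarith [sq_nonneg (|x 1| * ‖u x‖ - ‖d0 u x‖), sq_nonneg (|x 0| * ‖u x‖ - ‖d1 u x‖)]

lemma InH.integrable_moment {V : Plane → ℝ} (hV : V110 V) {u : Plane → ℂ} (hu : InH V u) :
    Integrable fun x => ‖x‖ ^ 2 * ‖u x‖ ^ 2 := by
  obtain ⟨c, hc, R, hR⟩ := hV.2.2.2
  have hcont := hu.1.1.continuous
  refine ((hu.1.2.1.const_mul (R ^ 2)).add (hu.2.const_mul c⁻¹)).mono'
    (Continuous.aestronglyMeasurable (by fun_prop)) (Eventually.of_forall fun x => ?_)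
  rw [Real.norm_eq_abs, abs_of_nonneg (by positivity)]
  simp only [Pi.add_apply]
  have hVx := hV.2.1 x
  by_cases hx : R ≤ ‖x‖
  · have h1 := mul_le_mul_of_nonneg_right (hR x hx) (sq_nonneg ‖u x‖)
    have h2 : ‖x‖ ^ 2 * ‖u x‖ ^ 2 ≤ c⁻¹ * (V x * ‖u x‖ ^ 2) := by
      rw [le_inv_mul_iff₀ hc]; linarith
    have : 0 ≤ R ^ 2 * ‖u x‖ ^ 2 := by positivity
    linarith
  · have h1 : ‖x‖ ^ 2 ≤ R ^ 2 := pow_le_pow_left₀ (norm_nonneg x) (le_of_not_ge hx) 2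
    have h2 := mul_le_mul_of_nonneg_right h1 (sq_nonneg ‖u x‖)
    have : 0 ≤ c⁻¹ * (V x * ‖u x‖ ^ 2) := by positivity
    linarith

lemma InH.admissible {V : Plane → ℝ} (hV : V110 V) {u : Plane → ℂ} (hu : InH V u) :
    Admissible fun x => ‖u x‖ where
  nonneg := fun _ => norm_nonneg _
  diff := hu.1.1.norm_sq ℝ
  sq := hu.1.2.1
  kin := hu.1.2.2.mono' (measurable_fderiv_norm_sq _).aestronglyMeasurable
    (Eventually.of_forall fun x => by
      rw [Real.norm_eq_abs, abs_of_nonneg (sq_nonneg _)]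
      simpa [gradAbsSq] using diamagnetic hu.1.1 0 x)
  moment := hu.integrable_moment hV

lemma InH.le_Ea {V : Plane → ℝ} (hV : V110 V) {Ω : ℝ}
    (hVΩ : ∀ x : Plane, 0 ≤ V x - Ω ^ 2 / 4 * ‖x‖ ^ 2) {u : Plane → ℂ} (hu : InH V u) :
    kin (fun x => ‖u x‖) + 1 / 2 * logE (fun x => ‖u x‖) - 1 / 2 * quart (fun x => ‖u x‖) ≤
      Ea V Ω u := by
  have hmom : Integrable (momentum u) := by
    have hcont := hu.1.1.continuous
    have m0 : Measurable (d0 u) := measurable_fderiv_apply_const ℝ u e0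
    have m1 : Measurable (d1 u) := measurable_fderiv_apply_const ℝ u e1
    have mx : ∀ i : Fin 2, Measurable fun x : Plane => x i := fun i =>
      (by fun_prop : Continuous fun x : Plane => x i).measurable
    have hcm : Measurable fun x => (starRingEnd ℂ) (u x) :=
      (Complex.continuous_conj.comp hcont).measurable
    refine (((hu.integrable_moment hV).add hu.1.2.2).const_mul (1 / 2)).mono' ?_
      (Eventually.of_forall fun x => abs_momentum_le u x)
    exact ((((mx 1).neg).mul (Complex.measurable_im.comp (hcm.mul m0))).add
      ((mx 0).mul (Complex.measurable_im.comp (hcm.mul m1)))).aestronglyMeasurable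
  have hGV : Integrable fun x => gradSq u x + V x * ‖u x‖ ^ 2 := hu.1.2.2.add hu.2
  have h : kin (fun x => ‖u x‖) ≤
      (∫ x, (gradSq u x + V x * ‖u x‖ ^ 2)) - Ω * ∫ x, momentum u x := by
    rw [← integral_const_mul, ← integral_sub hGV (hmom.const_mul Ω)]
    refine integral_mono (hu.admissible hV).kin (hGV.sub (hmom.const_mul Ω)) fun x => ?_
    have h1 := diamagnetic hu.1.1 Ω x
    have h2 := mul_nonneg (hVΩ x) (sq_nonneg ‖u x‖)
    simp only [gradAbsSq] at h1
    linarith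
  simp only [Ea]
  change _ ≤ _ + 1 / 2 * logE (fun x => ‖u x‖) - 1 / 2 * quart (fun x => ‖u x‖) - _
  linarith

/-! ### The ground state -/

/-- Integration by parts against a compactly supported function. -/
lemma integral_mul_fderiv_of_hasCompactSupport {f g : Plane → ℝ} (hf : ContDiff ℝ 1 f)
    (hg : ContDiff ℝ 1 g) (hc : HasCompactSupport f) (v : Plane) :
    ∫ x, f x * fderiv ℝ g x v = - ∫ x, fderiv ℝ f x v * g x := by
  have hf' : Continuous fun x => fderiv ℝ f x v :=
    (hf.continuous_fderiv one_ne_zero).clm_apply continuous_const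
  have hg' : Continuous fun x => fderiv ℝ g x v :=
    (hg.continuous_fderiv one_ne_zero).clm_apply continuous_const
  refine integral_mul_fderiv_eq_neg_fderiv_mul_of_integrable ?_ ?_ ?_
    (fun x _ => hf.differentiable one_ne_zero x) (fun x _ => hg.differentiable one_ne_zero x)
  · exact (hf'.mul hg.continuous).integrable_of_hasCompactSupport
      (HasCompactSupport.mul_right (f' := g) (hc.fderiv_apply ℝ v))
  · exact (hf.continuous.mul hg').integrable_of_hasCompactSupport
      (HasCompactSupport.mul_right (f' := fun x => fderiv ℝ g x v) hc)
  · exact (hf.continuous.mul hg.continuous).integrable_of_hasCompactSupport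
      (HasCompactSupport.mul_right (f' := g) hc)

lemma integrable_mul_of_hasCompactSupport {f g : Plane → ℝ} (hf : Continuous f)
    (hg : Continuous g) (hc : HasCompactSupport f) : Integrable fun x => f x * g x :=
  (hf.mul hg).integrable_of_hasCompactSupport (HasCompactSupport.mul_right (f' := g) hc)

/-- Fatou's lemma for square integrability. -/
lemma integrable_sq_of_eventually_eq {g : ℕ → Plane → ℝ} {h : Plane → ℝ} {C : ℝ}
    (hg : ∀ n, Measurable (g n)) (hh : Measurable h)
    (hi : ∀ n, Integrable fun x => g n x ^ 2) (hC : ∀ n, ∫ x, g n x ^ 2 ≤ C)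
    (hlim : ∀ x, ∀ᶠ n in atTop, g n x = h x) : Integrable fun x => h x ^ 2 := by
  have hC0 : 0 ≤ C := (integral_nonneg fun x => sq_nonneg _).trans (hC 0)
  have hI : ∀ n, ∫⁻ x, ‖g n x‖ₑ ^ 2 ≤ ENNReal.ofReal C := by
    intro n
    refine le_trans (le_of_eq ?_) (ENNReal.ofReal_le_ofReal (hC n))
    rw [ofReal_integral_eq_lintegral_ofReal (hi n) (Eventually.of_forall fun x => sq_nonneg _)]
    refine lintegral_congr fun x => ?_
    rw [← sq_abs, ENNReal.ofReal_pow (abs_nonneg _), Real.enorm_eq_ofReal_abs]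
  refine (integral_sq_le_of_lintegral hh hC0 ?_).1
  have hlim' : ∀ x, liminf (fun n => ‖g n x‖ₑ ^ 2) atTop = ‖h x‖ₑ ^ 2 := by
    intro x
    refine Tendsto.liminf_eq (tendsto_const_nhds.congr' ?_)
    filter_upwards [hlim x] with n hn
    rw [hn]
  calc ∫⁻ x, ‖h x‖ₑ ^ 2
      = ∫⁻ x, liminf (fun n => ‖g n x‖ₑ ^ 2) atTop := by simp_rw [hlim']
    _ ≤ liminf (fun n => ∫⁻ x, ‖g n x‖ₑ ^ 2) atTop :=
        lintegral_liminf_le fun n => (hg n).enorm.pow_const 2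
    _ ≤ ENNReal.ofReal C := liminf_le_of_frequently_le' (Frequently.of_forall hI)

lemma IsLocalMax.fderiv_eq_zero_of_const {η : Plane → ℝ} {x : Plane} {c : ℝ} (h : ∀ y, η y ≤ c)
    (hx : η x = c) : fderiv ℝ η x = 0 :=
  IsLocalMax.fderiv_eq_zero (Eventually.of_forall fun y => hx ▸ h y)

/-- Cutoff functions, with the additional weighted gradient bound. -/
lemma exists_weighted_cutoffs : ∃ G : ℝ, 0 < G ∧ ∃ η : ℝ → Plane → ℝ, ∀ R : ℝ, 0 < R →
    ContDiff ℝ 1 (η R) ∧ HasCompactSupport (η R) ∧ (∀ x, 0 ≤ η R x ∧ η R x ≤ 1) ∧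
    (∀ x, ‖x‖ ≤ R → η R x = 1) ∧ (∀ x, 2 * R ≤ ‖x‖ → η R x = 0) ∧
    (∀ x, ‖fderiv ℝ (η R) x‖ ≤ G / R) ∧
    (∀ x, ‖fderiv ℝ (η R) x‖ * ‖x‖ ≤ 2 * G) ∧ ∀ x, ‖x‖ ≤ R → fderiv ℝ (η R) x = 0 := by
  obtain ⟨G, hG, η, hη⟩ := exists_cutoffs
  refine ⟨G, hG, η, fun R hR => ?_⟩
  obtain ⟨h1, h2, h3, h4, h5, h6⟩ := hη R hR
  refine ⟨h1, h2, h3, h4, h5, h6, fun x => ?_, fun x hx => ?_⟩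
  · by_cases hx : 2 * R ≤ ‖x‖
    · have : IsLocalMin (η R) x := Eventually.of_forall fun y => by rw [h5 x hx]; exact (h3 y).1
      rw [this.fderiv_eq_zero]; simp [hG.le]
    · calc ‖fderiv ℝ (η R) x‖ * ‖x‖ ≤ G / R * (2 * R) :=
          mul_le_mul (h6 x) (le_of_not_ge hx) (norm_nonneg _) (by positivity)
        _ = 2 * G := by field_simp
  · exact IsLocalMax.fderiv_eq_zero_of_const (fun y => (h3 y).2) (h4 x hx)

lemma sqrt_one_add_sq_facts : ContDiff ℝ 1 (fun x : Plane => Real.sqrt (1 + ‖x‖ ^ 2)) ∧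
    (∀ x : Plane, Real.sqrt (1 + ‖x‖ ^ 2) ≤ 1 + ‖x‖) ∧
    ∀ x : Plane, ‖fderiv ℝ (fun x : Plane => Real.sqrt (1 + ‖x‖ ^ 2)) x‖ ≤ 1 := by
  have hpos : ∀ x : Plane, 1 + ‖x‖ ^ 2 ≠ 0 := fun x => by positivity
  refine ⟨(contDiff_const.add (contDiff_norm_sq ℝ)).sqrt hpos, fun x => ?_, fun x => ?_⟩
  · exact Real.sqrt_le_iff.2 ⟨by positivity, by nlinarith [norm_nonneg x]⟩
  · have hd : HasFDerivAt (fun x : Plane => 1 + ‖x‖ ^ 2) (2 • innerSL ℝ x) x :=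
      (hasStrictFDerivAt_norm_sq x).hasFDerivAt.const_add 1
    rw [(hd.sqrt (hpos x)).fderiv, norm_smul, two_smul, ← two_smul ℝ, norm_smul, innerSL_apply_norm]
    have h1 : ‖x‖ ≤ Real.sqrt (1 + ‖x‖ ^ 2) := Real.le_sqrt_of_sq_le (by linarith)
    have h2 : 0 < Real.sqrt (1 + ‖x‖ ^ 2) := Real.sqrt_pos.2 (by positivity)
    rw [Real.norm_eq_abs, Real.norm_eq_abs, abs_two, abs_of_pos (by positivity)]
    rw [div_mul_eq_mul_div, one_mul, div_le_one (by positivity)]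
    linarith

namespace IsGroundState

variable {Q : Plane → ℝ}

lemma contDiff_d0R (hQ : IsGroundState Q) : ContDiff ℝ 1 (d0R Q) :=
  (hQ.1.fderiv_right (m := 1) (by norm_num)).clm_apply contDiff_const

lemma contDiff_d1R (hQ : IsGroundState Q) : ContDiff ℝ 1 (d1R Q) :=
  (hQ.1.fderiv_right (m := 1) (by norm_num)).clm_apply contDiff_const

lemma contDiff_one (hQ : IsGroundState Q) : ContDiff ℝ 1 Q := hQ.1.of_le (by norm_num)

/-- The weak form of the equation. -/
lemma weak_form (hQ : IsGroundState Q) {φ : Plane → ℝ} (hφ : ContDiff ℝ 1 φ)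
    (hc : HasCompactSupport φ) :
    ∫ x, (d0R φ x * d0R Q x + d1R φ x * d1R Q x + φ x * Q x - φ x * Q x ^ 3) = 0 := by
  have hQc := hQ.1.continuous
  have c0 := hQ.contDiff_d0R.continuous
  have c1 := hQ.contDiff_d1R.continuous
  have k : ∀ v, Continuous fun x => fderiv ℝ φ x v := fun v =>
    (hφ.continuous_fderiv one_ne_zero).clm_apply continuous_const
  have i0 : Integrable fun x => d0R φ x * d0R Q x :=
    integrable_mul_of_hasCompactSupport (k e0) c0 (hc.fderiv_apply ℝ e0)
  have i1 : Integrable fun x => d1R φ x * d1R Q x :=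
    integrable_mul_of_hasCompactSupport (k e1) c1 (hc.fderiv_apply ℝ e1)
  have i2 : Integrable fun x => φ x * Q x :=
    integrable_mul_of_hasCompactSupport hφ.continuous hQc hc
  have i3 : Integrable fun x => φ x * Q x ^ 3 :=
    integrable_mul_of_hasCompactSupport hφ.continuous (hQc.pow 3) hc
  have j0 := integral_mul_fderiv_of_hasCompactSupport hφ hQ.contDiff_d0R hc e0
  have j1 := integral_mul_fderiv_of_hasCompactSupport hφ hQ.contDiff_d1R hc e1
  have hd : ∀ (g : Plane → ℝ) (_ : ContDiff ℝ 1 g) (v : Plane), Integrable fun x => φ x * fderiv ℝ g x v :=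
    fun g hg v => integrable_mul_of_hasCompactSupport hφ.continuous
      ((hg.continuous_fderiv one_ne_zero).clm_apply continuous_const) hc
  have l0 := hd _ hQ.contDiff_d0R e0
  have l1 := hd _ hQ.contDiff_d1R e1
  rw [integral_sub ((i0.fun_add i1).fun_add i2) i3, integral_add (i0.fun_add i1) i2,
    integral_add i0 i1]
  have j0' : ∫ x, d0R φ x * d0R Q x = - ∫ x, φ x * fderiv ℝ (d0R Q) x e0 := by
    rw [j0, neg_neg]; rfl
  have j1' : ∫ x, d1R φ x * d1R Q x = - ∫ x, φ x * fderiv ℝ (d1R Q) x e1 := by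
    rw [j1, neg_neg]; rfl
  have hs : (∫ x, φ x * fderiv ℝ (d0R Q) x e0) + (∫ x, φ x * fderiv ℝ (d1R Q) x e1) =
      (∫ x, φ x * Q x) - ∫ x, φ x * Q x ^ 3 := by
    rw [← integral_add l0 l1, ← integral_sub i2 i3]
    refine integral_congr_ae (Eventually.of_forall fun x => ?_)
    have := hQ.2.2.2.2.2 x
    simp only [lapR] at this
    linear_combination (-φ x) * this
  rw [j0', j1']
  linarith

/-- The weak form tested with `ξ² Q`. -/
lemma localized_energy (hQ : IsGroundState Q) {ξ : Plane → ℝ} (hξ : ContDiff ℝ 1 ξ)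
    (hc : HasCompactSupport ξ) :
    kin (fun x => ξ x * Q x) + ∫ x, ξ x ^ 2 * Q x ^ 2 =
      (∫ x, ‖fderiv ℝ ξ x‖ ^ 2 * Q x ^ 2) + ∫ x, ξ x ^ 2 * Q x ^ 4 := by
  have hQc := hQ.1.continuous
  have hQ1 := hQ.contDiff_one
  have hs : HasCompactSupport fun x => ξ x ^ 2 := hc.comp_left (g := fun t : ℝ => t ^ 2) (by simp)
  have hw := hQ.weak_form ((hξ.pow 2).mul hQ1)
    (HasCompactSupport.mul_right (f' := Q) hs)
  have hn : ∀ g : Plane → ℝ, HasCompactSupport g → HasCompactSupport fun x => ‖fderiv ℝ g x‖ ^ 2 :=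
    fun g hg => (hg.fderiv ℝ).comp_left (g := fun L : Plane →L[ℝ] ℝ => ‖L‖ ^ 2) (by simp)
  have hk : ∀ g : Plane → ℝ, ContDiff ℝ 1 g → Continuous fun x => ‖fderiv ℝ g x‖ ^ 2 :=
    fun g hg => (hg.continuous_fderiv one_ne_zero).norm.pow 2
  have i1 : Integrable fun x => ‖fderiv ℝ (fun x => ξ x * Q x) x‖ ^ 2 :=
    (hk _ (hξ.mul hQ1)).integrable_of_hasCompactSupport
      (hn _ (HasCompactSupport.mul_right (f' := Q) hc))
  have i2 : Integrable fun x => ξ x ^ 2 * Q x ^ 2 :=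
    integrable_mul_of_hasCompactSupport (hξ.continuous.pow 2) (hQc.pow 2) hs
  have i3 : Integrable fun x => ‖fderiv ℝ ξ x‖ ^ 2 * Q x ^ 2 :=
    integrable_mul_of_hasCompactSupport (hk _ hξ) (hQc.pow 2) (hn _ hc)
  have i4 : Integrable fun x => ξ x ^ 2 * Q x ^ 4 :=
    integrable_mul_of_hasCompactSupport (hξ.continuous.pow 2) (hQc.pow 4) hs
  have hsum : (∫ x, ‖fderiv ℝ (fun x => ξ x * Q x) x‖ ^ 2) + (∫ x, ξ x ^ 2 * Q x ^ 2) -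
      (∫ x, ‖fderiv ℝ ξ x‖ ^ 2 * Q x ^ 2) - (∫ x, ξ x ^ 2 * Q x ^ 4) = 0 := by
    have i123 : Integrable fun x => ‖fderiv ℝ (fun x => ξ x * Q x) x‖ ^ 2 + ξ x ^ 2 * Q x ^ 2 -
        ‖fderiv ℝ ξ x‖ ^ 2 * Q x ^ 2 := (i1.add i2).sub i3
    rw [← integral_add i1 i2, ← integral_sub (i1.fun_add i2) i3, ← integral_sub i123 i4, ← hw]
    refine integral_congr_ae (Eventually.of_forall fun x => ?_)
    have dξ := hξ.differentiable one_ne_zero x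
    have dQ := hQ1.differentiable one_ne_zero x
    simp only [norm_sq_clm, d0R, d1R]
    rw [fderiv_fun_mul dξ dQ, fderiv_fun_mul (dξ.fun_pow 2) dQ, fderiv_fun_pow 2 dξ]
    simp
    ring
  simp only [kin]
  linarith

end IsGroundState

/-- A weight with uniformly bounded gradient approximating `√(1 + ‖x‖²)` away from the origin. -/
lemma exists_weights {R : ℝ} (hR : 0 < R) : ∃ C : ℝ, ∃ ξ : ℕ → Plane → ℝ, ∃ h : Plane → ℝ,
    (∀ n, ContDiff ℝ 1 (ξ n)) ∧ (∀ n, HasCompactSupport (ξ n)) ∧ (∀ n x, 0 ≤ ξ n x) ∧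
    (∀ n x, ‖x‖ ≤ R → ξ n x = 0) ∧ (∀ n x, ‖fderiv ℝ (ξ n) x‖ ≤ C) ∧ Measurable h ∧
    (∀ x, ∀ᶠ n in atTop, ξ n x = h x) ∧ ∀ x, 2 * R ≤ ‖x‖ → ‖x‖ ^ 2 ≤ h x ^ 2 := by
  obtain ⟨G, hG, η, hη⟩ := exists_weighted_cutoffs
  obtain ⟨s1, s2, s3⟩ := sqrt_one_add_sq_facts
  set s : Plane → ℝ := fun x => Real.sqrt (1 + ‖x‖ ^ 2) with hs
  have s0 : ∀ x, 0 ≤ s x := fun x => Real.sqrt_nonneg _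
  have hpos : ∀ n : ℕ, (0 : ℝ) < n + 1 := fun n => by positivity
  obtain ⟨r1, r2, r3, r4, r5, r6, r7, r8⟩ := hη R hR
  set g : ℕ → Plane → ℝ := fun n x => η (n + 1) x * s x with hg
  have hgC : ∀ n, ContDiff ℝ 1 (g n) := fun n => (hη _ (hpos n)).1.mul s1
  have hg0 : ∀ n x, 0 ≤ g n x := fun n x => mul_nonneg ((hη _ (hpos n)).2.2.1 x).1 (s0 x)
  have hgs : ∀ n x, g n x ≤ 1 + ‖x‖ := fun n x =>
    (mul_le_of_le_one_left (s0 x) ((hη _ (hpos n)).2.2.1 x).2).trans (s2 x)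
  have hgd : ∀ n x, ‖fderiv ℝ (g n) x‖ ≤ 1 + 3 * G := by
    intro n x
    obtain ⟨h1, h2, h3, h4, h5, h6, h7, h8⟩ := hη _ (hpos n)
    simp only [hg]
    rw [fderiv_fun_mul (h1.differentiable one_ne_zero x) (s1.differentiable one_ne_zero x)]
    refine (norm_add_le _ _).trans ?_
    rw [norm_smul, norm_smul, Real.norm_eq_abs, Real.norm_eq_abs, abs_of_nonneg (h3 x).1,
      abs_of_nonneg (s0 x)]
    have a1 : η (n + 1) x * ‖fderiv ℝ s x‖ ≤ 1 := mul_le_one₀ (h3 x).2 (norm_nonneg _) (s3 x)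
    have a2 := mul_le_mul_of_nonneg_right (s2 x) (norm_nonneg (fderiv ℝ (η (n + 1)) x))
    have a3 : ‖fderiv ℝ (η (n + 1)) x‖ ≤ G :=
      (h6 x).trans (div_le_self hG.le (by linarith [(Nat.cast_nonneg n : (0 : ℝ) ≤ n)]))
    linarith [h7 x]
  refine ⟨1 + 3 * G + (G / R + 2 * G), fun n x => (1 - η R x) * g n x,
    fun x => (1 - η R x) * s x, fun n => (contDiff_const.sub r1).mul (hgC n), fun n => ?_,
    fun n x => mul_nonneg (by linarith [(r3 x).2]) (hg0 n x), fun n x hx => by beta_reduce; rw [r4 x hx]; ring,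
    fun n x => ?_, ((continuous_const.sub r1.continuous).mul s1.continuous).measurable,
    fun x => ?_, fun x hx => ?_⟩
  · exact HasCompactSupport.mul_left (f := fun x => 1 - η R x)
      (HasCompactSupport.mul_right (f' := s) (hη _ (hpos n)).2.1)
  · rw [fderiv_fun_mul ((r1.differentiable one_ne_zero x).const_sub 1)
      ((hgC n).differentiable one_ne_zero x), fderiv_const_sub]
    refine (norm_add_le _ _).trans ?_
    rw [norm_smul, norm_smul, norm_neg, Real.norm_eq_abs, Real.norm_eq_abs,
      abs_of_nonneg (by linarith [(r3 x).2] : 0 ≤ 1 - η R x), abs_of_nonneg (hg0 n x)]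
    have a1 : (1 - η R x) * ‖fderiv ℝ (g n) x‖ ≤ ‖fderiv ℝ (g n) x‖ :=
      mul_le_of_le_one_left (norm_nonneg _) (by linarith [(r3 x).1])
    have a2 := mul_le_mul_of_nonneg_right (hgs n x) (norm_nonneg (fderiv ℝ (η R) x))
    linarith [r6 x, r7 x, hgd n x]
  · filter_upwards [eventually_ge_atTop ⌈‖x‖⌉₊] with n hn
    have : ‖x‖ ≤ (n : ℝ) + 1 := (Nat.ceil_le.1 hn).trans (by linarith)
    simp only [hg]
    rw [(hη _ (hpos n)).2.2.2.1 x this, one_mul]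
  · beta_reduce
    rw [r5 x hx, sub_zero, one_mul]
    simp only [hs]
    rw [Real.sq_sqrt (by positivity)]
    linarith

/-- A small tail of the mass outside a large ball. -/
lemma exists_tail_le {f : Plane → ℝ} (hf : Integrable fun x => f x ^ 2) {ε : ℝ}
    (hε : 0 < ε) : ∃ R, 0 < R ∧ ∫ x in {x : Plane | R < ‖x‖}, f x ^ 2 ≤ ε := by
  have hlim : Tendsto (fun n : ℕ => ∫ x in {x : Plane | (n : ℝ) + 1 < ‖x‖}, f x ^ 2) atTop
      (𝓝 (∫ x in ⋂ n : ℕ, {x : Plane | (n : ℝ) + 1 < ‖x‖}, f x ^ 2)) := by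
    refine tendsto_setIntegral_of_antitone (fun n => ?_) ?_ ⟨0, hf.integrableOn⟩
    · exact measurableSet_lt measurable_const measurable_norm
    · intro m n hmn x hx
      have : (m : ℝ) ≤ n := Nat.cast_le.2 hmn
      exact lt_of_le_of_lt (by linarith) (mem_ofPred.1 hx)
  have he : (⋂ n : ℕ, {x : Plane | (n : ℝ) + 1 < ‖x‖}) = ∅ := by
    refine eq_empty_iff_forall_notMem.2 fun x hx => ?_
    obtain ⟨n, hn⟩ := exists_nat_gt ‖x‖
    have := mem_iInter.1 hx n
    simp only [mem_ofPred_eq] at this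
    linarith
  rw [he] at hlim
  simp only [Measure.restrict_empty, integral_zero_measure] at hlim
  obtain ⟨n, hn⟩ := (hlim.eventually (gt_mem_nhds hε)).exists
  exact ⟨n + 1, by positivity, hn.le⟩

namespace IsGroundState

variable {Q : Plane → ℝ}

lemma integrable_moment (hQ : IsGroundState Q) : Integrable fun x => ‖x‖ ^ 2 * Q x ^ 2 := by
  have hQc := hQ.1.continuous
  have hQ1 := hQ.contDiff_one
  have hm := hQ.2.2.2.1
  obtain ⟨R, hR, hM⟩ := exists_tail_le hm (ε := 1 / 8) (by norm_num)
  obtain ⟨C, ξ, h, x1, x2, x3, x4, x5, x6, x7, x8⟩ := exists_weights hR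
  have hsupp : ∀ n, HasCompactSupport fun x => ξ n x ^ 2 := fun n =>
    (x2 n).comp_left (g := fun t : ℝ => t ^ 2) (by simp)
  have i2 : ∀ n, Integrable fun x => (ξ n x * Q x) ^ 2 := fun n => by
    simp only [mul_pow]
    exact integrable_mul_of_hasCompactSupport ((x1 n).continuous.pow 2) (hQc.pow 2) (hsupp n)
  have hbound : ∀ n, ∫ x, (ξ n x * Q x) ^ 2 ≤ C ^ 2 * mass Q + 2 * C ^ 2 * (1 / 8) ^ 2 := by
    intro n
    have hd := (x1 n).differentiable one_ne_zero
    have hdQ := hQ1.differentiable one_ne_zero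
    have hcQ : HasCompactSupport fun x => ξ n x * Q x := HasCompactSupport.mul_right (f' := Q) (x2 n)
    have h1 := hQ.localized_energy (x1 n) (x2 n)
    have ic : Continuous fun x => ‖fderiv ℝ (fun y => ξ n y * Q y) x‖ ^ 2 :=
      (((x1 n).mul hQ1).continuous_fderiv one_ne_zero).norm.pow 2
    have is : HasCompactSupport fun x => ‖fderiv ℝ (fun y => ξ n y * Q y) x‖ ^ 2 :=
      (hcQ.fderiv ℝ).comp_left (g := fun L : Plane →L[ℝ] ℝ => ‖L‖ ^ 2) (by simp)
    have ik : Integrable fun x => ‖fderiv ℝ (fun y => ξ n y * Q y) x‖ ^ 2 :=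
      ic.integrable_of_hasCompactSupport is
    have h2 : ∫ x, ξ n x ^ 2 * Q x ^ 4 ≤
        8 * (1 / 8) * kin (fun y => ξ n y * Q y) + 2 * C ^ 2 * (1 / 8) ^ 2 := by
      refine integral_weight_quart_le hdQ hd (x3 n)
        (HasCompactSupport.mul_right (f' := fun x => Q x ^ 2) (x2 n)) (x5 n) hm ik
        (le_trans ?_ hM)
      refine setIntegral_mono_set hm.integrableOn
        (Eventually.of_forall fun x => sq_nonneg _) (LE.le.eventuallyLE ?_)
      intro x hx
      by_contra hcon
      exact hx (x4 n x (not_lt.1 hcon))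
    have h3 : ∫ x, ‖fderiv ℝ (ξ n) x‖ ^ 2 * Q x ^ 2 ≤ C ^ 2 * mass Q := by
      rw [mass, ← integral_const_mul]
      refine integral_mono_of_nonneg (Eventually.of_forall fun x => by positivity)
        (hm.const_mul _) (Eventually.of_forall fun x => ?_)
      exact mul_le_mul_of_nonneg_right (pow_le_pow_left₀ (norm_nonneg _) (x5 n x) 2) (sq_nonneg _)
    simp only [mul_pow] at h1 ⊢
    linarith
  have key := integrable_sq_of_eventually_eq
    (fun n => ((x1 n).continuous.mul hQc).measurable) (x6.mul hQc.measurable) i2 hbound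
    (fun x => (x7 x).mono fun n hn => by simp only [hn, Pi.mul_apply])
  refine (key.add (hm.const_mul ((2 * R) ^ 2))).mono'
    (Continuous.aestronglyMeasurable (by fun_prop)) (Eventually.of_forall fun x => ?_)
  rw [Real.norm_eq_abs, abs_of_nonneg (by positivity)]
  simp only [Pi.add_apply, Pi.mul_apply, mul_pow]
  by_cases hx : 2 * R ≤ ‖x‖
  · have := mul_le_mul_of_nonneg_right (x8 x hx) (sq_nonneg (Q x))
    have : 0 ≤ 2 ^ 2 * R ^ 2 * Q x ^ 2 := by positivity
    linarith
  · have h1 : ‖x‖ ^ 2 ≤ (2 * R) ^ 2 := pow_le_pow_left₀ (norm_nonneg x) (le_of_not_ge hx) 2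
    have := mul_le_mul_of_nonneg_right h1 (sq_nonneg (Q x))
    have : 0 ≤ h x ^ 2 * Q x ^ 2 := by positivity
    linarith

lemma admissible (hQ : IsGroundState Q) : Admissible Q where
  nonneg := fun x => (hQ.2.1 x).le
  diff := (hQ.contDiff_one.differentiable one_ne_zero).pow 2
  sq := hQ.2.2.2.1
  kin := hQ.2.2.2.2.1
  moment := hQ.integrable_moment

lemma abs_d0R_le (q : Plane → ℝ) (x : Plane) : |d0R q x| ≤ ‖fderiv ℝ q x‖ := by
  simpa [d0R, norm_e0] using (fderiv ℝ q x).le_opNorm e0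

lemma abs_d1R_le (q : Plane → ℝ) (x : Plane) : |d1R q x| ≤ ‖fderiv ℝ q x‖ := by
  simpa [d1R, norm_e1] using (fderiv ℝ q x).le_opNorm e1

lemma d0R_sq_add (q : Plane → ℝ) (x : Plane) : d0R q x ^ 2 + d1R q x ^ 2 = ‖fderiv ℝ q x‖ ^ 2 :=
  (norm_sq_clm _).symm

/-- Testing the equation with the ground state itself. -/
lemma kin_add_mass (hQ : IsGroundState Q) : kin Q + mass Q = quart Q := by
  obtain ⟨G, hG, η, hη⟩ := exists_weighted_cutoffs
  have hpos : ∀ n : ℕ, (0 : ℝ) < n + 1 := fun n => by positivity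
  have hA := hQ.admissible
  have hQc := hQ.1.continuous
  have hQ1 := hQ.contDiff_one
  have i1 := hA.kin
  have i2 := hA.sq
  have i3 := hA.integrable_quart
  have i4 := hA.integrable_mul_fderiv
  have c0 := hQ.contDiff_d0R.continuous
  have c1 := hQ.contDiff_d1R.continuous
  have cF : Continuous (fderiv ℝ Q) := hQ1.continuous_fderiv one_ne_zero
  have hlim : Tendsto (fun n : ℕ => ∫ x, (η (n + 1) x * (‖fderiv ℝ Q x‖ ^ 2 + Q x ^ 2 - Q x ^ 4) +
      Q x * (d0R (η (n + 1)) x * d0R Q x + d1R (η (n + 1)) x * d1R Q x))) atTop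
      (𝓝 (∫ x, (‖fderiv ℝ Q x‖ ^ 2 + Q x ^ 2 - Q x ^ 4))) := by
    refine tendsto_integral_of_dominated_convergence
      (fun x => ‖fderiv ℝ Q x‖ ^ 2 + Q x ^ 2 + Q x ^ 4 + 2 * G * (Q x * ‖fderiv ℝ Q x‖))
      (fun n => ?_) (((i1.add i2).add i3).add (i4.const_mul _))
      (fun n => Eventually.of_forall fun x => ?_) (Eventually.of_forall fun x => ?_)
    · have h1 := (hη _ (hpos n)).1
      have h2 := h1.continuous
      have h3 : ∀ v, Continuous fun x => fderiv ℝ (η (n + 1)) x v := fun v =>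
        (h1.continuous_fderiv one_ne_zero).clm_apply continuous_const
      have h30 : Continuous (d0R (η (n + 1))) := h3 e0
      have h31 : Continuous (d1R (η (n + 1))) := h3 e1
      exact Continuous.aestronglyMeasurable (by fun_prop)
    · obtain ⟨h1, h2, h3, h4, h5, h6, h7, h8⟩ := hη _ (hpos n)
      have a3 : ‖fderiv ℝ (η (n + 1)) x‖ ≤ G :=
        (h6 x).trans (div_le_self hG.le (by linarith [(Nat.cast_nonneg n : (0 : ℝ) ≤ n)]))
      have b0 := (abs_d0R_le (η (n + 1)) x).trans a3
      have b1 := (abs_d1R_le (η (n + 1)) x).trans a3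
      have m0 : |d0R (η (n + 1)) x * d0R Q x| ≤ G * ‖fderiv ℝ Q x‖ := by
        rw [abs_mul]; exact mul_le_mul b0 (abs_d0R_le Q x) (abs_nonneg _) hG.le
      have m1 : |d1R (η (n + 1)) x * d1R Q x| ≤ G * ‖fderiv ℝ Q x‖ := by
        rw [abs_mul]; exact mul_le_mul b1 (abs_d1R_le Q x) (abs_nonneg _) hG.le
      rw [Real.norm_eq_abs]
      refine (abs_add_le _ _).trans ?_
      rw [abs_mul, abs_mul, abs_of_nonneg (h3 x).1, abs_of_nonneg (hA.nonneg x)]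
      have t1 : |‖fderiv ℝ Q x‖ ^ 2 + Q x ^ 2 - Q x ^ 4| ≤
          ‖fderiv ℝ Q x‖ ^ 2 + Q x ^ 2 + Q x ^ 4 := by
        have : 0 ≤ Q x ^ 4 := by positivity
        rw [abs_le]; constructor <;> nlinarith [sq_nonneg ‖fderiv ℝ Q x‖, sq_nonneg (Q x)]
      have t2 := mul_le_of_le_one_left (abs_nonneg (‖fderiv ℝ Q x‖ ^ 2 + Q x ^ 2 - Q x ^ 4)) (h3 x).2
      have t3 := mul_le_mul_of_nonneg_left ((abs_add_le _ _).trans (add_le_add m0 m1)) (hA.nonneg x)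
      linarith
    · refine tendsto_const_nhds.congr' ?_
      filter_upwards [eventually_ge_atTop ⌈‖x‖⌉₊] with n hn
      have hx : ‖x‖ ≤ (n : ℝ) + 1 := (Nat.ceil_le.1 hn).trans (by linarith)
      obtain ⟨h1, h2, h3, h4, h5, h6, h7, h8⟩ := hη _ (hpos n)
      simp [d0R, d1R, h4 x hx, h8 x hx]
  have hzero : ∀ n : ℕ, ∫ x, (η (n + 1) x * (‖fderiv ℝ Q x‖ ^ 2 + Q x ^ 2 - Q x ^ 4) +
      Q x * (d0R (η (n + 1)) x * d0R Q x + d1R (η (n + 1)) x * d1R Q x)) = 0 := by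
    intro n
    obtain ⟨h1, h2, -⟩ := hη _ (hpos n)
    rw [← hQ.weak_form (h1.mul hQ1) (HasCompactSupport.mul_right (f' := Q) h2)]
    refine integral_congr_ae (Eventually.of_forall fun x => ?_)
    have dη := h1.differentiable one_ne_zero x
    have dQ := hQ1.differentiable one_ne_zero x
    simp only [d0R, d1R, norm_sq_clm]
    rw [fderiv_fun_mul dη dQ]
    simp
    ring
  simp only [hzero] at hlim
  have h0 := tendsto_nhds_unique hlim tendsto_const_nhds
  rw [integral_sub (i1.fun_add i2) i3, integral_add i1 i2] at h0
  simp only [kin, mass, quart]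
  linarith

end IsGroundState

namespace IsGroundState

variable {Q : Plane → ℝ}

/-- The first component of the Pohozaev vector field. -/
def pohozaev0 (Q : Plane → ℝ) (x : Plane) : ℝ :=
  (x 0 * d0R Q x + x 1 * d1R Q x) * d0R Q x - x 0 * ((d0R Q x ^ 2 + d1R Q x ^ 2) / 2) +
    x 0 * (Q x ^ 4 / 4 - Q x ^ 2 / 2)

/-- The second component of the Pohozaev vector field. -/
def pohozaev1 (Q : Plane → ℝ) (x : Plane) : ℝ :=
  (x 0 * d0R Q x + x 1 * d1R Q x) * d1R Q x - x 1 * ((d0R Q x ^ 2 + d1R Q x ^ 2) / 2) +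
    x 1 * (Q x ^ 4 / 4 - Q x ^ 2 / 2)

lemma contDiff_coord (i : Fin 2) : ContDiff ℝ 1 fun x : Plane => x i :=
  (EuclideanSpace.proj (𝕜 := ℝ) i).contDiff

lemma contDiff_pohozaev0 (hQ : IsGroundState Q) : ContDiff ℝ 1 (pohozaev0 Q) := by
  have h0 := hQ.contDiff_d0R
  have h1 := hQ.contDiff_d1R
  have h := hQ.contDiff_one
  have c0 := contDiff_coord 0
  have c1 := contDiff_coord 1
  unfold pohozaev0
  fun_prop

lemma contDiff_pohozaev1 (hQ : IsGroundState Q) : ContDiff ℝ 1 (pohozaev1 Q) := by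
  have h0 := hQ.contDiff_d0R
  have h1 := hQ.contDiff_d1R
  have h := hQ.contDiff_one
  have c0 := contDiff_coord 0
  have c1 := contDiff_coord 1
  unfold pohozaev1
  fun_prop

lemma fderiv_d0R_comm (hQ : IsGroundState Q) (x : Plane) :
    fderiv ℝ (d0R Q) x e1 = fderiv ℝ (d1R Q) x e0 := by
  have hd : DifferentiableAt ℝ (fderiv ℝ Q) x :=
    (hQ.1.fderiv_right (m := 1) (by norm_num)).differentiable one_ne_zero x
  have key : ∀ v w : Plane, fderiv ℝ (fun y => fderiv ℝ Q y v) x w = fderiv ℝ (fderiv ℝ Q) x w v := by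
    intro v w
    rw [fderiv_clm_apply hd (differentiableAt_const v)]
    simp
  have hs := (hQ.1.contDiffAt (x := x)).isSymmSndFDerivAt (by simp)
  show fderiv ℝ (fun y => fderiv ℝ Q y e0) x e1 = fderiv ℝ (fun y => fderiv ℝ Q y e1) x e0
  rw [key, key]
  exact hs e1 e0

lemma div_pohozaev (hQ : IsGroundState Q) (x : Plane) :
    fderiv ℝ (pohozaev0 Q) x e0 + fderiv ℝ (pohozaev1 Q) x e1 = 2 * (Q x ^ 4 / 4 - Q x ^ 2 / 2) := by
  have c0 : HasFDerivAt (fun x : Plane => x 0) (EuclideanSpace.proj (𝕜 := ℝ) (0 : Fin 2)) x :=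
    (EuclideanSpace.proj (𝕜 := ℝ) (0 : Fin 2)).hasFDerivAt
  have c1 : HasFDerivAt (fun x : Plane => x 1) (EuclideanSpace.proj (𝕜 := ℝ) (1 : Fin 2)) x :=
    (EuclideanSpace.proj (𝕜 := ℝ) (1 : Fin 2)).hasFDerivAt
  have h0 := (hQ.contDiff_d0R.differentiable one_ne_zero x).hasFDerivAt
  have h1 := (hQ.contDiff_d1R.differentiable one_ne_zero x).hasFDerivAt
  have h := (hQ.contDiff_one.differentiable one_ne_zero x).hasFDerivAt
  have hpow : ∀ (n : ℕ) {f : Plane → ℝ} {f' : Plane →L[ℝ] ℝ}, HasFDerivAt f f' x →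
      HasFDerivAt (fun y => f y ^ n) ((n * f x ^ (n - 1)) • f') x := fun n f f' hf => by
    simpa using hf.pow n
  have hs := (c0.fun_mul h0).fun_add (c1.fun_mul h1)
  have hg := ((hpow 4 h).mul_const (1 / 4)).fun_sub ((hpow 2 h).mul_const (1 / 2))
  have hp := ((hpow 2 h0).fun_add (hpow 2 h1)).mul_const (1 / 2)
  have f0 := (((hs.fun_mul h0).fun_sub (c0.fun_mul hp)).fun_add (c0.fun_mul hg)).fderiv
  have f1 := (((hs.fun_mul h1).fun_sub (c1.fun_mul hp)).fun_add (c1.fun_mul hg)).fderiv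
  have e00 : (e0 : Plane) 0 = 1 := by simp [e0]
  have e01 : (e0 : Plane) 1 = 0 := by simp [e0]
  have e10 : (e1 : Plane) 0 = 0 := by simp [e1]
  have e11 : (e1 : Plane) 1 = 1 := by simp [e1]
  have r0 : pohozaev0 Q = fun x => (x 0 * d0R Q x + x 1 * d1R Q x) * d0R Q x -
      x 0 * ((d0R Q x ^ 2 + d1R Q x ^ 2) * (1 / 2)) + x 0 * (Q x ^ 4 * (1 / 4) - Q x ^ 2 * (1 / 2)) := by
    funext y; simp only [pohozaev0]; ring
  have r1 : pohozaev1 Q = fun x => (x 0 * d0R Q x + x 1 * d1R Q x) * d1R Q x -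
      x 1 * ((d0R Q x ^ 2 + d1R Q x ^ 2) * (1 / 2)) + x 1 * (Q x ^ 4 * (1 / 4) - Q x ^ 2 * (1 / 2)) := by
    funext y; simp only [pohozaev1]; ring
  rw [r0, r1, f0, f1]
  have hsy := hQ.fderiv_d0R_comm x
  have hpde := hQ.2.2.2.2.2 x
  have q0 : fderiv ℝ Q x e0 = d0R Q x := rfl
  have q1 : fderiv ℝ Q x e1 = d1R Q x := rfl
  simp only [lapR] at hpde
  have pr : ∀ (i : Fin 2) (v : Plane), EuclideanSpace.proj (𝕜 := ℝ) i v = v i := fun _ _ => rfl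
  simp only [_root_.add_apply, _root_.sub_apply, _root_.smul_apply, smul_eq_mul, pr, e00, e01, e10,
    e11, hsy, q0, q1]
  push_cast
  linear_combination (-(x 0 * d0R Q x + x 1 * d1R Q x)) * hpde

lemma abs_coord_le (x : Plane) (i : Fin 2) : |x i| ≤ ‖x‖ := by
  simpa using PiLp.norm_apply_le x i

/-- The Pohozaev identity. -/
lemma mass_eq (hQ : IsGroundState Q) : mass Q = 1 / 2 * quart Q := by
  obtain ⟨G, hG, η, hη⟩ := exists_weighted_cutoffs
  have hpos : ∀ n : ℕ, (0 : ℝ) < n + 1 := fun n => by positivity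
  have hA := hQ.admissible
  have i1 := hA.kin
  have i2 := hA.sq
  have i3 := hA.integrable_quart
  have hX0 := hQ.contDiff_pohozaev0
  have hX1 := hQ.contDiff_pohozaev1
  have c0 := hX0.continuous
  have c1 := hX1.continuous
  have hQc := hQ.1.continuous
  have hlim : Tendsto (fun n : ℕ => ∫ x, (η (n + 1) x * (2 * (Q x ^ 4 / 4 - Q x ^ 2 / 2)) +
      (d0R (η (n + 1)) x * pohozaev0 Q x + d1R (η (n + 1)) x * pohozaev1 Q x))) atTop
      (𝓝 (∫ x, 2 * (Q x ^ 4 / 4 - Q x ^ 2 / 2))) := by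
    refine tendsto_integral_of_dominated_convergence
      (fun x => (1 + 4 * G) * (3 * ‖fderiv ℝ Q x‖ ^ 2 + Q x ^ 2 + Q x ^ 4))
      (fun n => ?_) ((((i1.const_mul 3).add i2).add i3).const_mul _)
      (fun n => Eventually.of_forall fun x => ?_) (Eventually.of_forall fun x => ?_)
    · have h1 := (hη _ (hpos n)).1
      have h2 := h1.continuous
      have h3 : ∀ v, Continuous fun x => fderiv ℝ (η (n + 1)) x v := fun v =>
        (h1.continuous_fderiv one_ne_zero).clm_apply continuous_const
      have h30 : Continuous (d0R (η (n + 1))) := h3 e0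
      have h31 : Continuous (d1R (η (n + 1))) := h3 e1
      exact Continuous.aestronglyMeasurable (by fun_prop)
    · obtain ⟨h1, h2, h3, h4, h5, h6, h7, h8⟩ := hη _ (hpos n)
      set D := ‖fderiv ℝ Q x‖ with hD
      set Y := 3 * D ^ 2 + Q x ^ 2 + Q x ^ 4 with hY
      have hD0 : 0 ≤ D := norm_nonneg _
      have q4 : 0 ≤ Q x ^ 4 := by positivity
      have q2 : 0 ≤ Q x ^ 2 := by positivity
      have hY0 : 0 ≤ Y := by positivity
      have p0 := abs_d0R_le Q x
      have p1 := abs_d1R_le Q x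
      have m0 := abs_coord_le x 0
      have m1 := abs_coord_le x 1
      have hsum : |x 0 * d0R Q x + x 1 * d1R Q x| ≤ 2 * (‖x‖ * D) := by
        refine (abs_add_le _ _).trans ?_
        rw [abs_mul, abs_mul]
        have := mul_le_mul m0 p0 (abs_nonneg _) (norm_nonneg _)
        have := mul_le_mul m1 p1 (abs_nonneg _) (norm_nonneg _)
        linarith
      have hg : |Q x ^ 4 / 4 - Q x ^ 2 / 2| ≤ (Q x ^ 2 + Q x ^ 4) / 2 := by
        rw [abs_le]; constructor <;> linarith
      have hk : (d0R Q x ^ 2 + d1R Q x ^ 2) / 2 = D ^ 2 / 2 := by rw [d0R_sq_add]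
      have hX : ∀ (s p : ℝ), |s| ≤ ‖x‖ → |p| ≤ D →
          |(x 0 * d0R Q x + x 1 * d1R Q x) * p - s * ((d0R Q x ^ 2 + d1R Q x ^ 2) / 2) +
            s * (Q x ^ 4 / 4 - Q x ^ 2 / 2)| ≤ ‖x‖ * Y := by
        intro s p hs hp
        rw [hk]
        refine (abs_add_le _ _).trans ((add_le_add_left (abs_sub _ _) _).trans ?_)
        rw [abs_mul, abs_mul, abs_mul, abs_of_nonneg (by positivity : 0 ≤ D ^ 2 / 2)]
        have t1 := mul_le_mul hsum hp (abs_nonneg _) (by positivity)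
        have t2 := mul_le_mul_of_nonneg_right hs (by positivity : 0 ≤ D ^ 2 / 2)
        have t3 := mul_le_mul hs hg (abs_nonneg _) (norm_nonneg _)
        have t4 : 0 ≤ ‖x‖ * D ^ 2 := by positivity
        have t5 : 0 ≤ ‖x‖ * (Q x ^ 2 + Q x ^ 4) := by positivity
        rw [hY]
        nlinarith
      have hP : ∀ (d s : ℝ), |d| ≤ ‖fderiv ℝ (η (n + 1)) x‖ → |s| ≤ ‖x‖ * Y →
          |d * s| ≤ 2 * G * Y := by
        intro d s hd hs
        rw [abs_mul]
        refine (mul_le_mul hd hs (abs_nonneg _) (norm_nonneg _)).trans ?_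
        rw [← mul_assoc]
        exact mul_le_mul_of_nonneg_right (h7 x) hY0
      have u0 := hP _ (pohozaev0 Q x) (abs_d0R_le _ x) (hX _ _ m0 p0)
      have u1 := hP _ (pohozaev1 Q x) (abs_d1R_le _ x) (hX _ _ m1 p1)
      rw [Real.norm_eq_abs]
      refine (abs_add_le _ _).trans ?_
      have u2 : |η (n + 1) x * (2 * (Q x ^ 4 / 4 - Q x ^ 2 / 2))| ≤ Y := by
        rw [abs_mul, abs_mul, abs_of_nonneg (h3 x).1, abs_two]
        refine (mul_le_of_le_one_left (by positivity) (h3 x).2).trans ?_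
        have : 0 ≤ D ^ 2 := by positivity
        linarith
      have := abs_add_le (d0R (η (n + 1)) x * pohozaev0 Q x) (d1R (η (n + 1)) x * pohozaev1 Q x)
      linarith
    · refine tendsto_const_nhds.congr' ?_
      filter_upwards [eventually_ge_atTop ⌈‖x‖⌉₊] with n hn
      have hx : ‖x‖ ≤ (n : ℝ) + 1 := (Nat.ceil_le.1 hn).trans (by linarith)
      obtain ⟨h1, h2, h3, h4, h5, h6, h7, h8⟩ := hη _ (hpos n)
      simp [d0R, d1R, h4 x hx, h8 x hx]
  have hzero : ∀ n : ℕ, ∫ x, (η (n + 1) x * (2 * (Q x ^ 4 / 4 - Q x ^ 2 / 2)) +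
      (d0R (η (n + 1)) x * pohozaev0 Q x + d1R (η (n + 1)) x * pohozaev1 Q x)) = 0 := by
    intro n
    obtain ⟨h1, h2, -⟩ := hη _ (hpos n)
    have j0 := integral_mul_fderiv_of_hasCompactSupport h1 hX0 h2 e0
    have j1 := integral_mul_fderiv_of_hasCompactSupport h1 hX1 h2 e1
    have hd : ∀ (g : Plane → ℝ) (_ : ContDiff ℝ 1 g) (v : Plane),
        Integrable fun x => η (n + 1) x * fderiv ℝ g x v := fun g hg v =>
      integrable_mul_of_hasCompactSupport h1.continuous
        ((hg.continuous_fderiv one_ne_zero).clm_apply continuous_const) h2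
    have hd' : ∀ (g : Plane → ℝ) (_ : ContDiff ℝ 1 g) (v : Plane),
        Integrable fun x => fderiv ℝ (η (n + 1)) x v * g x := fun g hg v =>
      integrable_mul_of_hasCompactSupport
        ((h1.continuous_fderiv one_ne_zero).clm_apply continuous_const) hg.continuous
        (h2.fderiv_apply ℝ v)
    have k0 := hd _ hX0 e0
    have k1 := hd _ hX1 e1
    have k0' : Integrable fun x => d0R (η (n + 1)) x * pohozaev0 Q x := hd' _ hX0 e0
    have k1' : Integrable fun x => d1R (η (n + 1)) x * pohozaev1 Q x := hd' _ hX1 e1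
    have j0' : ∫ x, d0R (η (n + 1)) x * pohozaev0 Q x =
        -∫ x, η (n + 1) x * fderiv ℝ (pohozaev0 Q) x e0 := by rw [j0, neg_neg]; rfl
    have j1' : ∫ x, d1R (η (n + 1)) x * pohozaev1 Q x =
        -∫ x, η (n + 1) x * fderiv ℝ (pohozaev1 Q) x e1 := by rw [j1, neg_neg]; rfl
    have hrew : ∀ x, η (n + 1) x * (2 * (Q x ^ 4 / 4 - Q x ^ 2 / 2)) =
        η (n + 1) x * fderiv ℝ (pohozaev0 Q) x e0 + η (n + 1) x * fderiv ℝ (pohozaev1 Q) x e1 :=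
      fun x => by rw [← hQ.div_pohozaev x]; ring
    simp only [hrew]
    rw [integral_add (k0.fun_add k1) (k0'.fun_add k1'), integral_add k0 k1, integral_add k0' k1',
      j0', j1']
    ring
  simp only [hzero] at hlim
  have h0 := tendsto_nhds_unique hlim tendsto_const_nhds
  rw [integral_const_mul, integral_sub (i3.div_const 4) (i2.div_const 2), integral_div,
    integral_div] at h0
  simp only [mass, quart]
  linarith

lemma kin_eq (hQ : IsGroundState Q) : kin Q = mass Q := by
  linarith [hQ.kin_add_mass, hQ.mass_eq]

lemma mass_pos (hQ : IsGroundState Q) : 0 < mass Q := by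
  refine (integral_pos_iff_support_of_nonneg (fun x => sq_nonneg _) hQ.2.2.2.1).2 ?_
  have : Function.support (fun x => Q x ^ 2) = univ :=
    eq_univ_of_forall fun x => pow_ne_zero 2 (hQ.2.1 x).ne'
  rw [this]
  exact isOpen_univ.measure_pos volume univ_nonempty

end IsGroundState

/-- The Gagliardo–Nirenberg inequality with constant `A` on the core. -/
def GNBound (A : ℝ) : Prop := ∀ f : Plane → ℝ, IsCore f → A * (1 / 2 * quart f) ≤ kin f * mass f

/-- The reduced energy of a function of unit mass. -/
def reducedEnergy (A κ : ℝ) (f : Plane → ℝ) : ℝ :=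
  kin f + κ * (kin f / A - 1 / 2 * quart f) + 1 / 2 * logE f

/-- The infimum of the reduced energy over core functions of unit mass. -/
def reducedInf (A κ : ℝ) : ℝ := sInf (reducedEnergy A κ '' {f | IsCore f ∧ mass f = 1})

lemma GNBound.half_quart_le {A : ℝ} (hA : 0 < A) (h : GNBound A) {f : Plane → ℝ} (hf : IsCore f)
    (hm : mass f = 1) : 1 / 2 * quart f ≤ kin f / A := by
  rw [le_div_iff₀ hA]
  have := h f hf
  rw [hm] at this
  linarith

lemma reducedEnergy_ge {A : ℝ} (hA : 0 < A) (h : GNBound A) {κ : ℝ} (hκ : 0 ≤ κ) {f : Plane → ℝ}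
    (hf : IsCore f) (hm : mass f = 1) :
    1 / 2 * kin f + 1 / 2 * plusE f - kernelNorm / (4 * A) ≤ reducedEnergy A κ f := by
  have h1 := h.half_quart_le hA hf hm
  have h2 := hf.hasFiniteEnergy.negE_le (s := 1 / A) (by positivity)
  rw [hm, one_mul] at h2
  have h3 : 1 / (2 * (1 / A)) * quart f ≤ kin f := by
    rw [le_div_iff₀ hA] at h1
    have : 1 / (2 * (1 / A)) = A / 2 := by field_simp
    rw [this]
    linarith
  have h4 : 1 / A / 2 * kernelNorm = 2 * (kernelNorm / (4 * A)) := by field_simp; ring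
  have h5 := mul_nonneg hκ (sub_nonneg.2 h1)
  rw [reducedEnergy, hf.hasFiniteEnergy.logE_eq]
  linarith

lemma bddBelow_reducedEnergy {A : ℝ} (hA : 0 < A) (h : GNBound A) {κ : ℝ} (hκ : 0 ≤ κ) :
    BddBelow (reducedEnergy A κ '' {f | IsCore f ∧ mass f = 1}) := by
  refine ⟨-(kernelNorm / (4 * A)), ?_⟩
  rintro _ ⟨f, ⟨hf, hm⟩, rfl⟩
  linarith [reducedEnergy_ge hA h hκ hf hm, kin_nonneg f, plusE_nonneg f]

lemma reducedInf_le {A : ℝ} (hA : 0 < A) (h : GNBound A) {κ : ℝ} (hκ : 0 ≤ κ) {f : Plane → ℝ}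
    (hf : IsCore f) (hm : mass f = 1) : reducedInf A κ ≤ reducedEnergy A κ f :=
  csInf_le (bddBelow_reducedEnergy hA h hκ) ⟨f, ⟨hf, hm⟩, rfl⟩

/-- The normalisation of a core function to unit mass. -/
def unitize (f : Plane → ℝ) (x : Plane) : ℝ := (Real.sqrt (mass f))⁻¹ * f x

lemma IsCore.unitize {f : Plane → ℝ} (hf : IsCore f) : IsCore (unitize f) := hf.const_mul _

lemma inv_sqrt_mass_sq {f : Plane → ℝ} (hm : 0 < mass f) :
    (Real.sqrt (mass f))⁻¹ ^ 2 = (mass f)⁻¹ := by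
  rw [inv_pow, Real.sq_sqrt hm.le]

lemma inv_sqrt_mass_pow_four {f : Plane → ℝ} (hm : 0 < mass f) :
    (Real.sqrt (mass f))⁻¹ ^ 4 = (mass f ^ 2)⁻¹ := by
  rw [show (4 : ℕ) = 2 * 2 by norm_num, pow_mul, inv_sqrt_mass_sq hm, inv_pow]

lemma mass_unitize {f : Plane → ℝ} (hm : 0 < mass f) : mass (unitize f) = 1 := by
  unfold unitize
  rw [mass_const_mul, inv_sqrt_mass_sq hm, inv_mul_cancel₀ hm.ne']

lemma kin_unitize {f : Plane → ℝ} (hm : 0 < mass f) : kin (unitize f) = (mass f)⁻¹ * kin f := by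
  unfold unitize
  rw [kin_const_mul, inv_sqrt_mass_sq hm]

lemma quart_unitize {f : Plane → ℝ} (hm : 0 < mass f) :
    quart (unitize f) = (mass f ^ 2)⁻¹ * quart f := by
  unfold unitize
  rw [quart_const_mul, inv_sqrt_mass_pow_four hm]

lemma logE_unitize {f : Plane → ℝ} (hm : 0 < mass f) :
    logE (unitize f) = (mass f ^ 2)⁻¹ * logE f := by
  unfold unitize
  rw [logE_const_mul, inv_sqrt_mass_pow_four hm]

lemma reducedEnergy_unitize {f : Plane → ℝ} (hm : 0 < mass f) (A κ : ℝ) :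
    mass f ^ 2 * reducedEnergy A κ (unitize f) =
    (1 + κ / A) * kin f * mass f - κ * (1 / 2 * quart f) + 1 / 2 * logE f := by
  have := hm.ne'
  rw [reducedEnergy, kin_unitize hm, quart_unitize hm, logE_unitize hm]
  field_simp
  ring

lemma reducedInf_mul_le {A : ℝ} (hA : 0 < A) (h : GNBound A) {κ : ℝ} (hκ : 0 ≤ κ) {τ : ℝ}
    (hτ : 0 < τ) {f : Plane → ℝ} (hf : IsCore f) (hm : 0 < mass f) :
    reducedInf A κ * mass f ^ 2 ≤
      τ ^ 2 * ((1 + κ / A) * kin f * mass f - κ * (1 / 2 * quart f)) +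
        1 / 2 * (logE f - mass f ^ 2 * Real.log τ) := by
  have hc := hf.dilate hτ
  have hmd := mass_dilate f hτ
  have h1 := reducedInf_le hA h hκ hc.unitize (mass_unitize (by rw [hmd]; exact hm))
  have h2 := reducedEnergy_unitize (f := fun x => τ * f (τ • x)) (by rw [hmd]; exact hm) A κ
  rw [hmd, kin_dilate f hτ, quart_dilate f hτ, hf.hasFiniteEnergy.logE_dilate hτ] at h2
  have h3 := mul_le_mul_of_nonneg_left h1 (sq_nonneg (mass f))
  rw [h2] at h3
  linarith

lemma Admissible.reducedInf_mul_le {A : ℝ} (hA : 0 < A) (h : GNBound A) {κ : ℝ} (hκ : 0 ≤ κ) {τ : ℝ}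
    (hτ : 0 < τ) {f : Plane → ℝ} (hf : Admissible f) (hm : 0 < mass f) :
    reducedInf A κ * mass f ^ 2 ≤
      τ ^ 2 * ((1 + κ / A) * _root_.kin f * mass f - κ * (1 / 2 * quart f)) +
        1 / 2 * (logE f - mass f ^ 2 * Real.log τ) := by
  obtain ⟨v, hv, h1, h2, h3, k, h4, h5⟩ := hf.exists_approx
  refine le_of_tendsto_of_tendsto (tendsto_const_nhds.mul (h1.pow 2))
    ((((((h5.const_mul (1 + κ / A)).mul h1).sub ((h2.const_mul (1 / 2)).const_mul κ))).const_mul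
      (τ ^ 2)).add ((h3.sub ((h1.pow 2).mul_const (Real.log τ))).const_mul (1 / 2))) ?_
  filter_upwards [h1.eventually (lt_mem_nhds hm)] with n hn
  refine (_root_.reducedInf_mul_le hA h hκ hτ (hv n) hn).trans ?_
  have : (1 + κ / A) * _root_.kin (v n) * mass (v n) ≤ (1 + κ / A) * k n * mass (v n) := by
    have := h4 n
    gcongr
  gcongr

/-- The set of competitors is nonempty. -/
lemma Admissible.exists_unit {f : Plane → ℝ} (hf : Admissible f) (hm : 0 < mass f) (A κ : ℝ) :
    (reducedEnergy A κ '' {f | IsCore f ∧ mass f = 1}).Nonempty := by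
  obtain ⟨v, hv, h1, -⟩ := hf.exists_approx
  obtain ⟨n, hn⟩ := (h1.eventually (lt_mem_nhds hm)).exists
  exact ⟨_, _, ⟨(hv n).unitize, mass_unitize hn⟩, rfl⟩

lemma reducedInf_mono {A : ℝ} (hA : 0 < A) (h : GNBound A) {Q : Plane → ℝ} (hQ : Admissible Q)
    (hm : 0 < mass Q) {κ κ' : ℝ} (hκ : 0 ≤ κ) (hκκ' : κ ≤ κ') :
    reducedInf A κ ≤ reducedInf A κ' := by
  refine le_csInf (hQ.exists_unit hm _ _) ?_
  rintro _ ⟨f, ⟨hf, hf1⟩, rfl⟩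
  refine (reducedInf_le hA h hκ hf hf1).trans ?_
  have := mul_le_mul_of_nonneg_right hκκ' (sub_nonneg.2 (h.half_quart_le hA hf hf1))
  unfold reducedEnergy
  linarith

namespace IsGroundState

variable {Q : Plane → ℝ}

lemma reducedInf_le (hQ : IsGroundState Q) (h : GNBound (mass Q)) {κ : ℝ} (hκ : 0 ≤ κ) :
    reducedInf (mass Q) κ ≤ 1 + 1 / 2 * logE Q / mass Q ^ 2 := by
  have hm := hQ.mass_pos
  have h1 := hQ.admissible.reducedInf_mul_le hm h hκ one_pos hm
  rw [← hQ.mass_eq, hQ.kin_eq, Real.log_one] at h1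
  have h2 : 1 + 1 / 2 * logE Q / mass Q ^ 2 = (mass Q ^ 2 + 1 / 2 * logE Q) / mass Q ^ 2 := by
    field_simp
  rw [h2, le_div_iff₀ (by positivity)]
  refine h1.trans (le_of_eq ?_)
  field_simp
  ring

lemma exists_tendsto_reducedInf (hQ : IsGroundState Q) (h : GNBound (mass Q)) :
    ∃ l, Tendsto (reducedInf (mass Q)) atTop (𝓝 l) := by
  have hm := hQ.mass_pos
  have hmono : Monotone fun κ => reducedInf (mass Q) (max κ 0) := fun a b hab =>
    reducedInf_mono hm h hQ.admissible hm (le_max_right _ _) (max_le_max hab le_rfl)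
  have hb : BddAbove (range fun κ => reducedInf (mass Q) (max κ 0)) :=
    ⟨_, by rintro _ ⟨κ, rfl⟩; exact hQ.reducedInf_le h (le_max_right _ _)⟩
  refine ⟨_, (tendsto_atTop_ciSup hmono hb).congr' ?_⟩
  filter_upwards [eventually_ge_atTop 0] with κ hκ
  rw [max_eq_left hκ]

end IsGroundState

lemma negLog_neg (z : Plane) : negLog (-z) = negLog z := by simp [negLog]

lemma plusLog_neg (z : Plane) : plusLog (-z) = plusLog z := by simp [plusLog]

lemma plusE_le_plusE {f g : Plane → ℝ} (hf : HasFiniteEnergy f) (hgf : ∀ x, g x ^ 2 ≤ f x ^ 2) :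
    plusE g ≤ plusE f := by
  refine integral_mono_of_nonneg (Eventually.of_forall fun p => ?_) hf.integrable_prod_plusLog
    (Eventually.of_forall fun p => ?_)
  · exact mul_nonneg (plusLog_nonneg _) (by positivity)
  · have := plusLog_nonneg (p.1 - p.2)
    have := hgf p.1
    have := hgf p.2
    dsimp only
    gcongr

lemma negE_le_add {f g : Plane → ℝ} (hf : HasFiniteEnergy f) (hg : HasFiniteEnergy g)
    (hgf : ∀ x, g x ^ 2 ≤ f x ^ 2) {N : ℝ} (hN : ∀ x, ∫ y, negLog (x - y) * f y ^ 2 ≤ N) :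
    negE f ≤ negE g + 2 * N * (mass f - mass g) := by
  have hfc := hf.cont
  have hgc := hg.cont
  have hD : ∀ x, 0 ≤ f x ^ 2 - g x ^ 2 := fun x => sub_nonneg.2 (hgf x)
  have i1 : Integrable fun p : Plane × Plane =>
      negLog (p.1 - p.2) * ((f p.1 ^ 2 - g p.1 ^ 2) * f p.2 ^ 2) := by
    refine hf.integrable_prod_negLog.mono' ?_ (Eventually.of_forall fun p => ?_)
    · have h1 : Measurable fun p : Plane × Plane => negLog (p.1 - p.2) :=
        measurable_negLog.comp (measurable_fst.sub measurable_snd)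
      have h2 : Continuous fun p : Plane × Plane => (f p.1 ^ 2 - g p.1 ^ 2) * f p.2 ^ 2 := by
        fun_prop
      exact (h1.mul h2.measurable).aestronglyMeasurable
    · have h1 := negLog_nonneg (p.1 - p.2)
      have h2 := hD p.1
      rw [Real.norm_eq_abs, abs_of_nonneg (by positivity)]
      have : f p.1 ^ 2 - g p.1 ^ 2 ≤ f p.1 ^ 2 := by linarith [sq_nonneg (g p.1)]
      gcongr
  have i2 : Integrable fun p : Plane × Plane =>
      negLog (p.1 - p.2) * ((f p.2 ^ 2 - g p.2 ^ 2) * f p.1 ^ 2) := by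
    refine i1.swap.congr (Eventually.of_forall fun p => ?_)
    simp only [Function.comp, Prod.fst_swap, Prod.snd_swap]
    rw [← negLog_neg, neg_sub]
  have e2 : ∫ p : Plane × Plane, negLog (p.1 - p.2) * ((f p.2 ^ 2 - g p.2 ^ 2) * f p.1 ^ 2) =
      ∫ p : Plane × Plane, negLog (p.1 - p.2) * ((f p.1 ^ 2 - g p.1 ^ 2) * f p.2 ^ 2) := by
    rw [Measure.volume_eq_prod, ← integral_prod_swap]
    refine integral_congr_ae (Eventually.of_forall fun p => ?_)
    simp only [Prod.fst_swap, Prod.snd_swap]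
    rw [← negLog_neg, neg_sub]
  have e1 : ∫ p : Plane × Plane, negLog (p.1 - p.2) * ((f p.1 ^ 2 - g p.1 ^ 2) * f p.2 ^ 2) ≤
      N * (mass f - mass g) := by
    have hr : ∀ x, ∫ y, negLog (x - y) * ((f x ^ 2 - g x ^ 2) * f y ^ 2) =
        (f x ^ 2 - g x ^ 2) * ∫ y, negLog (x - y) * f y ^ 2 := fun x => by
      rw [← integral_const_mul]
      exact integral_congr_ae (Eventually.of_forall fun y => by ring)
    rw [Measure.volume_eq_prod, integral_prod _ i1, mass, mass, ← integral_sub hf.sq hg.sq,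
      ← integral_const_mul]
    refine integral_mono i1.integral_prod_left ((hf.sq.sub hg.sq).const_mul N) fun x => ?_
    dsimp only
    rw [hr, mul_comm N]
    exact mul_le_mul_of_nonneg_left (hN x) (hD x)
  have e3 : negE f - negE g ≤
      (∫ p : Plane × Plane, negLog (p.1 - p.2) * ((f p.1 ^ 2 - g p.1 ^ 2) * f p.2 ^ 2)) +
      ∫ p : Plane × Plane, negLog (p.1 - p.2) * ((f p.2 ^ 2 - g p.2 ^ 2) * f p.1 ^ 2) := by
    rw [negE, negE, ← integral_sub hf.integrable_prod_negLog hg.integrable_prod_negLog,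
      ← integral_add i1 i2]
    refine integral_mono (hf.integrable_prod_negLog.sub hg.integrable_prod_negLog) (i1.add i2)
      fun p => ?_
    have h1 := mul_nonneg (negLog_nonneg (p.1 - p.2)) (mul_nonneg (hD p.1) (hD p.2))
    dsimp only
    nlinarith
  rw [e2] at e3
  linarith

/-- The logarithmic energy barely increases when a little mass is removed. -/
lemma logE_le_add {f g : Plane → ℝ} (hf : HasFiniteEnergy f) (hg : HasFiniteEnergy g)
    (hgf : ∀ x, g x ^ 2 ≤ f x ^ 2) :
    logE g ≤ logE f + (kernelNorm + quart f) * (mass f - mass g) := by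
  have h1 := plusE_le_plusE hf hgf
  have h2 := negE_le_add hf hg hgf (fun x => hf.integral_negLog_mul_le x one_pos)
  rw [hf.logE_eq, hg.logE_eq]
  linarith

/-- A function of unit mass can be centred so that its logarithmic moment is controlled. -/
lemma IsCore.exists_centered {w : Plane → ℝ} (hw : IsCore w) (hm : mass w = 1) :
    ∃ z, ∫ y, plusLog y * w (y + z) ^ 2 ≤ plusE w + 1 := by
  have hf := hw.hasFiniteEnergy
  have hi := hf.integrable_prod_plusLog
  have key : ∃ z, ∫ y, plusLog (z - y) * w y ^ 2 ≤ plusE w + 1 := by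
    by_contra! hcon
    have hr : ∀ x, ∫ y, plusLog (x - y) * (w x ^ 2 * w y ^ 2) =
        w x ^ 2 * ∫ y, plusLog (x - y) * w y ^ 2 := fun x => by
      rw [← integral_const_mul]
      exact integral_congr_ae (Eventually.of_forall fun y => by ring)
    have h1 : ∫ x, w x ^ 2 * (plusE w + 1) ≤ plusE w := by
      conv_rhs => rw [plusE, Measure.volume_eq_prod, integral_prod _ hi]
      refine integral_mono (hf.sq.mul_const _) hi.integral_prod_left fun x => ?_
      dsimp only
      rw [hr]
      exact mul_le_mul_of_nonneg_left (hcon x).le (sq_nonneg _)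
    rw [integral_mul_const] at h1
    rw [mass] at hm
    rw [hm] at h1
    linarith
  obtain ⟨z, hz⟩ := key
  refine ⟨z, le_trans (le_of_eq ?_) hz⟩
  rw [← integral_add_right_eq_self (fun y => plusLog (z - y) * w y ^ 2) z]
  refine integral_congr_ae (Eventually.of_forall fun y => ?_)
  dsimp only
  rw [← plusLog_neg, sub_add_cancel_right]

lemma IsCore.tail_le {w : Plane → ℝ} (hw : IsCore w) {P R : ℝ} (hR : 1 < R)
    (hP : ∫ y, plusLog y * w y ^ 2 ≤ P) : ∫ x in {x : Plane | R < ‖x‖}, w x ^ 2 ≤ P / Real.log R := by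
  have hlog := Real.log_pos hR
  have hf := hw.hasFiniteEnergy
  have hi : Integrable fun y => plusLog y * w y ^ 2 := by
    refine (hf.integrable_plusLog_mul 0).congr (Eventually.of_forall fun y => ?_)
    dsimp only
    rw [zero_sub, plusLog_neg]
  rw [le_div_iff₀' hlog, ← integral_const_mul]
  refine le_trans ?_ ((setIntegral_le_integral (s := {x : Plane | R < ‖x‖}) hi
    (Eventually.of_forall fun y => mul_nonneg (plusLog_nonneg _) (sq_nonneg _))).trans hP)
  refine setIntegral_mono_on (hf.sq.const_mul _).integrableOn hi.integrableOn
    (measurableSet_lt measurable_const measurable_norm) fun x hx => ?_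
  refine mul_le_mul_of_nonneg_right ?_ (sq_nonneg _)
  have : Real.log R ≤ Real.log ‖x‖ := Real.log_le_log (by linarith) (le_of_lt hx)
  exact this.trans (by unfold plusLog; rw [Real.posLog_apply]; exact le_max_right _ _)

/-- Truncation of a core function outside a large ball by an IMS-type partition. -/
lemma exists_truncation : ∃ C : ℝ, ∀ w : Plane → ℝ, IsCore w → mass w = 1 → ∀ R M : ℝ, 0 < R →
    ∫ x in {x : Plane | R < ‖x‖}, w x ^ 2 ≤ M → ∃ v : Plane → ℝ, ∃ k : ℝ, IsCore v ∧
      (∀ x, 2 * R ≤ ‖x‖ → v x = 0) ∧ 0 ≤ k ∧ mass v ≤ 1 ∧ 1 - M ≤ mass v ∧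
      kin v + k ≤ kin w + (C / R) ^ 2 * M ∧
      1 / 2 * quart w ≤ 1 / 2 * quart v + 8 * M * k + 2 * (C / R) ^ 2 * M ^ 2 ∧
      logE v ≤ logE w + (kernelNorm + quart w) * M := by
  obtain ⟨G, hG, η, hη⟩ := exists_weighted_cutoffs
  refine ⟨Real.pi / 2 * G, fun w hw hm R M hR hM => ?_⟩
  obtain ⟨h1, h2, h3, h4, h5, h6, -, h8⟩ := hη R hR
  set S : Set Plane := {x | R < ‖x‖} with hS
  have hSm : MeasurableSet S := measurableSet_lt measurable_const measurable_norm
  set θ : Plane → ℝ := fun x => Real.pi / 2 * (1 - η R x) with hθ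
  have hθC : ContDiff ℝ 1 θ := contDiff_const.mul (contDiff_const.sub h1)
  have hθd : Differentiable ℝ θ := hθC.differentiable one_ne_zero
  have hθ0 : ∀ x, ‖x‖ ≤ R → θ x = 0 := fun x hx => by simp only [hθ]; rw [h4 x hx]; ring
  have hθ1 : ∀ x, 2 * R ≤ ‖x‖ → θ x = Real.pi / 2 := fun x hx => by
    simp only [hθ]; rw [h5 x hx]; ring
  have hπ := Real.pi_pos
  have hθf : ∀ x, ‖fderiv ℝ θ x‖ = Real.pi / 2 * ‖fderiv ℝ (η R) x‖ := fun x => by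
    simp only [hθ]
    rw [fderiv_const_mul ((h1.differentiable one_ne_zero x).const_sub 1), fderiv_const_sub,
      norm_smul, norm_neg, Real.norm_eq_abs, abs_of_pos (by positivity)]
  have hθB : ∀ x, ‖fderiv ℝ θ x‖ ≤ Real.pi / 2 * G / R := fun x => by
    rw [hθf, mul_div_assoc]
    exact mul_le_mul_of_nonneg_left (h6 x) (by positivity)
  have hθz : ∀ x, x ∉ S → fderiv ℝ θ x = 0 := fun x hx => by
    rw [← norm_eq_zero, hθf, h8 x (not_lt.1 hx), norm_zero, mul_zero]
  set ξ : Plane → ℝ := fun x => Real.sin (θ x) with hξ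
  have hξd : Differentiable ℝ ξ := hθd.sin
  have hcd : Differentiable ℝ fun x => Real.cos (θ x) := hθd.cos
  have hξz : ∀ x, x ∉ S → ξ x = 0 := fun x hx => by
    simp only [hξ]; rw [hθ0 x (not_lt.1 hx), Real.sin_zero]
  have hξ0 : ∀ x, 0 ≤ ξ x := fun x => by
    refine Real.sin_nonneg_of_nonneg_of_le_pi ?_ ?_ <;> simp only [hθ] <;> nlinarith [h3 x]
  have hξB : ∀ x, ‖fderiv ℝ ξ x‖ ≤ Real.pi / 2 * G / R := fun x => by
    simp only [hξ]
    rw [fderiv_sin (hθd x), norm_smul, Real.norm_eq_abs]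
    exact (mul_le_of_le_one_left (norm_nonneg _) (Real.abs_cos_le_one _)).trans (hθB x)
  have hwd := hw.diff
  have hsq := hw.hasFiniteEnergy.sq
  have hq := hw.hasFiniteEnergy.quart
  have hθc : Continuous fun x => ‖fderiv ℝ θ x‖ ^ 2 :=
    (hθC.continuous_fderiv one_ne_zero).norm.pow 2
  have iθ : Integrable fun x => ‖fderiv ℝ θ x‖ ^ 2 * w x ^ 2 := by
    refine (hsq.const_mul ((Real.pi / 2 * G / R) ^ 2)).mono'
      (hθc.mul (hwd.continuous.pow 2)).aestronglyMeasurable (Eventually.of_forall fun x => ?_)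
    rw [Real.norm_eq_abs, abs_of_nonneg (by positivity)]
    exact mul_le_mul_of_nonneg_right (pow_le_pow_left₀ (norm_nonneg _) (hθB x) 2) (sq_nonneg _)
  have hloc := fun x => localization_identity (hwd x) (hθd x)
  have ic : Integrable fun x => ‖fderiv ℝ (fun y => Real.cos (θ y) * w y) x‖ ^ 2 := by
    refine (hw.kin.add iθ).mono' (measurable_fderiv_norm_sq _).aestronglyMeasurable
      (Eventually.of_forall fun x => ?_)
    rw [Real.norm_eq_abs, abs_of_nonneg (by positivity), Pi.add_apply, ← hloc x]
    exact le_add_of_nonneg_right (sq_nonneg _)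
  have is : Integrable fun x => ‖fderiv ℝ (fun y => ξ y * w y) x‖ ^ 2 := by
    refine (hw.kin.add iθ).mono' (measurable_fderiv_norm_sq _).aestronglyMeasurable
      (Eventually.of_forall fun x => ?_)
    rw [Real.norm_eq_abs, abs_of_nonneg (by positivity), Pi.add_apply, ← hloc x]
    exact le_add_of_nonneg_left (sq_nonneg _)
  have hv : IsCore fun x => Real.cos (θ x) * w x :=
    ⟨hcd.mul hwd, HasCompactSupport.mul_left (f := fun x => Real.cos (θ x)) hw.supp, ic⟩
  have hvf := hv.hasFiniteEnergy
  have hle : ∀ x, (Real.cos (θ x) * w x) ^ 2 ≤ w x ^ 2 := fun x => by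
    rw [mul_pow]
    exact mul_le_of_le_one_left (sq_nonneg _) (Real.cos_sq_le_one _)
  have hmass : mass w - mass (fun x => Real.cos (θ x) * w x) ≤ M := by
    refine le_trans ?_ hM
    rw [mass, mass, ← integral_sub hsq hvf.sq, ← integral_indicator hSm]
    refine integral_mono (hsq.sub hvf.sq) (hsq.indicator hSm) fun x => ?_
    by_cases hx : x ∈ S
    · rw [indicator_of_mem hx]
      dsimp only
      linarith [sq_nonneg (Real.cos (θ x) * w x)]
    · rw [indicator_of_notMem hx]
      simp [hθ0 x (not_lt.1 hx)]
  have hk0 := kernelNorm_nonneg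
  have hq0 := quart_nonneg w
  refine ⟨fun x => Real.cos (θ x) * w x, kin (fun y => ξ y * w y), hv, fun x hx => ?_,
    kin_nonneg _, ?_, by linarith, ?_, ?_, ?_⟩
  · simp [hθ1 x hx]
  · rw [← hm]
    exact integral_mono hvf.sq hsq hle
  · rw [kin, kin, ← integral_add ic is, integral_congr_ae (Eventually.of_forall hloc),
      integral_add hw.kin iθ, kin]
    refine add_le_add_right ?_ _
    refine le_trans ?_ (mul_le_mul_of_nonneg_left hM (sq_nonneg _))
    rw [← integral_const_mul, ← integral_indicator hSm]
    refine integral_mono iθ ((hsq.const_mul _).indicator hSm) fun x => ?_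
    by_cases hx : x ∈ S
    · rw [indicator_of_mem hx]
      exact mul_le_mul_of_nonneg_right (pow_le_pow_left₀ (norm_nonneg _) (hθB x) 2) (sq_nonneg _)
    · rw [indicator_of_notMem hx]
      simp [hθz x hx]
  · have hW : ∫ x, ξ x ^ 2 * w x ^ 4 ≤ 8 * M * kin (fun y => ξ y * w y) +
        2 * (Real.pi / 2 * G / R) ^ 2 * M ^ 2 := by
      refine integral_weight_quart_le hwd hξd hξ0 (HasCompactSupport.mul_left (f := ξ)
        (hw.supp.comp_left (g := fun t : ℝ => t ^ 2) (by simp))) hξB hsq is (le_trans ?_ hM)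
      refine setIntegral_mono_set hsq.integrableOn
        (Eventually.of_forall fun x => sq_nonneg _) (LE.le.eventuallyLE ?_)
      intro x hx
      by_contra hcon
      exact hx (hξz x hcon)
    have iW : Integrable fun x => ξ x ^ 2 * w x ^ 4 := by
      refine hq.mono' (((hξd.continuous.pow 2).mul (hwd.continuous.pow 4)).aestronglyMeasurable)
        (Eventually.of_forall fun x => ?_)
      rw [Real.norm_eq_abs, abs_of_nonneg (by positivity)]
      exact mul_le_of_le_one_left (by positivity) (Real.sin_sq_le_one _)
    have hd : quart w - quart (fun x => Real.cos (θ x) * w x) ≤ 2 * ∫ x, ξ x ^ 2 * w x ^ 4 := by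
      rw [quart, quart, ← integral_sub hq hvf.quart, ← integral_const_mul]
      refine integral_mono (hq.sub hvf.quart) (iW.const_mul 2) fun x => ?_
      simp only [hξ]
      have hs := Real.sin_sq (θ x)
      have hc := Real.cos_sq_le_one (θ x)
      have hw4 : 0 ≤ w x ^ 4 := by positivity
      have : w x ^ 4 - (Real.cos (θ x) * w x) ^ 4 =
          (1 - Real.cos (θ x) ^ 2) * (1 + Real.cos (θ x) ^ 2) * w x ^ 4 := by ring
      rw [this, hs, ← mul_assoc]
      refine mul_le_mul_of_nonneg_right ?_ hw4
      nlinarith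
    linarith
  · refine (logE_le_add hw.hasFiniteEnergy hvf hle).trans ?_
    have := mul_le_mul_of_nonneg_left hmass (add_nonneg hk0 hq0)
    linarith

/-- The effect of the truncation on the reduced energy. -/
lemma reducedEnergy_truncation_le {A κ T M N k : ℝ} {v w : Plane → ℝ} (hA : 0 < A) (hκ : 1 ≤ κ)
    (hT : 0 ≤ T) (hM : 0 ≤ M) (hMA : M ≤ 1 / (8 * A)) (hm0 : 0 < mass v) (hm1 : mass v ≤ 1)
    (hk : 0 ≤ k) (hvk : kin v + k ≤ kin w + T / κ * M)
    (hvq : 1 / 2 * quart w ≤ 1 / 2 * quart v + 8 * M * k + 2 * (T / κ) * M ^ 2)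
    (hvl : logE v ≤ logE w + N * M) :
    mass v ^ 2 * reducedEnergy A κ (unitize v) ≤ reducedEnergy A κ w +
      ((1 + 1 / A) * T * M + 2 * T * M ^ 2 + 1 / 2 * N * M) := by
  have hκ0 : 0 < κ := by linarith
  have hc : 0 ≤ 1 + κ / A := by positivity
  have b1 : (1 + κ / A) * kin v * mass v ≤ (1 + κ / A) * kin v :=
    mul_le_of_le_one_right (mul_nonneg hc (kin_nonneg v)) hm1
  have b2 : (1 + κ / A) * (kin v + k) ≤ (1 + κ / A) * (kin w + T / κ * M) :=
    mul_le_mul_of_nonneg_left hvk hc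
  have b3 := mul_le_mul_of_nonneg_left hvq hκ0.le
  have b4 : κ * (8 * M * k) ≤ κ / A * k := by
    have h1 : 8 * M ≤ 1 / A := by
      have : 1 / A = 8 * (1 / (8 * A)) := by field_simp
      linarith
    have h2 := mul_le_mul_of_nonneg_left (mul_le_mul_of_nonneg_right h1 hk) hκ0.le
    exact h2.trans (le_of_eq (by ring))
  have b5 : (1 + κ / A) * (T / κ * M) ≤ (1 + 1 / A) * T * M := by
    have h1 : (1 + κ / A) * (T / κ * M) = (1 / κ + 1 / A) * (T * M) := by
      field_simp
    have h2 : 1 / κ ≤ 1 := by rw [div_le_one hκ0]; exact hκ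
    rw [h1, mul_assoc]
    exact mul_le_mul_of_nonneg_right (by linarith) (by positivity)
  have b6 : κ * (2 * (T / κ) * M ^ 2) = 2 * T * M ^ 2 := by field_simp
  have e1 : reducedEnergy A κ w = (1 + κ / A) * kin w - κ * (1 / 2 * quart w) + 1 / 2 * logE w := by
    rw [reducedEnergy]; ring
  rw [reducedEnergy_unitize hm0 A κ, e1]
  linarith

lemma le_add_of_sq_mul_le {Φ U δ m M e B R : ℝ} (hδ : 0 < δ) (hm0 : 0 < m) (hm1 : m ≤ 1)
    (hm : 1 - M ≤ m) (hΦ : Φ ≤ U) (hB : B ≤ Φ + δ / 2) (hR : m ^ 2 * R ≤ B + e)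
    (he : e + 2 * δ * M + 2 * |U| * M < δ / 2) : R ≤ Φ + δ := by
  by_contra! hcon
  have h1 : m ^ 2 * (Φ + δ) < m ^ 2 * R :=
    mul_lt_mul_of_pos_left hcon (by positivity)
  have h2 : 1 - m ^ 2 ≤ 2 * M := by nlinarith
  have h3 : 0 ≤ 1 - m ^ 2 := by nlinarith
  have h4 : Φ * (1 - m ^ 2) ≤ |U| * (2 * M) :=
    (mul_le_mul_of_nonneg_right (hΦ.trans (le_abs_self U)) h3).trans
      (mul_le_mul_of_nonneg_left h2 (abs_nonneg _))
  have h5 := mul_le_mul_of_nonneg_left h2 hδ.le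
  linarith

/-- Near-minimizers of the reduced energy supported in balls of radius `r √κ`. -/
lemma IsGroundState.eventually_exists_near_minimizer {Q : Plane → ℝ} (hQ : IsGroundState Q)
    (h : GNBound (mass Q)) {δ r : ℝ} (hδ : 0 < δ) (hr : 0 < r) :
    ∀ᶠ κ in atTop, ∃ v : Plane → ℝ, IsCore v ∧ mass v = 1 ∧
      (∀ x, r * Real.sqrt κ ≤ ‖x‖ → v x = 0) ∧
      reducedEnergy (mass Q) κ v ≤ reducedInf (mass Q) κ + δ := by
  have hA := hQ.mass_pos
  set A := mass Q with hAdef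
  obtain ⟨C, hC⟩ := exists_truncation
  set U : ℝ := 1 + 1 / 2 * logE Q / A ^ 2 with hU
  set E : ℝ := U + δ / 2 + kernelNorm / (4 * A) with hE
  set N : ℝ := kernelNorm + 4 * E / A with hN
  set T : ℝ := 4 * C ^ 2 / r ^ 2 with hT
  set M : ℝ → ℝ := fun κ => (2 * E + 1) / Real.log (r * Real.sqrt κ / 2) with hM
  have hT0 : 0 ≤ T := by positivity
  have hR : Tendsto (fun κ => r * Real.sqrt κ / 2) atTop atTop :=
    (Real.tendsto_sqrt_atTop.const_mul_atTop hr).atTop_div_const two_pos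
  have hM0 : Tendsto M atTop (𝓝 0) := (Real.tendsto_log_atTop.comp hR).const_div_atTop _
  have herr : Tendsto (fun κ => (1 + 1 / A) * T * M κ + 2 * T * M κ ^ 2 + 1 / 2 * N * M κ +
      2 * δ * M κ + 2 * |U| * M κ) atTop (𝓝 0) := by
    have := ((((hM0.const_mul ((1 + 1 / A) * T)).add ((hM0.pow 2).const_mul (2 * T))).add
      (hM0.const_mul (1 / 2 * N))).add (hM0.const_mul (2 * δ))).add (hM0.const_mul (2 * |U|))
    simpa using this
  filter_upwards [hR.eventually_gt_atTop 1, eventually_ge_atTop 1,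
    herr.eventually (gt_mem_nhds (half_pos hδ)),
    hM0.eventually (gt_mem_nhds (by positivity : 0 < 1 / (8 * A))),
    hM0.eventually (gt_mem_nhds one_pos)] with κ hκR hκ1 hκe hκM hκM1
  have hκ0 : 0 < κ := by linarith
  obtain ⟨_, ⟨w₀, ⟨hw₀, hw₀m⟩, rfl⟩, hw₀e⟩ := exists_lt_of_csInf_lt
    (hQ.admissible.exists_unit hA A κ) (lt_add_of_pos_right (reducedInf A κ) (half_pos hδ))
  have hΦU : reducedInf A κ ≤ U := hQ.reducedInf_le h hκ0.le
  obtain ⟨z, hz⟩ := hw₀.exists_centered hw₀m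
  have hlow := reducedEnergy_ge hA h hκ0.le hw₀ hw₀m
  set w : Plane → ℝ := fun x => w₀ (x + z) with hwdef
  have hw : IsCore w := hw₀.translate z
  have hwm : mass w = 1 := (mass_translate w₀ z).trans hw₀m
  have hwe : reducedEnergy A κ w = reducedEnergy A κ w₀ := by
    simp only [reducedEnergy, hwdef, kin_translate, quart_translate, logE_translate]
  have hkE : kin w ≤ 2 * E := by
    rw [show kin w = kin w₀ from kin_translate w₀ z]
    linarith [plusE_nonneg w₀]
  have hqE : quart w ≤ 4 * E / A := by
    have h1 := h.half_quart_le hA hw hwm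
    have h2 : kin w / A ≤ 2 * E / A := div_le_div_of_nonneg_right hkE hA.le
    have h3 : 4 * E / A = 2 * (2 * E / A) := by ring
    linarith
  have hE0 : 0 ≤ E := by linarith [kin_nonneg w]
  have hMpos : 0 ≤ M κ := div_nonneg (by linarith) (Real.log_pos hκR).le
  have htail : ∫ x in {x : Plane | r * Real.sqrt κ / 2 < ‖x‖}, w x ^ 2 ≤ M κ :=
    hw.tail_le hκR (hz.trans (by linarith [kin_nonneg w₀]))
  obtain ⟨v, k, hv, hvs, hk0, hvm1, hvm, hvk, hvq, hvl⟩ :=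
    hC w hw hwm (r * Real.sqrt κ / 2) (M κ) (by linarith) htail
  have hCR : (C / (r * Real.sqrt κ / 2)) ^ 2 = T / κ := by
    rw [div_pow, div_pow, mul_pow, Real.sq_sqrt hκ0.le, hT]
    field_simp
    ring
  rw [hCR] at hvk hvq
  have hm0 : 0 < mass v := by linarith
  refine ⟨unitize v, hv.unitize, mass_unitize hm0, fun x hx => ?_, ?_⟩
  · unfold unitize
    rw [hvs x (by linarith), mul_zero]
  have hNM : (kernelNorm + quart w) * M κ ≤ N * M κ :=
    mul_le_mul_of_nonneg_right (by linarith) hMpos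
  have hmain := reducedEnergy_truncation_le hA hκ1 hT0 hMpos hκM.le hm0 hvm1 hk0 hvk hvq
    (hvl.trans (add_le_add_right hNM _))
  exact le_add_of_sq_mul_le hδ hm0 hvm1 hvm hΦU (hwe.trans_le hw₀e.le) hmain hκe

lemma tendsto_quarter_of_log_le {ι : Type*} {F : Filter ι} {Y : ι → ℝ}
    (h : ∀ τ : ℝ, 0 < τ → ∀ ε : ℝ, 0 < ε →
      ∀ᶠ a in F, 1 / 2 * Real.log τ - ε ≤ (τ ^ 2 - 1) * Y a) :
    Tendsto Y F (𝓝 (1 / 4)) := by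
  have hc : ContinuousAt (fun τ : ℝ => 1 / (2 * τ * (τ + 1))) 1 :=
    continuousAt_const.div (by fun_prop) (by norm_num)
  have hc1 : (1 : ℝ) / (2 * 1 * (1 + 1)) = 1 / 4 := by norm_num
  rw [ContinuousAt, hc1] at hc
  refine tendsto_order.2 ⟨fun l hl => ?_, fun l hl => ?_⟩
  · obtain ⟨τ, h1, h2⟩ := (((hc.mono_left nhdsWithin_le_nhds).eventually (lt_mem_nhds hl)).and
      (self_mem_nhdsWithin (s := Ioi (1 : ℝ)))).exists
    have hτ : 1 < τ := h2
    have hτ2 : 0 < τ ^ 2 - 1 := by nlinarith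
    set p := 1 / (2 * τ * (τ + 1)) with hp
    have hlog : (τ ^ 2 - 1) * p ≤ 1 / 2 * Real.log τ := by
      have h3 := Real.one_sub_inv_le_log_of_pos (by linarith : 0 < τ)
      have h4 : (τ ^ 2 - 1) * p = 1 / 2 * (1 - τ⁻¹) := by
        rw [hp]; field_simp; ring
      linarith
    filter_upwards [h τ (by linarith) ((τ ^ 2 - 1) * (p - l) / 2)
      (by have := sub_pos.2 h1; positivity)] with a ha
    have h5 : 0 < (τ ^ 2 - 1) * (p - l) := mul_pos hτ2 (sub_pos.2 h1)
    have h6 : (τ ^ 2 - 1) * l < (τ ^ 2 - 1) * Y a := by linarith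
    exact lt_of_mul_lt_mul_left h6 hτ2.le
  · obtain ⟨τ, ⟨h1, h2⟩, h0⟩ := (((hc.mono_left nhdsWithin_le_nhds).eventually (gt_mem_nhds hl)).and
      (self_mem_nhdsWithin (s := Iio (1 : ℝ)))).and
      (mem_nhdsWithin_of_mem_nhds (lt_mem_nhds (zero_lt_one' ℝ))) |>.exists
    have hτ : τ < 1 := h2
    have hτ0 : 0 < τ := h0
    have hτ2 : 0 < 1 - τ ^ 2 := by nlinarith
    set p := 1 / (2 * τ * (τ + 1)) with hp
    have hlog : -((1 - τ ^ 2) * p) ≤ 1 / 2 * Real.log τ := by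
      have h3 := Real.one_sub_inv_le_log_of_pos hτ0
      have h4 : -((1 - τ ^ 2) * p) = 1 / 2 * (1 - τ⁻¹) := by
        rw [hp]; field_simp; ring
      linarith
    filter_upwards [h τ hτ0 ((1 - τ ^ 2) * (l - p) / 2)
      (by have := sub_pos.2 h1; positivity)] with a ha
    have h5 : 0 < (1 - τ ^ 2) * (l - p) := mul_pos hτ2 (sub_pos.2 h1)
    have h6 : (1 - τ ^ 2) * Y a < (1 - τ ^ 2) * l := by linarith
    exact lt_of_mul_lt_mul_left h6 hτ2.le

/-- The energy of a minimizer is bounded above by the reduced energy of a rescaled profile. -/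
lemma IsMinimizer.Ea_le {V : Plane → ℝ} (hV : V110 V) {Ω a : ℝ} {u : Plane → ℂ}
    (hu : IsMinimizer V Ω a u) (ha : 0 < a) {A κ δ r : ℝ} (hκ : 0 < κ) (hκa : 1 + κ / A = κ / a)
    (hr : ∀ x, ‖x‖ ≤ r → V x ≤ δ) {v : Plane → ℝ} (hv : IsCore v) (hm : mass v = 1)
    (hs : ∀ x, r * Real.sqrt κ ≤ ‖x‖ → v x = 0) :
    Ea V Ω u ≤ a ^ 2 * (reducedEnergy A κ v - 1 / 4 * Real.log κ) + δ * a := by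
  have hκs := Real.sqrt_pos.2 hκ
  have hf := (hv.dilate hκs).const_mul (Real.sqrt a)
  have ha2 : Real.sqrt a ^ 2 = a := Real.sq_sqrt ha.le
  have ha4 : Real.sqrt a ^ 4 = a ^ 2 := by
    rw [show (4 : ℕ) = 2 * 2 by norm_num, pow_mul, ha2]
  have hmf : mass (fun x => Real.sqrt a * (Real.sqrt κ * v (Real.sqrt κ • x))) = a := by
    rw [mass_const_mul, mass_dilate v hκs, hm, ha2, mul_one]
  have h1 := hu.le_core hV hf hmf (C := δ) fun x hx => by
    refine hr x ?_
    by_contra! hcon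
    refine hx ?_
    rw [hs, mul_zero, mul_zero]
    rw [norm_smul, Real.norm_eq_abs, abs_of_pos hκs, mul_comm]
    exact mul_le_mul_of_nonneg_left hcon.le hκs.le
  rw [kin_const_mul (Real.sqrt a) (fun x => Real.sqrt κ * v (Real.sqrt κ • x)),
    quart_const_mul (Real.sqrt a) (fun x => Real.sqrt κ * v (Real.sqrt κ • x)),
    logE_const_mul (Real.sqrt a) (fun x => Real.sqrt κ * v (Real.sqrt κ • x)),
    kin_dilate v hκs, quart_dilate v hκs, hv.hasFiniteEnergy.logE_dilate hκs, ha2, ha4,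
    Real.sq_sqrt hκ.le, hm, Real.log_sqrt hκ.le] at h1
  refine h1.trans (le_of_eq ?_)
  have h2 : reducedEnergy A κ v = (1 + κ / A) * kin v - κ * (1 / 2 * quart v) + 1 / 2 * logE v := by
    rw [reducedEnergy]; ring
  rw [h2, hκa]
  field_simp
  ring

/-- The energy of a minimizer is bounded below through the reduced infimum. -/
lemma IsMinimizer.reducedInf_mul_le {V : Plane → ℝ} (hV : V110 V) {Ω a : ℝ}
    (hVΩ : ∀ x : Plane, 0 ≤ V x - Ω ^ 2 / 4 * ‖x‖ ^ 2) {u : Plane → ℂ}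
    (hu : IsMinimizer V Ω a u) (ha : 0 < a) {A κ τ : ℝ} (hA : 0 < A) (hκ : 0 < κ)
    (hκa : 1 + κ / A = κ / a) (h : GNBound A) (hτ : 0 < τ) :
    reducedInf A (κ / τ ^ 2) * a ^ 2 ≤ Ea V Ω u +
      (τ ^ 2 - 1) * (a / κ) * (∫ x, gradAbsSq u x) - 1 / 2 * a ^ 2 * Real.log τ +
        1 / 4 * a ^ 2 * Real.log κ := by
  have hlow := hu.1.1.le_Ea hV hVΩ
  have hf := hu.1.1.admissible hV
  have hm : mass (fun x => ‖u x‖) = a := hu.1.2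
  have hκs := Real.sqrt_pos.2 hκ
  have h1 := hf.reducedInf_mul_le hA h (κ := κ / τ ^ 2) (by positivity)
    (τ := τ / Real.sqrt κ) (by positivity) (by rw [hm]; exact ha)
  rw [hm, div_pow, Real.sq_sqrt hκ.le, Real.log_div hτ.ne' hκs.ne', Real.log_sqrt hκ.le] at h1
  refine h1.trans ?_
  have e1 : τ ^ 2 / κ * ((1 + κ / τ ^ 2 / A) * kin (fun x => ‖u x‖) * a -
      κ / τ ^ 2 * (1 / 2 * quart fun x => ‖u x‖)) =
      (τ ^ 2 - 1) * (a / κ) * kin (fun x => ‖u x‖) +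
        (a / κ * (1 + κ / A)) * kin (fun x => ‖u x‖) - 1 / 2 * quart fun x => ‖u x‖ := by
    field_simp
    ring
  have e2 : a / κ * (κ / a) = 1 := by field_simp
  rw [e1, hκa, e2]
  have e3 : (∫ x, gradAbsSq u x) = kin (fun x => ‖u x‖) := rfl
  rw [e3]
  linarith

/-- The blow-up rate of the kinetic energy of the modulus. -/
lemma tendsto_kinetic {V : Plane → ℝ} {Ω α : ℝ} {Q : Plane → ℝ} (hV : V110 V)
    (hCV : CondV V Ω α) (hQ : IsGroundState Q) {u : ℝ → Plane → ℂ}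
    (hmin : ∀ a ∈ Ioo (0 : ℝ) (mass Q), IsMinimizer V Ω a (u a)) :
    Tendsto (fun a => (∫ x, gradAbsSq (u a) x) * (mass Q - a) / (a ^ 2 * mass Q))
      (𝓝[<] (mass Q)) (𝓝 (1 / 4)) := by
  have hA := hQ.mass_pos
  set A := mass Q with hAdef
  have hGN : GNBound A := fun f hf => hf.gagliardo_nirenberg hV hA hmin
  obtain ⟨l, hl⟩ := hQ.exists_tendsto_reducedInf hGN
  have hid : Tendsto (fun a : ℝ => a) (𝓝[<] A) (𝓝 A) := nhdsWithin_le_nhds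
  have hsub : Tendsto (fun a => A - a) (𝓝[<] A) (𝓝[>] 0) := by
    refine tendsto_nhdsWithin_iff.2 ⟨by simpa using (tendsto_const_nhds (x := A)).sub hid, ?_⟩
    filter_upwards [self_mem_nhdsWithin] with a ha
    exact sub_pos.2 (mem_Iio.1 ha)
  have hκ : Tendsto (fun a => a * A * (A - a)⁻¹) (𝓝[<] A) atTop :=
    (hid.mul_const A).pos_mul_atTop (by positivity) (tendsto_inv_nhdsGT_zero.comp hsub)
  refine tendsto_quarter_of_log_le fun τ hτ ε hε => ?_
  set δ := ε / (2 * (1 + 2 / A)) with hδ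
  have hδ0 : 0 < δ := by positivity
  obtain ⟨r, hr0, hr⟩ := hCV.exists_le hδ0
  have hdiff : Tendsto (fun a => reducedInf A (a * A * (A - a)⁻¹) -
      reducedInf A (a * A * (A - a)⁻¹ / τ ^ 2)) (𝓝[<] A) (𝓝 0) := by
    have := (hl.comp hκ).sub (hl.comp (hκ.atTop_div_const (by positivity : 0 < τ ^ 2)))
    simpa using this
  filter_upwards [hκ.eventually (hQ.eventually_exists_near_minimizer hGN hδ0 hr0),
    hdiff.eventually (gt_mem_nhds (half_pos hε)), self_mem_nhdsWithin,
    hid.eventually (lt_mem_nhds (half_lt_self hA))] with a hv hd haA ha2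
  have haA' : a < A := haA
  have ha : 0 < a := by linarith
  obtain ⟨v, hvc, hvm, hvs, hve⟩ := hv
  set κ := a * A * (A - a)⁻¹ with hκdef
  have hAa : 0 < A - a := sub_pos.2 haA'
  have hκ0 : 0 < κ := by positivity
  have hκa : 1 + κ / A = κ / a := by
    rw [hκdef]; field_simp; ring
  have hm := hmin a ⟨ha, haA'⟩
  have up := hm.Ea_le hV ha hκ0 hκa hr hvc hvm hvs
  have lo := hm.reducedInf_mul_le hV hCV.2.1 ha hA hκ0 hκa hGN hτ
  set K := ∫ x, gradAbsSq (u a) x with hK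
  have hY : K * (A - a) / (a ^ 2 * A) = (a / κ * K) / a ^ 2 := by
    rw [hκdef]; field_simp
  have hup := mul_le_mul_of_nonneg_left hve (sq_nonneg a)
  have key : a ^ 2 * (1 / 2 * Real.log τ - (reducedInf A κ - reducedInf A (κ / τ ^ 2)) - δ) -
      δ * a ≤ (τ ^ 2 - 1) * (a / κ * K) := by
    linarith
  have hδa : δ * a ≤ a ^ 2 * (δ * (2 / A)) := by
    have : a ≤ a ^ 2 * (2 / A) := by
      rw [mul_div_assoc', le_div_iff₀ hA]
      nlinarith
    have := mul_le_mul_of_nonneg_left this hδ0.le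
    linarith
  have hδε : δ + δ * (2 / A) = ε / 2 := by
    rw [hδ]; field_simp
  rw [hY, mul_div_assoc', le_div_iff₀ (by positivity)]
  have h3 : a ^ 2 * (1 / 2 * Real.log τ - ε) ≤
      a ^ 2 * (1 / 2 * Real.log τ - (reducedInf A κ - reducedInf A (κ / τ ^ 2)) -
        (δ + δ * (2 / A))) :=
    mul_le_mul_of_nonneg_left (by linarith) (sq_nonneg a)
  linarith

theorem eps_asymptotics
    (V : Plane → ℝ) (Ω α : ℝ) (Q : Plane → ℝ)
    (hV : V110 V) (hΩ : 0 < Ω) (hsub : SubCritical V Ω) (hCV : CondV V Ω α)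
    (hQ : IsGroundState Q)
    (astar : ℝ) (hastar : astar = ∫ x : Plane, (Q x) ^ 2)
    (u : ℝ → Plane → ℂ)
    (hmin : ∀ a ∈ Ioo (0 : ℝ) astar, IsMinimizer V Ω a (u a))
 :
    Tendsto
      (fun a => (epsOf u a - 2 / astar * Real.sqrt ((astar - a) / astar)) /
        Real.sqrt (astar - a))
      (𝓝[<] astar) (𝓝 0) := by
  obtain rfl : astar = mass Q := hastar
  have hA := hQ.mass_pos
  have hkin := tendsto_kinetic hV hCV hQ hmin
  set A := mass Q
  have hid : Tendsto (fun a : ℝ => a) (𝓝[<] A) (𝓝 A) := nhdsWithin_le_nhds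
  have hlim := ((hkin.mul ((hid.pow 2).mul_const A)).rpow_const (p := -(1 : ℝ) / 2)
    (Or.inl (by positivity))).sub_const (2 / A / Real.sqrt A)
  have hval : (1 / 4 * (A ^ 2 * A)) ^ (-(1 : ℝ) / 2) - 2 / A / Real.sqrt A = 0 := by
    rw [neg_div, Real.rpow_neg (by positivity), ← Real.sqrt_eq_rpow,
      show 1 / 4 * (A ^ 2 * A) = (A / 2) ^ 2 * A by ring, Real.sqrt_mul (by positivity),
      Real.sqrt_sq (by positivity), sub_eq_zero]
    field_simp
  rw [hval] at hlim
  refine hlim.congr' ?_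
  filter_upwards [self_mem_nhdsWithin, hid.eventually (lt_mem_nhds hA)] with a ha ha0
  have hAa : 0 < A - a := sub_pos.2 (mem_Iio.1 ha)
  have hK : 0 ≤ ∫ x, gradAbsSq (u a) x := integral_nonneg fun x => sq_nonneg _
  have hs := Real.sqrt_pos.2 hAa
  have hsA := Real.sqrt_pos.2 hA
  have h1 : (∫ x, gradAbsSq (u a) x) * (A - a) / (a ^ 2 * A) * (a ^ 2 * A) =
      (∫ x, gradAbsSq (u a) x) * (A - a) := by
    field_simp
  rw [h1, Real.mul_rpow hK hAa.le, epsOf, Real.sqrt_div hAa.le]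
  have h2 : (A - a) ^ (-(1 : ℝ) / 2) = (Real.sqrt (A - a))⁻¹ := by
    rw [neg_div, Real.rpow_neg hAa.le, ← Real.sqrt_eq_rpow]
  rw [h2]
  field_simp

end
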